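/- For every $c\in(a,b)$, the transformation $f\mapsto \hat f$, $\hat f(z) = \int_a^b \phi_z(x) f(x)\, r(x)\,dx$, restricted to $L^2_0((a,c); r\,dx)$ (square-integrable functions vanishing a.e. outside $(a,c)$), is a unitary map onto the de Branges space $\mathfrak{B}(c)$. -/

import Mathlib

open MeasureTheory Set Filter Complex Topology ComplexConjugate

noncomputable section

/-- `f` is locally absolutely continuous on `(a,b)` with a.e. derivative `g`,
encoded via the integral representation. -/
def HasACDeriv (a b : ℝ) (f g : ℝ → ℂ) : Prop :=
  ∀ x ∈ Set.Ioo a b, ∀ y ∈ Set.Ioo a b,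
    IntervalIntegrable g volume y x ∧ f x = f y + ∫ t in y..x, g t

/-- `f` lies in the domain `𝔇_τ` with first quasi-derivative `fq = p (f' + s f)` and
`τ f = w`, encoded via the equivalent first order system
`(f, f^{[1]})' = ((-s, 1/p), (q - 0·r, s)) (f, f^{[1]}) - (0, r·w)`. -/
structure SLSys (a b : ℝ) (p q r s : ℝ → ℝ) (f fq w : ℝ → ℂ) : Prop where
  fst : HasACDeriv a b f fun x => fq x / (p x : ℂ) - (s x : ℂ) * f x
  snd : HasACDeriv a b fq fun x => (s x : ℂ) * fq x + (q x : ℂ) * f x - (r x : ℂ) * w x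

/-- Standing hypothesis on the coefficients `p, q, r, s` on `(a,b)`:
real-valued and measurable, `p⁻¹, q, r, s ∈ L¹_loc((a,b))`, `p ≠ 0` and `r > 0` a.e. -/
structure SLHyp (a b : ℝ) (p q r s : ℝ → ℝ) : Prop where
  lt : a < b
  mp : Measurable p
  mq : Measurable q
  mr : Measurable r
  ms : Measurable s
  ip : ∀ x ∈ Set.Ioo a b, ∀ y ∈ Set.Ioo a b,
    IntervalIntegrable (fun t => (p t)⁻¹) volume y x
  iq : ∀ x ∈ Set.Ioo a b, ∀ y ∈ Set.Ioo a b, IntervalIntegrable q volume y x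
  ir : ∀ x ∈ Set.Ioo a b, ∀ y ∈ Set.Ioo a b, IntervalIntegrable r volume y x
  is' : ∀ x ∈ Set.Ioo a b, ∀ y ∈ Set.Ioo a b, IntervalIntegrable s volume y x
  pne : ∀ᵐ t ∂(volume.restrict (Set.Ioo a b)), p t ≠ 0
  rpos : ∀ᵐ t ∂(volume.restrict (Set.Ioo a b)), 0 < r t

/-- The modified Wronskian `W(f,g)(x) = f(x) g^{[1]}(x) - f^{[1]}(x) g(x)`. -/
def Wr (f fq g gq : ℝ → ℂ) (x : ℝ) : ℂ := f x * gq x - fq x * g x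
/-- A non-trivial real entire solution family `φ_z` of `(τ - z) u = 0` (with quasi-derivative
family `φq`) which lies in the domain of `S` near `a`: square integrable near `a`
w.r.t. `r dx` and satisfying the boundary condition at `a`, the latter encoded through
the vanishing at `a` of the Wronskians of members of the family. -/
structure RealEntireSolFam (a b : ℝ) (p q r s : ℝ → ℝ) (φ φq : ℂ → ℝ → ℂ) : Prop where
  sol : ∀ z : ℂ, SLSys a b p q r s (φ z) (φq z) fun x => z * φ z x
  entire : ∀ x ∈ Set.Ioo a b,
    (Differentiable ℂ fun z => φ z x) ∧ Differentiable ℂ fun z => φq z x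
  real : ∀ z : ℂ, ∀ x ∈ Set.Ioo a b,
    φ (conj z) x = conj (φ z x) ∧ φq (conj z) x = conj (φq z x)
  nontriv : ∀ z : ℂ, ∃ x ∈ Set.Ioo a b, φ z x ≠ 0 ∨ φq z x ≠ 0
  sqint : ∀ z : ℂ, ∀ c ∈ Set.Ioo a b,
    IntegrableOn (fun x => ‖φ z x‖ ^ 2 * r x) (Set.Ioo a c)
  bc : ∀ z ζ : ℂ, Tendsto (Wr (φ z) (φq z) (φ ζ) (φq ζ)) (𝓝[>] a) (𝓝 0)

/-- The de Branges function `E(z,c) = φ_z(c) + i φ_z^{[1]}(c)`. -/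
def dBE (φ φq : ℂ → ℝ → ℂ) (c : ℝ) (z : ℂ) : ℂ := φ z c + Complex.I * φq z c
/-- The open upper complex half-plane. -/
def UHP : Set ℂ := {z : ℂ | 0 < z.im}

/-- `N` is of bounded type in `ℂ₊`: a quotient of two bounded analytic functions. -/
def OfBoundedType (N : ℂ → ℂ) : Prop :=
  ∃ u v : ℂ → ℂ, DifferentiableOn ℂ u UHP ∧ DifferentiableOn ℂ v UHP ∧
    (∃ C : ℝ, ∀ z ∈ UHP, ‖u z‖ ≤ C) ∧ (∃ C : ℝ, ∀ z ∈ UHP, ‖v z‖ ≤ C) ∧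
    ∀ z ∈ UHP, v z ≠ 0 ∧ N z = u z / v z

/-- `N` has non-positive mean type: `limsup_{y→∞} ln |N(iy)| / y ≤ 0`. -/
def NonposMeanType (N : ℂ → ℂ) : Prop :=
  Filter.limsup (fun y : ℝ => Real.log ‖N ((y : ℂ) * Complex.I)‖ / y) Filter.atTop ≤ 0

/-- Membership in the de Branges space `𝔅` associated with the de Branges function `E`. -/
def MemDB (E F : ℂ → ℂ) : Prop :=
  Differentiable ℂ F ∧
  Integrable (fun t : ℝ => ‖F (t : ℂ)‖ ^ 2 / ‖E (t : ℂ)‖ ^ 2) ∧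
  OfBoundedType (fun z => F z / E z) ∧ NonposMeanType (fun z => F z / E z) ∧
  OfBoundedType (fun z => conj (F (conj z)) / E z) ∧
  NonposMeanType (fun z => conj (F (conj z)) / E z)

/-- The squared norm of the de Branges space with de Branges function `E`. -/
def DBnormSq (E F : ℂ → ℂ) : ℝ :=
  (1 / Real.pi) * ∫ t : ℝ, ‖F (t : ℂ)‖ ^ 2 / ‖E (t : ℂ)‖ ^ 2

/-- The inner product of the de Branges space with de Branges function `E`. -/
def DBinner (E F G : ℂ → ℂ) : ℂ :=
  ((1 / Real.pi : ℝ) : ℂ) * ∫ t : ℝ, F (t : ℂ) * conj (G (t : ℂ)) / ((‖E (t : ℂ)‖ : ℂ) ^ 2)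

/-- The kernel `K(ζ,z,c) = ∫_a^c φ_z(x) conj (φ_ζ(x)) r(x) dx`. -/
def dBK (a c : ℝ) (r : ℝ → ℝ) (φ : ℂ → ℝ → ℂ) (ζ z : ℂ) : ℂ :=
  ∫ x in Set.Ioo a c, φ z x * conj (φ ζ x) * (r x : ℂ)

/-- The transform `f ↦ f̂`, `f̂(z) = ∫_a^b φ_z(x) f(x) r(x) dx`. -/
def hatT (a b : ℝ) (r : ℝ → ℝ) (φ : ℂ → ℝ → ℂ) (f : ℝ → ℂ) (z : ℂ) : ℂ :=
  ∫ x in Set.Ioo a b, φ z x * f x * (r x : ℂ)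

/-! ### Cauchy's theorem in the half-plane -/

theorem isOpen_uhp : IsOpen {z : ℂ | 0 < z.im} := isOpen_lt continuous_const Complex.continuous_im

theorem half_plane_integral_zero {H : ℂ → ℂ} (hd : DifferentiableOn ℂ H {z | 0 < z.im})
    (hc : ContinuousOn H {z | 0 ≤ z.im}) {C R₀ : ℝ}
    (hC : ∀ z : ℂ, 0 ≤ z.im → R₀ ≤ ‖z‖ → ‖H z‖ ≤ C / ‖z‖ ^ 2)
    (hIntg : Integrable (fun t : ℝ => H t)) : ∫ t : ℝ, H t = 0 := by
  have hC0 : 0 ≤ C := by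
    have h1 := hC ((|R₀| + 1 : ℝ) : ℂ) (by simp) (by
      rw [Complex.norm_real, Real.norm_eq_abs, abs_of_nonneg (by positivity)]
      linarith [le_abs_self R₀])
    by_contra hneg
    have : C / ‖((|R₀| + 1 : ℝ) : ℂ)‖ ^ 2 < 0 := by
      apply div_neg_of_neg_of_pos (not_le.mp hneg)
      rw [Complex.norm_real, Real.norm_eq_abs, abs_of_nonneg (by positivity)]
      positivity
    linarith [norm_nonneg (H ((|R₀| + 1 : ℝ) : ℂ))]
  have key : ∀ R : ℝ, 0 < R → R₀ ≤ R → ‖∫ x in (-R)..R, H x‖ ≤ 4 * C / R := by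
    intro R hR hRR
    have hrect := Complex.integral_boundary_rect_eq_zero_of_continuousOn_of_differentiableOn H
      ((-R : ℝ) : ℂ) ((R : ℂ) + R * I)
      (hc.mono (by
        intro z hz
        rw [mem_reProdIm] at hz
        have := hz.2
        simp [uIcc_of_le hR.le] at this
        exact this.1))
      (hd.mono (by
        intro z hz
        rw [mem_reProdIm] at hz
        have := hz.2
        simp [hR.le] at this
        exact this.1))
    simp only [Complex.ofReal_re, Complex.ofReal_im, Complex.add_re, Complex.mul_re, Complex.I_re,
      Complex.I_im, Complex.add_im, Complex.mul_im, mul_zero, mul_one, zero_add, add_zero,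
      sub_zero, Complex.ofReal_zero, zero_mul] at hrect
    have b : ∀ z : ℂ, 0 ≤ z.im → R ≤ ‖z‖ → ‖H z‖ ≤ C / R ^ 2 := by
      intro z hz hzR
      refine (hC z hz (hRR.trans hzR)).trans ?_
      gcongr
    have b1 : ‖∫ x in (-R)..R, H (x + R * I)‖ ≤ C / R ^ 2 * |R - (-R)| := by
      apply intervalIntegral.norm_integral_le_of_norm_le_const
      intro x _
      apply b
      · simp [hR.le]
      · refine le_trans ?_ (Complex.abs_im_le_norm _)
        simp [abs_of_pos hR]
    have b2 : ‖∫ y in (0 : ℝ)..R, H (R + y * I)‖ ≤ C / R ^ 2 * |R - 0| := by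
      apply intervalIntegral.norm_integral_le_of_norm_le_const
      intro x hx
      rw [uIoc_of_le hR.le] at hx
      apply b
      · simp [hx.1.le]
      · refine le_trans ?_ (Complex.abs_re_le_norm _)
        simp [abs_of_pos hR]
    have b3 : ‖∫ y in (0 : ℝ)..R, H (((-R : ℝ) : ℂ) + y * I)‖ ≤ C / R ^ 2 * |R - 0| := by
      apply intervalIntegral.norm_integral_le_of_norm_le_const
      intro x hx
      rw [uIoc_of_le hR.le] at hx
      apply b
      · simp [hx.1.le]
      · refine le_trans ?_ (Complex.abs_re_le_norm _)
        simp [abs_of_pos hR]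
    have e : (∫ x in (-R)..R, H x) = (∫ x in (-R)..R, H (x + R * I))
        - I • (∫ y in (0 : ℝ)..R, H (R + y * I))
        + I • (∫ y in (0 : ℝ)..R, H (((-R : ℝ) : ℂ) + y * I)) := by
      linear_combination hrect
    rw [e]
    refine (norm_add_le _ _).trans ?_
    have := norm_sub_le (∫ x in (-R)..R, H (x + R * I)) (I • (∫ y in (0 : ℝ)..R, H (R + y * I)))
    rw [norm_smul, Complex.norm_I, one_mul] at *
    have e2 : C / R ^ 2 * |R - (-R)| + C / R ^ 2 * |R - 0| + C / R ^ 2 * |R - 0| = 4 * C / R := by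
      rw [sub_neg_eq_add, sub_zero, abs_of_pos hR, abs_of_pos (by linarith : 0 < R + R)]
      field_simp
      ring
    linarith
  have h1 : Tendsto (fun R : ℝ => ∫ x in (-R)..R, H x) atTop (𝓝 (∫ t : ℝ, H t)) :=
    intervalIntegral_tendsto_integral hIntg tendsto_neg_atTop_atBot tendsto_id
  have h2 : Tendsto (fun R : ℝ => ∫ x in (-R)..R, H x) atTop (𝓝 0) := by
    apply squeeze_zero_norm' (a := fun R => 4 * C / R)
    · filter_upwards [eventually_gt_atTop 0, eventually_ge_atTop R₀] with R h1 h2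
      exact key R h1 h2
    · exact tendsto_const_nhds.div_atTop tendsto_id
  exact tendsto_nhds_unique h1 h2

/-- integrability of `1/|t-ζ|^2` -/
theorem integrable_inv_normSq {ζ : ℂ} (hζ : ζ.im ≠ 0) :
    Integrable (fun t : ℝ => (((t - ζ.re) ^ 2 + ζ.im ^ 2)⁻¹ : ℝ)) := by
  have h := ((integrable_inv_one_add_sq).comp_div hζ).comp_sub_right ζ.re
  have h2 := h.const_mul ((ζ.im ^ 2)⁻¹)
  refine h2.congr (Eventually.of_forall fun t => ?_)
  simp only
  rw [← mul_inv]
  congr 1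
  field_simp
  ring

theorem integral_inv_normSq {ζ : ℂ} (hζ : 0 < ζ.im) :
    ∫ t : ℝ, (((t - ζ.re) ^ 2 + ζ.im ^ 2)⁻¹ : ℝ) = Real.pi / ζ.im := by
  have e : (fun t : ℝ => (((t - ζ.re) ^ 2 + ζ.im ^ 2)⁻¹ : ℝ))
      = fun t : ℝ => (ζ.im ^ 2)⁻¹ * (1 + ((t - ζ.re) / ζ.im) ^ 2)⁻¹ := by
    funext t
    rw [← mul_inv]
    congr 1
    field_simp
    ring
  rw [e, integral_const_mul, integral_sub_right_eq_self (fun t : ℝ => (1 + (t / ζ.im) ^ 2)⁻¹) ζ.re,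
    Measure.integral_comp_div (fun t : ℝ => (1 + t ^ 2)⁻¹), integral_univ_inv_one_add_sq]
  rw [abs_of_pos hζ, smul_eq_mul]
  field_simp

theorem norm_real_sub_sq (t : ℝ) (ζ : ℂ) : ‖(t : ℂ) - ζ‖ ^ 2 = (t - ζ.re) ^ 2 + ζ.im ^ 2 := by
  rw [← Complex.normSq_eq_norm_sq, Complex.normSq_apply]
  simp
  ring

theorem real_sub_ne {ζ : ℂ} (hζ : ζ.im ≠ 0) (t : ℝ) : (t : ℂ) - ζ ≠ 0 := by
  intro h
  apply hζ
  have := congrArg Complex.im h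
  simpa using this

theorem memLp_inv_sub {ζ : ℂ} (hζ : ζ.im ≠ 0) : MemLp (fun t : ℝ => ((t : ℂ) - ζ)⁻¹) 2 := by
  have hcont : Continuous (fun t : ℝ => ((t : ℂ) - ζ)⁻¹) :=
    (Complex.continuous_ofReal.sub continuous_const).inv₀ (real_sub_ne hζ)
  rw [memLp_two_iff_integrable_sq_norm hcont.aestronglyMeasurable]
  refine (integrable_inv_normSq hζ).congr (Eventually.of_forall fun t => ?_)
  simp only
  rw [norm_inv, inv_pow, norm_real_sub_sq]

/-- product of two L² functions is integrable -/
theorem L2_mul_integrable {α : Type*} [MeasurableSpace α] {μ : Measure α} {f g : α → ℂ}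
    (hf : MemLp f 2 μ) (hg : MemLp g 2 μ) : Integrable (fun x => f x * g x) μ :=
  hf.integrable_mul hg

theorem uhp_sub_conj_ne {z ζ : ℂ} (hz : 0 ≤ z.im) (hζ : 0 < ζ.im) : z - conj ζ ≠ 0 := by
  intro h
  have := congrArg Complex.im h
  simp at this
  linarith

/-- a continuous function on the real line that is `O(1/t)` is in L² -/
theorem memLp_of_decay {G : ℂ → ℂ} (hc : ContinuousOn G {z | 0 ≤ z.im}) {C R₀ : ℝ}
    (hG : ∀ z : ℂ, 0 ≤ z.im → R₀ ≤ ‖z‖ → ‖G z‖ ≤ C / ‖z‖) :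
    MemLp (fun t : ℝ => G t) 2 := by
  have hcont : Continuous (fun t : ℝ => G t) :=
    hc.comp_continuous Complex.continuous_ofReal (fun t => by simp)
  rw [memLp_two_iff_integrable_sq_norm hcont.aestronglyMeasurable]
  obtain ⟨B, hB⟩ := (isCompact_Icc (a := -(|R₀| + 1)) (b := |R₀| + 1)).exists_bound_of_continuousOn
    hcont.continuousOn
  have hIntg : Integrable (fun t : ℝ => (B ^ 2 * (1 + (|R₀| + 1) ^ 2) + 2 * C ^ 2) * (1 + t ^ 2)⁻¹) :=
    integrable_inv_one_add_sq.const_mul _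
  refine hIntg.mono' (hcont.norm.pow 2).aestronglyMeasurable (Eventually.of_forall fun t => ?_)
  rw [Real.norm_eq_abs, abs_of_nonneg (by positivity), ← div_eq_mul_inv, le_div_iff₀ (by positivity)]
  by_cases ht : |t| ≤ |R₀| + 1
  · have h1 := hB t (abs_le.mp ht)
    have h2 : t ^ 2 ≤ (|R₀| + 1) ^ 2 := by
      rw [← sq_abs t]; gcongr
    have h3 : ‖G t‖ ^ 2 ≤ B ^ 2 := by gcongr
    calc ‖G t‖ ^ 2 * (1 + t ^ 2) ≤ B ^ 2 * (1 + (|R₀| + 1) ^ 2) := by gcongr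
      _ ≤ _ := by nlinarith [sq_nonneg C]
  · push Not at ht
    have h1 := hG t (by simp) (by
      rw [Complex.norm_real, Real.norm_eq_abs]; linarith [le_abs_self R₀])
    rw [Complex.norm_real, Real.norm_eq_abs] at h1
    have ht1 : 1 ≤ |t| := by linarith [abs_nonneg R₀]
    rw [le_div_iff₀ (by linarith)] at h1
    have h3 : (‖G t‖ * |t|) ^ 2 ≤ C ^ 2 := by gcongr
    rw [mul_pow, sq_abs] at h3
    have h4 : 1 ≤ t ^ 2 := by rw [← sq_abs]; nlinarith
    have h5 : ‖G t‖ ^ 2 ≤ ‖G t‖ ^ 2 * t ^ 2 := by nlinarith [sq_nonneg ‖G t‖]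
    have h6 : 0 ≤ B ^ 2 * (1 + (|R₀| + 1) ^ 2) := by positivity
    linarith

theorem norm_sub_ge_half {z ζ : ℂ} (h : 2 * ‖ζ‖ ≤ ‖z‖) : ‖z‖ / 2 ≤ ‖z - ζ‖ := by
  have := norm_sub_norm_le z ζ
  linarith

theorem cauchy_decay_conj {G : ℂ → ℂ} (hd : DifferentiableOn ℂ G {z | 0 < z.im})
    (hc : ContinuousOn G {z | 0 ≤ z.im}) {C R₀ : ℝ}
    (hG : ∀ z : ℂ, 0 ≤ z.im → R₀ ≤ ‖z‖ → ‖G z‖ ≤ C / ‖z‖) {ζ : ℂ} (hζ : 0 < ζ.im) :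
    ∫ t : ℝ, G t / (t - conj ζ) = 0 := by
  apply half_plane_integral_zero (H := fun z => G z / (z - conj ζ))
    (C := 2 * C) (R₀ := max (max R₀ (2 * ‖ζ‖)) 1)
  · apply hd.div (differentiableOn_id.sub_const _)
    intro z hz
    exact uhp_sub_conj_ne (le_of_lt hz) hζ
  · apply hc.div (continuousOn_id.sub continuousOn_const)
    intro z hz
    exact uhp_sub_conj_ne hz hζ
  · intro z hz hR
    have h1 := hG z hz (le_trans (le_trans (le_max_left _ _) (le_max_left _ _)) hR)
    have h2 : ‖z‖ / 2 ≤ ‖z - conj ζ‖ := norm_sub_ge_half (by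
      rw [RCLike.norm_conj]
      exact le_trans (le_trans (le_max_right _ _) (le_max_left _ _)) hR)
    have h3 : 1 ≤ ‖z‖ := (le_max_right _ _).trans hR
    rw [norm_div]
    calc ‖G z‖ / ‖z - conj ζ‖ ≤ (C / ‖z‖) / (‖z‖ / 2) := by
          gcongr
          exact (norm_nonneg _).trans h1
      _ = 2 * C / ‖z‖ ^ 2 := by field_simp
  · simp only [div_eq_mul_inv]
    exact L2_mul_integrable (memLp_of_decay hc hG) (memLp_inv_sub (by simp [hζ.ne']))

theorem cauchy_decay {G : ℂ → ℂ} (hd : DifferentiableOn ℂ G {z | 0 < z.im})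
    (hc : ContinuousOn G {z | 0 ≤ z.im}) {C R₀ : ℝ}
    (hG : ∀ z : ℂ, 0 ≤ z.im → R₀ ≤ ‖z‖ → ‖G z‖ ≤ C / ‖z‖) {ζ : ℂ} (hζ : 0 < ζ.im) :
    ∫ t : ℝ, G t / (t - ζ) = 2 * Real.pi * I * G ζ := by
  set J : ℂ → ℂ := fun z => G z - G ζ * (ζ - conj ζ) / (z - conj ζ) with hJ
  have hJζ : J ζ = 0 := by
    simp only [hJ]
    rw [mul_div_assoc, div_self (uhp_sub_conj_ne hζ.le hζ)]
    ring
  have hζU : {z : ℂ | 0 < z.im} ∈ 𝓝 ζ := isOpen_uhp.mem_nhds hζ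
  have hJd : DifferentiableOn ℂ J {z | 0 < z.im} := by
    apply hd.sub
    apply (differentiableOn_const _).div (differentiableOn_id.sub_const _)
    intro z hz
    exact uhp_sub_conj_ne (le_of_lt hz) hζ
  have hJc : ContinuousOn J {z | 0 ≤ z.im} := by
    apply hc.sub
    apply continuousOn_const.div (continuousOn_id.sub continuousOn_const)
    intro z hz
    exact uhp_sub_conj_ne hz hζ
  have hHd : DifferentiableOn ℂ (dslope J ζ) {z | 0 < z.im} :=
    (Complex.differentiableOn_dslope hζU).mpr hJd
  have hHc : ContinuousOn (dslope J ζ) {z | 0 ≤ z.im} :=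
    (continuousOn_dslope (mem_of_superset hζU fun z (hz : 0 < z.im) => hz.le)).mpr
      ⟨hJc, (hJd.differentiableAt hζU)⟩
  have hds : ∀ z, z ≠ ζ → dslope J ζ z = J z / (z - ζ) := by
    intro z hz
    rw [dslope_of_ne _ hz, slope_def_field, hJζ, sub_zero]
  have hne : ∀ t : ℝ, (t : ℂ) ≠ ζ := by
    intro t h
    rw [← h] at hζ
    simp at hζ
  have hdec : ∀ z : ℂ, 0 ≤ z.im → max (max R₀ (2 * ‖ζ‖)) (‖ζ‖ + 1) ≤ ‖z‖ →
      ‖J z‖ ≤ (C + 2 * ‖G ζ * (ζ - conj ζ)‖) / ‖z‖ := by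
    intro z hz hR
    have h1 := hG z hz (le_trans (le_trans (le_max_left _ _) (le_max_left _ _)) hR)
    have h2 : ‖z‖ / 2 ≤ ‖z - conj ζ‖ := norm_sub_ge_half (by
      rw [RCLike.norm_conj]
      exact le_trans (le_trans (le_max_right _ _) (le_max_left _ _)) hR)
    have h3 : ‖ζ‖ + 1 ≤ ‖z‖ := (le_max_right _ _).trans hR
    have h4 : 0 < ‖z‖ := by linarith [norm_nonneg ζ]
    simp only [hJ]
    refine (norm_sub_le _ _).trans ?_
    rw [norm_div, add_div]
    apply add_le_add h1
    calc ‖G ζ * (ζ - conj ζ)‖ / ‖z - conj ζ‖ ≤ ‖G ζ * (ζ - conj ζ)‖ / (‖z‖ / 2) := by gcongr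
      _ = _ := by field_simp
  have hJL : MemLp (fun t : ℝ => J t) 2 := memLp_of_decay hJc hdec
  have hζ' : ζ.im ≠ 0 := hζ.ne'
  have h0 : ∫ t : ℝ, dslope J ζ t = 0 := by
    apply half_plane_integral_zero hHd hHc (C := 2 * (C + 2 * ‖G ζ * (ζ - conj ζ)‖))
      (R₀ := max (max R₀ (2 * ‖ζ‖)) (‖ζ‖ + 1))
    · intro z hz hR
      have h1 := hdec z hz hR
      have h2 : ‖z‖ / 2 ≤ ‖z - ζ‖ := norm_sub_ge_half
        (le_trans (le_trans (le_max_right _ _) (le_max_left _ _)) hR)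
      have h3 : ‖ζ‖ + 1 ≤ ‖z‖ := (le_max_right _ _).trans hR
      have h4 : 0 < ‖z‖ := by linarith [norm_nonneg ζ]
      rw [hds z (by rintro rfl; linarith), norm_div]
      calc ‖J z‖ / ‖z - ζ‖ ≤ ((C + 2 * ‖G ζ * (ζ - conj ζ)‖) / ‖z‖) / (‖z‖ / 2) := by
            gcongr
            exact (norm_nonneg _).trans h1
        _ = _ := by field_simp
    · refine (L2_mul_integrable hJL (memLp_inv_sub hζ')).congr (Eventually.of_forall fun t => ?_)
      simp only
      rw [hds _ (hne t), div_eq_mul_inv]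
  have hGi : Integrable (fun t : ℝ => G t / (t - ζ)) := by
    simp only [div_eq_mul_inv]
    exact L2_mul_integrable (memLp_of_decay hc hG) (memLp_inv_sub hζ')
  have e2 : ∀ t : ℝ, ((t : ℂ) - conj ζ) * (t - ζ) = (((t - ζ.re) ^ 2 + ζ.im ^ 2 : ℝ) : ℂ) := by
    intro t
    apply Complex.ext <;> simp [Complex.mul_re, Complex.mul_im, pow_two]
    ring
  have hpt : ∀ t : ℝ, dslope J ζ t = G t / (t - ζ)
      - G ζ * (ζ - conj ζ) * ((((t - ζ.re) ^ 2 + ζ.im ^ 2)⁻¹ : ℝ) : ℂ) := by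
    intro t
    rw [hds _ (hne t)]
    simp only [hJ]
    rw [Complex.ofReal_inv, ← e2 t]
    have h1 := real_sub_ne hζ' t
    have h2 := real_sub_ne (ζ := conj ζ) (by simpa using hζ') t
    field_simp
  simp_rw [hpt] at h0
  have hi : Integrable (fun t : ℝ => ((((t - ζ.re) ^ 2 + ζ.im ^ 2)⁻¹ : ℝ) : ℂ)) :=
    (integrable_inv_normSq hζ').ofReal
  rw [integral_sub hGi (hi.const_mul _), integral_const_mul,
    integral_complex_ofReal, integral_inv_normSq hζ, sub_eq_zero] at h0
  rw [h0]
  have h5 : ζ - conj ζ = 2 * ζ.im * I := by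
    apply Complex.ext <;> simp
    ring
  rw [h5]
  push_cast
  have : (ζ.im : ℂ) ≠ 0 := by exact_mod_cast hζ'
  field_simp


/-! ### Bounded functions, parametric integrals, averages -/

theorem one_sub_Iez_norm {e : ℝ} (he : 0 < e) {z : ℂ} (hz : 0 ≤ z.im) :
    1 ≤ ‖1 - I * e * z‖ ∧ e * ‖z‖ ≤ ‖1 - I * e * z‖ := by
  have h1 : ‖1 - I * e * z‖ ^ 2 = (1 + e * z.im) ^ 2 + (e * z.re) ^ 2 := by
    rw [← Complex.normSq_eq_norm_sq, Complex.normSq_apply]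
    simp
    ring
  have h2 : ‖z‖ ^ 2 = z.re ^ 2 + z.im ^ 2 := by
    rw [← Complex.normSq_eq_norm_sq, Complex.normSq_apply]
    ring
  have h3 : 0 ≤ e * z.im := by positivity
  constructor
  · apply le_of_sq_le_sq _ (norm_nonneg _)
    rw [h1]
    nlinarith [sq_nonneg (e * z.re)]
  · apply le_of_sq_le_sq _ (norm_nonneg _)
    rw [h1, mul_pow, h2]
    nlinarith

theorem cauchy_bdd {g : ℂ → ℂ} (hd : DifferentiableOn ℂ g {z | 0 < z.im})
    (hc : ContinuousOn g {z | 0 ≤ z.im}) {B : ℝ} (hB : ∀ z : ℂ, 0 ≤ z.im → ‖g z‖ ≤ B)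
    (hL : MemLp (fun t : ℝ => g t) 2) {ζ : ℂ} (hζ : 0 < ζ.im) :
    ∫ t : ℝ, g t / (t - ζ) = 2 * Real.pi * I * g ζ ∧ ∫ t : ℝ, g t / (t - conj ζ) = 0 := by
  set e : ℕ → ℝ := fun n => 1 / ((n : ℝ) + 1) with he
  have he0 : ∀ n, 0 < e n := fun n => by simp only [he]; positivity
  have helim : Tendsto e atTop (𝓝 0) := tendsto_one_div_add_atTop_nhds_zero_nat
  have hne : ∀ n (z : ℂ), 0 ≤ z.im → (1 - I * e n * z) ≠ 0 := by
    intro n z hz h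
    have := (one_sub_Iez_norm (he0 n) hz).1
    rw [h] at this
    simp at this
    linarith
  have hGd : ∀ n, DifferentiableOn ℂ (fun z => g z / (1 - I * e n * z)) {z | 0 < z.im} := by
    intro n
    apply hd.div (by fun_prop)
    intro z hz
    exact hne n z (le_of_lt hz)
  have hGc : ∀ n, ContinuousOn (fun z => g z / (1 - I * e n * z)) {z | 0 ≤ z.im} := by
    intro n
    apply hc.div (by fun_prop)
    intro z hz
    exact hne n z hz
  have hGb : ∀ n (z : ℂ), 0 ≤ z.im → 1 ≤ ‖z‖ → ‖g z / (1 - I * e n * z)‖ ≤ (B / e n) / ‖z‖ := by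
    intro n z hz hz1
    rw [norm_div, div_div]
    have h1 := hB z hz
    have h2 := he0 n
    have h3 := (one_sub_Iez_norm (he0 n) hz).2
    have : 0 ≤ B := (norm_nonneg _).trans h1
    gcongr
  have hlim1 : ∀ t : ℂ, Tendsto (fun n => g t / (1 - I * e n * t)) atTop (𝓝 (g t)) := by
    intro t
    have h1 : Tendsto (fun n => (1 - I * e n * t)) atTop (𝓝 (1 - I * ((0 : ℝ) : ℂ) * t)) := by
      apply Tendsto.sub tendsto_const_nhds
      apply Tendsto.mul_const
      apply Tendsto.const_mul
      exact (Complex.continuous_ofReal.tendsto 0).comp helim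
    have h2 : Tendsto (fun n => g t / (1 - I * e n * t)) atTop
        (𝓝 (g t / (1 - I * ((0 : ℝ) : ℂ) * t))) := tendsto_const_nhds.div h1 (by simp)
    have h3 : g t / (1 - I * ((0 : ℝ) : ℂ) * t) = g t := by simp
    rwa [h3] at h2
  have hlim : ∀ w : ℂ, w.im ≠ 0 → Tendsto (fun n => ∫ t : ℝ, (g t / (1 - I * e n * t)) / (t - w)) atTop
      (𝓝 (∫ t : ℝ, g t / (t - w))) := by
    intro w hw
    have hgi : Integrable (fun t : ℝ => g t / (t - w)) := by
      simp only [div_eq_mul_inv]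
      exact L2_mul_integrable hL (memLp_inv_sub hw)
    apply tendsto_integral_of_dominated_convergence (fun t : ℝ => ‖g t / (t - w)‖)
    · intro n
      have h1 : Continuous (fun t : ℝ => g t / (1 - I * e n * t)) :=
        (hGc n).comp_continuous Complex.continuous_ofReal (fun t => by simp)
      exact (h1.div (by fun_prop) (real_sub_ne hw)).aestronglyMeasurable
    · exact hgi.norm
    · intro n
      refine Eventually.of_forall fun t => ?_
      rw [norm_div, norm_div, norm_div]
      gcongr
      apply div_le_self (norm_nonneg _)
      exact (one_sub_Iez_norm (he0 n) (by simp)).1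
    · refine Eventually.of_forall fun t => ?_
      exact (hlim1 t).div_const _
  constructor
  · have h1 := hlim ζ hζ.ne'
    have h2 : ∀ n, ∫ t : ℝ, (g t / (1 - I * e n * t)) / (t - ζ)
        = 2 * Real.pi * I * (g ζ / (1 - I * e n * ζ)) := fun n =>
      cauchy_decay (hGd n) (hGc n) (hGb n) hζ
    simp_rw [h2] at h1
    exact tendsto_nhds_unique h1 ((hlim1 ζ).const_mul _)
  · have h1 := hlim (conj ζ) (by simpa using hζ.ne')
    have h2 : ∀ n, ∫ t : ℝ, (g t / (1 - I * e n * t)) / (t - conj ζ) = 0 := fun n =>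
      cauchy_decay_conj (hGd n) (hGc n) (hGb n) hζ
    simp_rw [h2] at h1
    exact tendsto_nhds_unique h1 tendsto_const_nhds

/-- Holomorphy of parametric integrals under local `L¹` bounds. -/
theorem differentiableOn_integral {α : Type*} [MeasurableSpace α] {μ : Measure α} [SigmaFinite μ]
    {F : ℂ → α → ℂ} {U : Set ℂ} (hm : ∀ z ∈ U, Measurable (F z))
    (hd : ∀ x, DifferentiableOn ℂ (fun z => F z x) U)
    (hb : ∀ z₀ ∈ U, ∃ R > 0, ∃ C : ℝ, Metric.closedBall z₀ R ⊆ U ∧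
      ∀ z ∈ Metric.closedBall z₀ R, Integrable (F z) μ ∧ ∫ x, ‖F z x‖ ∂μ ≤ C) :
    DifferentiableOn ℂ (fun z => ∫ x, F z x ∂μ) U := by
  intro z₀ hz₀
  obtain ⟨R, hR, C, hsub, hC⟩ := hb z₀ hz₀
  lift R to NNReal using hR.le
  have hR' : 0 < R := by exact_mod_cast hR
  have hcirc : ∀ θ, circleMap z₀ R θ ∈ Metric.closedBall z₀ R := fun θ =>
    circleMap_mem_closedBall z₀ hR.le θ
  have hsm : StronglyMeasurable (Function.uncurry fun (θ : ℝ) (x : α) => F (circleMap z₀ R θ) x) := by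
    apply Measurable.stronglyMeasurable
    apply measurable_uncurry_of_continuous_of_measurable
      (u := fun (θ : ℝ) (x : α) => F (circleMap z₀ R θ) x)
    · intro x
      exact (hd x).continuousOn.comp_continuous (continuous_circleMap _ _)
        (fun θ => hsub (hcirc θ))
    · intro θ
      exact hm _ (hsub (hcirc θ))
  set I₀ := volume.restrict (Ioc (0 : ℝ) (2 * Real.pi)) with hI₀
  have hnorm_int : Integrable (fun θ : ℝ => ∫ x, ‖F (circleMap z₀ R θ) x‖ ∂μ) I₀ := by
    apply Integrable.mono' (g := fun _ => C) (integrable_const _)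
    · exact (hsm.norm.integral_prod_right (ν := μ)).aestronglyMeasurable
    · refine Eventually.of_forall fun θ => ?_
      rw [Real.norm_eq_abs, abs_of_nonneg (integral_nonneg fun _ => norm_nonneg _)]
      exact (hC _ (hcirc θ)).2
  have hprod : Integrable (Function.uncurry fun (θ : ℝ) (x : α) => F (circleMap z₀ R θ) x)
      (I₀.prod μ) := by
    rw [integrable_prod_iff hsm.aestronglyMeasurable]
    exact ⟨Eventually.of_forall fun θ => (hC _ (hcirc θ)).1, hnorm_int⟩
  have hCI : CircleIntegrable (fun z => ∫ x, F z x ∂μ) z₀ R := by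
    rw [CircleIntegrable, intervalIntegrable_iff, uIoc_of_le Real.two_pi_pos.le]
    exact hprod.integral_prod_left
  have hps := hasFPowerSeriesOn_cauchy_integral hCI hR'
  have heq : ∀ z ∈ Metric.ball z₀ R, (∫ x, F z x ∂μ) =
      (2 * Real.pi * I : ℂ)⁻¹ • ∮ w in C(z₀, R), (w - z)⁻¹ • ∫ x, F w x ∂μ := by
    intro z hz
    have h1 : ∀ x, F z x = (2 * Real.pi * I : ℂ)⁻¹ • ∮ w in C(z₀, R), (w - z)⁻¹ • F w x := by
      intro x
      have hdc : DiffContOnCl ℂ (fun z => F z x) (Metric.ball z₀ R) := by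
        apply DifferentiableOn.diffContOnCl
        rw [closure_ball _ hR.ne']
        exact (hd x).mono hsub
      exact (hdc.two_pi_i_inv_smul_circleIntegral_sub_inv_smul hz).symm
    simp_rw [h1]
    rw [integral_smul]
    congr 1
    simp only [circleIntegral]
    have h2 : ∀ θ, deriv (circleMap z₀ R) θ • (circleMap z₀ R θ - z)⁻¹ • ∫ x, F (circleMap z₀ R θ) x ∂μ
        = ∫ x, deriv (circleMap z₀ R) θ • (circleMap z₀ R θ - z)⁻¹ • F (circleMap z₀ R θ) x ∂μ := by
      intro θ
      rw [integral_smul, integral_smul]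
    simp_rw [h2]
    simp_rw [intervalIntegral.integral_of_le Real.two_pi_pos.le]
    rw [integral_integral_swap]
    have hker : Continuous fun θ : ℝ => deriv (circleMap z₀ R) θ * (circleMap z₀ R θ - z)⁻¹ := by
      apply Continuous.mul
      · have h9 : deriv (circleMap z₀ R) = fun θ => circleMap 0 R θ * I :=
          funext fun θ => deriv_circleMap z₀ R θ
        rw [h9]
        exact (continuous_circleMap 0 R).mul continuous_const
      · apply Continuous.inv₀ ((continuous_circleMap _ _).sub continuous_const)
        intro θ h
        have h : circleMap z₀ R θ - z = 0 := h
        rw [sub_eq_zero] at h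
        rw [← h] at hz
        have := circleMap_mem_sphere z₀ hR.le θ
        rw [Metric.mem_sphere] at this
        rw [Metric.mem_ball, this] at hz
        exact lt_irrefl _ hz
    obtain ⟨K, hK⟩ := (isCompact_Icc (a := (0 : ℝ)) (b := 2 * Real.pi)).exists_bound_of_continuousOn
      hker.continuousOn
    have hsm2 : StronglyMeasurable (Function.uncurry fun (θ : ℝ) (x : α) =>
        deriv (circleMap z₀ R) θ • (circleMap z₀ R θ - z)⁻¹ • F (circleMap z₀ R θ) x) := by
      have : StronglyMeasurable (fun p : ℝ × α => (deriv (circleMap z₀ R) p.1 * (circleMap z₀ R p.1 - z)⁻¹) *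
        (Function.uncurry fun (θ : ℝ) (x : α) => F (circleMap z₀ R θ) x) p) :=
        ((hker.stronglyMeasurable).comp_measurable measurable_fst).mul hsm
      convert this using 2 with p
      simp [Function.uncurry, mul_assoc]
    have hprod2 : Integrable (Function.uncurry fun (x : α) (θ : ℝ) =>
        deriv (circleMap z₀ R) θ • (circleMap z₀ R θ - z)⁻¹ • F (circleMap z₀ R θ) x) (μ.prod I₀) := by
      have h3 : Integrable (Function.uncurry fun (θ : ℝ) (x : α) =>
        deriv (circleMap z₀ R) θ • (circleMap z₀ R θ - z)⁻¹ • F (circleMap z₀ R θ) x) (I₀.prod μ) := by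
        apply (hprod.norm.const_mul K).mono' hsm2.aestronglyMeasurable
        have hae : ∀ᵐ p ∂(I₀.prod μ), p.1 ∈ Ioc (0 : ℝ) (2 * Real.pi) := by
          have : ∀ᵐ θ ∂I₀, θ ∈ Ioc (0 : ℝ) (2 * Real.pi) := ae_restrict_mem measurableSet_Ioc
          exact Measure.quasiMeasurePreserving_fst.ae this
        filter_upwards [hae] with p hp
        simp only [Function.uncurry]
        rw [← smul_assoc, norm_smul, smul_eq_mul]
        gcongr
        exact hK p.1 ⟨hp.1.le, hp.2⟩
      exact h3.swap
    exact hprod2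
  have han : DifferentiableAt ℂ (fun z => (2 * Real.pi * I : ℂ)⁻¹ •
      ∮ w in C(z₀, R), (w - z)⁻¹ • ∫ x, F w x ∂μ) z₀ := hps.analyticAt.differentiableAt
  apply DifferentiableAt.differentiableWithinAt
  apply han.congr_of_eventuallyEq
  filter_upwards [Metric.ball_mem_nhds z₀ hR] with z hz
  exact heq z hz


/-! ### Logarithms, a Harnack type bound, and the half-disc estimate -/

theorem exists_log_ball {g : ℂ → ℂ} {R : ℝ} (hR : 0 < R) (hg : DifferentiableOn ℂ g (Metric.ball 0 R))
    (h0 : ∀ w ∈ Metric.ball (0 : ℂ) R, g w ≠ 0) :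
    ∃ L : ℂ → ℂ, DifferentiableOn ℂ L (Metric.ball 0 R) ∧
      ∀ w ∈ Metric.ball (0 : ℂ) R, exp (L w) = g w := by
  have hdg : DifferentiableOn ℂ (fun w => deriv g w / g w) (Metric.ball 0 R) :=
    (hg.deriv Metric.isOpen_ball).div hg h0
  obtain ⟨L, hL⟩ := hdg.isExactOn_ball
  have hconst : ∀ w ∈ Metric.ball (0 : ℂ) R, g w * exp (-L w) = g 0 * exp (-L 0) := by
    intro w hw
    apply (convex_ball (0 : ℂ) R).is_const_of_fderivWithin_eq_zero (𝕜 := ℂ)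
      (f := fun w => g w * exp (-L w)) _ _ hw (Metric.mem_ball_self hR)
    · intro w hw
      have h1 := (hg.differentiableAt (Metric.isOpen_ball.mem_nhds hw))
      have h2 := (hL w hw).differentiableAt
      exact (h1.mul (h2.neg.cexp)).differentiableWithinAt
    · intro w hw
      have h1 := (hg.differentiableAt (Metric.isOpen_ball.mem_nhds hw)).hasDerivAt
      have h3 := h1.mul (hL w hw).neg.cexp
      have h4 : HasDerivAt (fun w => g w * exp (-L w)) 0 w := by
        refine h3.congr_deriv ?_
        have h5 : deriv g w / g w * g w = deriv g w := div_mul_cancel₀ _ (h0 w hw)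
        simp only [Pi.neg_apply]
        linear_combination (-exp (-L w)) * h5
      rw [fderivWithin_of_isOpen Metric.isOpen_ball hw]
      ext
      simpa using h4.deriv
  have hg0 : g 0 * exp (-L 0) ≠ 0 := mul_ne_zero (h0 0 (Metric.mem_ball_self hR)) (exp_ne_zero _)
  refine ⟨fun w => L w + log (g 0 * exp (-L 0)), ?_, ?_⟩
  · intro w hw
    exact ((hL w hw).differentiableAt.add_const _).differentiableWithinAt
  · intro w hw
    rw [Complex.exp_add, exp_log hg0, ← hconst w hw, mul_comm (g w), ← mul_assoc, ← Complex.exp_add]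
    simp

theorem harnack_bound {v : ℂ → ℂ} (hv : DifferentiableOn ℂ v {z | 0 < z.im}) {B : ℝ}
    (hB : ∀ z : ℂ, 0 < z.im → ‖v z‖ ≤ B) (h0 : ∀ z : ℂ, 0 < z.im → v z ≠ 0) :
    ∃ C : ℝ, 0 ≤ C ∧ ∀ z : ℂ, 0 < z.im → ‖v z‖⁻¹ ≤ Real.exp (C * ((1 + ‖z‖ ^ 2) / z.im)) := by
  set ψ : ℂ → ℂ := fun w => I * (1 + w) / (1 - w) with hψ
  have hne : ∀ w ∈ Metric.ball (0 : ℂ) 1, 1 - w ≠ 0 := by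
    intro w hw h
    rw [mem_ball_zero_iff] at hw
    have : w = 1 := by linear_combination -h
    rw [this] at hw
    simp at hw
  have him : ∀ w ∈ Metric.ball (0 : ℂ) 1, 0 < (ψ w).im := by
    intro w hw
    have h1 := hne w hw
    rw [mem_ball_zero_iff] at hw
    have h2 : (ψ w).im = (1 - ‖w‖ ^ 2) / normSq (1 - w) := by
      rw [← Complex.normSq_eq_norm_sq, hψ]
      simp only [Complex.div_im, normSq_apply]
      simp
      ring
    rw [h2]
    apply div_pos
    · have := norm_nonneg w
      nlinarith
    · exact normSq_pos.2 h1
  have hψd : DifferentiableOn ℂ ψ (Metric.ball 0 1) := by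
    apply DifferentiableOn.div (by fun_prop) (by fun_prop) hne
  obtain ⟨L, hLd, hL⟩ := exists_log_ball one_pos (hv.comp hψd him) (fun w hw => h0 _ (him w hw))
  set M := max B 2 with hM
  have hM2 : 2 ≤ M := le_max_right _ _
  have hlM : 0 < Real.log M := Real.log_pos (by linarith)
  have hmaps : MapsTo L (Metric.ball 0 1) {z | z.re ≤ Real.log M} := by
    intro w hw
    have h1 := hL w hw
    have h2 : Real.exp (L w).re ≤ M := by
      rw [← Complex.norm_exp, h1]
      exact (hB _ (him w hw)).trans (le_max_left _ _)
    exact (Real.le_log_iff_exp_le (by linarith)).2 h2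
  refine ⟨2 * Real.log M + 2 * ‖L 0‖, by positivity, fun z hz => ?_⟩
  have hzi : z + I ≠ 0 := by
    intro h
    have := congrArg Complex.im h
    simp at this
    linarith
  set w := (z - I) / (z + I) with hw
  have hn1 : ‖z + I‖ ^ 2 = ‖z‖ ^ 2 + 2 * z.im + 1 := by
    rw [← Complex.normSq_eq_norm_sq, ← Complex.normSq_eq_norm_sq, normSq_apply, normSq_apply]
    simp
    ring
  have hn2 : ‖z - I‖ ^ 2 = ‖z‖ ^ 2 - 2 * z.im + 1 := by
    rw [← Complex.normSq_eq_norm_sq, ← Complex.normSq_eq_norm_sq, normSq_apply, normSq_apply]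
    simp
    ring
  have hpos : 0 < ‖z + I‖ := norm_pos_iff.2 hzi
  have hw2 : 1 - ‖w‖ ^ 2 = 4 * z.im / ‖z + I‖ ^ 2 := by
    rw [hw, norm_div, div_pow, hn2]
    have : ‖z + I‖ ^ 2 ≠ 0 := by positivity
    field_simp
    rw [hn1]
    ring
  have hw1 : ‖w‖ < 1 := by
    have : 0 < 1 - ‖w‖ ^ 2 := by rw [hw2]; positivity
    nlinarith [norm_nonneg w]
  have himle : 2 * z.im ≤ ‖z‖ ^ 2 + 1 := by
    have := Complex.abs_im_le_norm z
    rw [abs_of_pos hz] at this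
    nlinarith [sq_nonneg (‖z‖ - 1)]
  have hw3 : (1 - ‖w‖)⁻¹ ≤ (1 + ‖z‖ ^ 2) / z.im := by
    rw [inv_le_comm₀ (by linarith) (by positivity), inv_div]
    have h1 : 1 - ‖w‖ ^ 2 ≤ 2 * (1 - ‖w‖) := by nlinarith [norm_nonneg w]
    rw [hw2] at h1
    have h2 : z.im / (1 + ‖z‖ ^ 2) * 2 ≤ 4 * z.im / ‖z + I‖ ^ 2 := by
      rw [div_mul_eq_mul_div, div_le_div_iff₀ (by positivity) (by positivity), hn1]
      nlinarith
    linarith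
  have hwb : w ∈ Metric.ball (0 : ℂ) 1 := by rwa [mem_ball_zero_iff]
  have hψw : ψ w = z := by
    have h5 : 1 - w ≠ 0 := hne w hwb
    simp only [hψ]
    rw [div_eq_iff h5, hw]
    field_simp
    linear_combination (0 : ℂ) * I_sq
  have hBC := Complex.borelCaratheodory hlM hLd hmaps one_pos hwb
  have hb2 : ‖L w‖ ≤ (2 * Real.log M + 2 * ‖L 0‖) * (1 - ‖w‖)⁻¹ := by
    refine hBC.trans ?_
    rw [← add_div, div_eq_mul_inv]
    have : 0 < 1 - ‖w‖ := by linarith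
    apply mul_le_mul_of_nonneg_right _ (by positivity)
    have := norm_nonneg (L 0)
    nlinarith
  have hLw := hL w hwb
  simp only [Function.comp, hψw] at hLw
  rw [← hLw, Complex.norm_exp, ← Real.exp_neg]
  apply Real.exp_le_exp.2
  have h6 : -(L w).re ≤ ‖L w‖ := by
    have := Complex.abs_re_le_norm (L w)
    exact (neg_le_abs _).trans this
  refine h6.trans (hb2.trans ?_)
  gcongr

theorem one_le_growth {z : ℂ} (hz : 0 < z.im) : 1 ≤ (1 + ‖z‖ ^ 2) / z.im := by
  rw [le_div_iff₀ hz]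
  have := Complex.abs_im_le_norm z
  rw [abs_of_pos hz] at this
  nlinarith [sq_nonneg (‖z‖ - 1)]

theorem boundedType_growth {N : ℂ → ℂ} (hN : OfBoundedType N) :
    ∃ C : ℝ, 0 ≤ C ∧ ∀ z : ℂ, 0 < z.im → ‖N z‖ ≤ Real.exp (C * ((1 + ‖z‖ ^ 2) / z.im)) := by
  obtain ⟨u, v, hu, hv, ⟨A, hA⟩, ⟨B, hB⟩, h⟩ := hN
  obtain ⟨C, hC, hCb⟩ := harnack_bound hv hB (fun z hz => (h z hz).1)
  refine ⟨max A 0 + C, by positivity, fun z hz => ?_⟩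
  rw [(h z hz).2, norm_div, div_eq_mul_inv, add_mul, Real.exp_add]
  gcongr
  · have h1 := one_le_growth hz
    have h2 := hA z hz
    have h3 := Real.add_one_le_exp (max A 0 * ((1 + ‖z‖ ^ 2) / z.im))
    have h4 := le_max_left A 0
    have h5 := le_max_right A 0
    nlinarith
  · exact hCb z hz

theorem im_div_norm_sub {z : ℂ} (R : ℝ) :
    (I / (z - R)).re = z.im / ‖z - R‖ ^ 2 := by
  rw [← Complex.normSq_eq_norm_sq, Complex.div_re]
  simp

/-- the half-disc estimate -/
theorem half_disc_estimate {g : ℂ → ℂ} (hd : DifferentiableOn ℂ g {z | 0 < z.im})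
    (hc : ContinuousOn g {z | 0 ≤ z.im}) {A C : ℝ} (hA1 : 1 ≤ A) (hC : 0 ≤ C)
    (hA : ∀ t : ℝ, ‖g t‖ ≤ A)
    (hg : ∀ z : ℂ, 0 < z.im → ‖g z‖ ≤ Real.exp (C * ((1 + ‖z‖ ^ 2) / z.im))) :
    ∀ z : ℂ, 0 ≤ z.im → ‖g z‖ ≤ A * Real.exp (16 * C * z.im) := by
  intro z₀ hz₀
  rcases hz₀.eq_or_lt with hz₀ | hz₀
  · have h1 : z₀ = ((z₀.re : ℝ) : ℂ) := by
      apply Complex.ext <;> simp [← hz₀]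
    rw [← hz₀, h1]
    simpa using hA z₀.re
  obtain ⟨R, hR⟩ : ∃ R : ℝ, R = 2 * ‖z₀‖ + 1 := ⟨_, rfl⟩
  have hR1 : 1 ≤ R := by have := norm_nonneg z₀; linarith
  have hR0 : 0 < R := by linarith
  set D : Set ℂ := {z | ‖z‖ < R ∧ 0 < z.im} with hD
  have hDo : IsOpen D := (isOpen_lt continuous_norm continuous_const).inter isOpen_uhp
  have hDcl : closure D ⊆ {z | ‖z‖ ≤ R ∧ 0 ≤ z.im} := by
    apply closure_minimal
    · intro z hz
      exact ⟨hz.1.le, hz.2.le⟩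
    · exact (isClosed_le continuous_norm continuous_const).inter
        (isClosed_le continuous_const Complex.continuous_im)
  have hDb : Bornology.IsBounded D := by
    apply (Metric.isBounded_ball (x := (0 : ℂ)) (r := R)).subset
    intro z hz
    rw [mem_ball_zero_iff]
    exact hz.1
  have hz₀D : z₀ ∈ D := ⟨by have := norm_nonneg z₀; linarith, hz₀⟩
  set P : ℂ → ℂ := fun z => exp (-(2 * C * R ^ 2 : ℝ) * (I / (z - R) + I / (z - (-R : ℝ)))) with hP
  set S : ℂ → ℝ := fun z => z.im / ‖z - R‖ ^ 2 + z.im / ‖z - (-R : ℝ)‖ ^ 2 with hS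
  have hPn : ∀ z : ℂ, ‖P z‖ = Real.exp (-(2 * C * R ^ 2) * S z) := by
    intro z
    simp only [hP, hS]
    rw [Complex.norm_exp, ← im_div_norm_sub, ← im_div_norm_sub, ← Complex.ofReal_neg,
      Complex.re_ofReal_mul, Complex.add_re]
  have hS0 : ∀ z : ℂ, 0 ≤ z.im → 0 ≤ S z := by
    intro z hz
    simp only [hS]
    positivity
  have hP1 : ∀ z : ℂ, 0 ≤ z.im → ‖P z‖ ≤ 1 := by
    intro z hz
    rw [hPn, Real.exp_le_one_iff]
    have := hS0 z hz
    have : 0 ≤ 2 * C * R ^ 2 * S z := by positivity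
    linarith
  have hq0 : ∀ z : ℂ, 0 < z.im → ∀ x : ℝ, z - x ≠ 0 := by
    intro z hz x h
    have := congrArg Complex.im h
    simp at this
    linarith
  have hsq : ∀ z : ℂ, z ^ 2 - (R : ℂ) ^ 2 = (z - R) * (z - (-R : ℝ)) := by
    intro z
    push_cast
    ring
  -- bound of g on the closed half disc
  have hcomp : IsCompact {z : ℂ | ‖z‖ ≤ R ∧ 0 ≤ z.im} := by
    apply (isCompact_closedBall (0 : ℂ) R).of_isClosed_subset
    · exact (isClosed_le continuous_norm continuous_const).inter
        (isClosed_le continuous_const Complex.continuous_im)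
    · intro z hz
      rw [mem_closedBall_zero_iff]
      exact hz.1
  obtain ⟨B, hB⟩ := hcomp.exists_bound_of_continuousOn (hc.mono fun z hz => hz.2)
  have hB0 : 0 ≤ B := (norm_nonneg _).trans (hB 0 ⟨by simp [hR0.le], by simp⟩)
  have key : ∀ n : ℕ, (‖g z₀ * P z₀‖ / A) ^ n ≤ 2 * R ^ 2 / ‖z₀ ^ 2 - (R : ℂ) ^ 2‖ := by
    intro n
    set k : ℂ → ℂ := fun z => (g z * P z) ^ n * ((z ^ 2 - (R : ℂ) ^ 2) / (2 * R ^ 2 : ℝ)) with hk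
    have hkb : ∀ z ∈ closure D, ‖k z‖ ≤ B ^ n * (‖z ^ 2 - (R : ℂ) ^ 2‖ / (2 * R ^ 2)) := by
      intro z hz
      have hz' := hDcl hz
      simp only [hk]
      rw [norm_mul, norm_pow, norm_mul, norm_div, Complex.norm_real, Real.norm_eq_abs,
        abs_of_pos (by positivity : 0 < 2 * R ^ 2)]
      gcongr
      calc ‖g z‖ * ‖P z‖ ≤ B * 1 :=
            mul_le_mul (hB z hz') (hP1 z hz'.2) (norm_nonneg _) hB0
        _ = B := mul_one _
    have hkd : DiffContOnCl ℂ k D := by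
      constructor
      · intro z hz
        have h1 := hd.differentiableAt (isOpen_uhp.mem_nhds hz.2)
        have h2 : DifferentiableAt ℂ P z := by
          simp only [hP]
          have e1 := hq0 z hz.2 R
          have e2 := hq0 z hz.2 (-R)
          fun_prop (disch := assumption)
        simp only [hk]
        exact (((h1.mul h2).pow n).mul (by fun_prop)).differentiableWithinAt
      · intro z hz
        have hz' := hDcl hz
        by_cases hzR : z ^ 2 - (R : ℂ) ^ 2 = 0
        · have hk0 : k z = 0 := by simp [hk, hzR]
          rw [ContinuousWithinAt, hk0, tendsto_zero_iff_norm_tendsto_zero]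
          have ht : Tendsto (fun z => B ^ n * (‖z ^ 2 - (R : ℂ) ^ 2‖ / (2 * R ^ 2))) (𝓝[closure D] z)
              (𝓝 0) := by
            have : Continuous (fun z : ℂ => B ^ n * (‖z ^ 2 - (R : ℂ) ^ 2‖ / (2 * R ^ 2))) := by
              fun_prop
            have h3 := this.continuousWithinAt (s := closure D) (x := z)
            rw [ContinuousWithinAt, hzR] at h3
            simpa using h3
          refine tendsto_of_tendsto_of_tendsto_of_le_of_le' tendsto_const_nhds ht
            (Eventually.of_forall fun _ => norm_nonneg _) ?_
          filter_upwards [self_mem_nhdsWithin] with w hw using hkb w hw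
        · rw [hsq] at hzR
          have e1 := left_ne_zero_of_mul hzR
          have e2 := right_ne_zero_of_mul hzR
          have h1 : ContinuousWithinAt g (closure D) z :=
            (hc z hz'.2).mono fun w hw => (hDcl hw).2
          have h2 : ContinuousAt P z := by
            simp only [hP]
            fun_prop (disch := assumption)
          simp only [hk]
          exact ((h1.mul h2.continuousWithinAt).pow n).mul
            (Continuous.continuousWithinAt (by fun_prop))
    have hfr : ∀ z ∈ frontier D, ‖k z‖ ≤ A ^ n := by
      intro z hz
      rw [hDo.frontier_eq] at hz
      have hz' := hDcl hz.1
      have hz2 : ‖z‖ = R ∨ z.im = 0 := by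
        by_contra hcon
        push Not at hcon
        exact hz.2 ⟨lt_of_le_of_ne hz'.1 hcon.1, lt_of_le_of_ne hz'.2 (Ne.symm hcon.2)⟩
      have hquot : ‖z ^ 2 - (R : ℂ) ^ 2‖ / (2 * R ^ 2) ≤ 1 := by
        rw [div_le_one (by positivity)]
        calc ‖z ^ 2 - (R : ℂ) ^ 2‖ ≤ ‖z ^ 2‖ + ‖(R : ℂ) ^ 2‖ := norm_sub_le _ _
          _ = ‖z‖ ^ 2 + R ^ 2 := by
            rw [norm_pow, norm_pow, Complex.norm_real, Real.norm_eq_abs, sq_abs]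
          _ ≤ 2 * R ^ 2 := by
            have := hz'.1
            have := norm_nonneg z
            nlinarith
      by_cases hzR : z ^ 2 - (R : ℂ) ^ 2 = 0
      · have hk0 : k z = 0 := by simp [hk, hzR]
        rw [hk0, norm_zero]
        positivity
      have hgp : ‖g z‖ * ‖P z‖ ≤ A := by
        by_cases him : z.im = 0
        · have h1 : z = ((z.re : ℝ) : ℂ) := by
            apply Complex.ext <;> simp [him]
          have h2 : ‖g z‖ ≤ A := by rw [h1]; exact hA _
          calc ‖g z‖ * ‖P z‖ ≤ A * 1 :=
            mul_le_mul h2 (hP1 z hz'.2) (norm_nonneg _) (by linarith)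
            _ = A := mul_one _
        · have hzn : ‖z‖ = R := hz2.resolve_right him
          have hy : 0 < z.im := lt_of_le_of_ne hz'.2 (Ne.symm him)
          have hn : z.re ^ 2 + z.im ^ 2 = R ^ 2 := by
            rw [← hzn, ← Complex.normSq_eq_norm_sq, normSq_apply]
            ring
          have e1 : ‖z - R‖ ^ 2 = 2 * R * (R - z.re) := by
            rw [← Complex.normSq_eq_norm_sq, normSq_apply]
            simp
            linear_combination hn
          have e2 : ‖z - (-R : ℝ)‖ ^ 2 = 2 * R * (R + z.re) := by
            rw [← Complex.normSq_eq_norm_sq, normSq_apply]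
            simp
            linear_combination hn
          have hSz : S z = 1 / z.im := by
            simp only [hS]
            rw [e1, e2]
            have f1 : 0 < R - z.re := by nlinarith
            have f2 : 0 < R + z.re := by nlinarith
            rw [div_add_div _ _ (by positivity) (by positivity),
              div_eq_div_iff (by positivity) (by positivity)]
            linear_combination 4 * R ^ 2 * hn
          rw [hPn, hSz]
          refine (mul_le_mul_of_nonneg_right (hg z hy) (Real.exp_pos _).le).trans ?_
          rw [← Real.exp_add, hzn]
          refine le_trans ?_ hA1
          rw [Real.exp_le_one_iff]
          have : C * ((1 + R ^ 2) / z.im) + -(2 * C * R ^ 2) * (1 / z.im)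
            = C * (1 - R ^ 2) / z.im := by
            field_simp
            ring
          rw [this]
          apply div_nonpos_of_nonpos_of_nonneg _ hy.le
          have hR2 : 0 ≤ R ^ 2 - 1 := by nlinarith
          nlinarith [mul_nonneg hC hR2]
      simp only [hk]
      rw [norm_mul, norm_pow, norm_mul, norm_div, Complex.norm_real, Real.norm_eq_abs,
        abs_of_pos (by positivity : 0 < 2 * R ^ 2)]
      calc (‖g z‖ * ‖P z‖) ^ n * (‖z ^ 2 - (R : ℂ) ^ 2‖ / (2 * R ^ 2)) ≤ A ^ n * 1 := by
            gcongr
        _ = A ^ n := mul_one _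
    have hfin := Complex.norm_le_of_forall_mem_frontier_norm_le hDb hkd hfr (subset_closure hz₀D)
    simp only [hk] at hfin
    rw [norm_mul, norm_pow, norm_div, Complex.norm_real, Real.norm_eq_abs,
        abs_of_pos (by positivity : 0 < 2 * R ^ 2)] at hfin
    have hne : 0 < ‖z₀ ^ 2 - (R : ℂ) ^ 2‖ := by
      rw [norm_pos_iff, hsq]
      exact mul_ne_zero (hq0 z₀ hz₀ R) (hq0 z₀ hz₀ (-R))
    rw [div_pow, div_le_div_iff₀ (by positivity) hne]
    rw [← mul_div_assoc, div_le_iff₀ (by positivity)] at hfin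
    linarith
  have hle : ‖g z₀ * P z₀‖ / A ≤ 1 := by
    by_contra hcon
    push Not at hcon
    obtain ⟨n, hn⟩ := ((tendsto_pow_atTop_atTop_of_one_lt hcon).eventually_gt_atTop
      (2 * R ^ 2 / ‖z₀ ^ 2 - (R : ℂ) ^ 2‖)).exists
    exact absurd (key n) (not_le.2 hn)
  rw [div_le_one (by linarith), norm_mul, hPn] at hle
  have hSle : R ^ 2 * S z₀ ≤ 8 * z₀.im := by
    have f : ∀ x : ℝ, |x| = R → z₀.im / ‖z₀ - x‖ ^ 2 ≤ 4 * z₀.im / R ^ 2 := by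
      intro x hx
      have h1 : R / 2 ≤ ‖z₀ - x‖ := by
        have := norm_sub_norm_le (x : ℂ) z₀
        rw [Complex.norm_real, Real.norm_eq_abs, hx, norm_sub_rev] at this
        linarith
      have h2 : R ^ 2 / 4 ≤ ‖z₀ - x‖ ^ 2 := by nlinarith
      rw [div_le_div_iff₀ (by nlinarith) (by positivity)]
      nlinarith
    have f1 := f R (abs_of_pos hR0)
    have f2 := f (-R) (by rw [abs_neg, abs_of_pos hR0])
    have : S z₀ ≤ 8 * z₀.im / R ^ 2 := by
      simp only [hS]
      calc _ ≤ 4 * z₀.im / R ^ 2 + 4 * z₀.im / R ^ 2 := add_le_add f1 f2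
        _ = _ := by ring
    rw [le_div_iff₀ (by positivity)] at this
    linarith
  calc ‖g z₀‖ = ‖g z₀‖ * Real.exp (-(2 * C * R ^ 2) * S z₀) * Real.exp ((2 * C * R ^ 2) * S z₀) := by
        rw [mul_assoc, ← Real.exp_add]
        simp
    _ ≤ A * Real.exp ((2 * C * R ^ 2) * S z₀) := by gcongr
    _ ≤ A * Real.exp (16 * C * z₀.im) := by
      apply mul_le_mul_of_nonneg_left _ (by linarith)
      apply Real.exp_le_exp.2
      nlinarith


/-! ### Averages over horizontal segments -/

def avg (w : ℝ → ℂ) (δ : ℝ) (G : ℂ → ℂ) (z : ℂ) : ℂ := ∫ s in (0 : ℝ)..1, w s * G (z + δ * s)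

def prj (z : ℂ) : ℂ := z.re + (max z.im 0 : ℝ) * I

theorem continuous_prj : Continuous prj := by
  unfold prj
  fun_prop

theorem prj_im (z : ℂ) : 0 ≤ (prj z).im := by simp [prj]

theorem prj_eq {z : ℂ} (hz : 0 ≤ z.im) : prj z = z := by
  apply Complex.ext <;> simp [prj, hz]

theorem im_add_real_mul (z : ℂ) (δ s : ℝ) : (z + δ * s).im = z.im := by simp

section
variable {G : ℂ → ℂ} {w : ℝ → ℂ} {δ : ℝ}

theorem cont_prj (hc : ContinuousOn G {z | 0 ≤ z.im}) : Continuous (fun z => G (prj z)) :=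
  hc.comp_continuous continuous_prj prj_im

theorem cont_real (hc : ContinuousOn G {z | 0 ≤ z.im}) : Continuous (fun t : ℝ => G t) :=
  hc.comp_continuous Complex.continuous_ofReal (fun t => by simp)

theorem cont_seg (hc : ContinuousOn G {z | 0 ≤ z.im}) {z : ℂ} (hz : 0 ≤ z.im) :
    Continuous (fun s : ℝ => G (z + δ * s)) :=
  hc.comp_continuous (by fun_prop) (fun s => by simpa using hz)

theorem avg_cont (hc : ContinuousOn G {z | 0 ≤ z.im}) (hw : Continuous w) :
    ContinuousOn (avg w δ G) {z | 0 ≤ z.im} := by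
  have h1 : Continuous (fun z : ℂ => ∫ s in (0 : ℝ)..1, w s * G (prj (z + δ * s))) := by
    apply intervalIntegral.continuous_parametric_intervalIntegral_of_continuous'
    have := cont_prj hc
    simp only [Function.uncurry_def]
    exact (hw.comp continuous_snd).mul (this.comp (by fun_prop))
  apply h1.continuousOn.congr
  intro z hz
  unfold avg
  apply intervalIntegral.integral_congr
  intro s _
  simp only
  rw [prj_eq (z := z + δ * s) (by rw [im_add_real_mul]; exact hz)]

theorem avg_diff (hd : DifferentiableOn ℂ G {z | 0 < z.im}) (hw : Continuous w) :
    DifferentiableOn ℂ (avg w δ G) {z | 0 < z.im} := by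
  have key : DifferentiableOn ℂ (fun z => ∫ s, w s * G (z + δ * s) ∂(volume.restrict (Ioc (0 : ℝ) 1)))
      {z | 0 < z.im} := by
    have hcs : ∀ z : ℂ, 0 < z.im → Continuous fun s : ℝ => w s * G (z + δ * s) := by
      intro z hz
      apply hw.mul
      exact hd.continuousOn.comp_continuous (by fun_prop) (fun s => by simpa using hz)
    apply differentiableOn_integral
    · intro z hz
      exact (hcs z hz).measurable
    · intro s
      apply DifferentiableOn.const_mul
      apply hd.comp (by fun_prop)
      intro z hz
      simpa using hz
    · intro z₀ hz₀
      have hz₀' : 0 < z₀.im := hz₀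
      have hsub : Metric.closedBall z₀ (z₀.im / 2) ⊆ {z | 0 < z.im} := by
        intro z hz
        rw [mem_closedBall_iff_norm] at hz
        have h1 := Complex.abs_im_le_norm (z - z₀)
        rw [Complex.sub_im] at h1
        have h2 := neg_abs_le (z.im - z₀.im)
        show 0 < z.im
        linarith
      have hcomp : IsCompact (Metric.closedBall z₀ (z₀.im / 2) ×ˢ Icc (0 : ℝ) 1) :=
        (isCompact_closedBall _ _).prod isCompact_Icc
      have hco : ContinuousOn (fun p : ℂ × ℝ => w p.2 * G (p.1 + δ * p.2))
          (Metric.closedBall z₀ (z₀.im / 2) ×ˢ Icc (0 : ℝ) 1) := by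
        apply ContinuousOn.mul (hw.comp continuous_snd).continuousOn
        apply hd.continuousOn.comp (by fun_prop)
        intro p hp
        have : 0 < p.1.im := hsub hp.1
        simpa using this
      obtain ⟨C, hC⟩ := hcomp.exists_bound_of_continuousOn hco
      refine ⟨z₀.im / 2, by positivity, C, hsub, fun z hz => ?_⟩
      have hIntg : Integrable (fun s : ℝ => w s * G (z + δ * s)) (volume.restrict (Ioc (0 : ℝ) 1)) :=
        ((hcs z (hsub hz)).integrableOn_Icc).mono_set Ioc_subset_Icc_self
      refine ⟨hIntg, ?_⟩
      calc ∫ s, ‖w s * G (z + δ * s)‖ ∂(volume.restrict (Ioc (0 : ℝ) 1))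
          ≤ ∫ s, C ∂(volume.restrict (Ioc (0 : ℝ) 1)) := by
            apply integral_mono_ae hIntg.norm (integrable_const _)
            filter_upwards [ae_restrict_mem measurableSet_Ioc] with s hs
            exact hC (z, s) ⟨hz, hs.1.le, hs.2⟩
        _ = C := by simp
  apply key.congr
  intro z _
  unfold avg
  rw [intervalIntegral.integral_of_le zero_le_one]

theorem avg_norm_le (hc : ContinuousOn G {z | 0 ≤ z.im}) (hw1 : ∀ s, ‖w s‖ ≤ 1) {z : ℂ}
    (hz : 0 ≤ z.im) : ‖avg w δ G z‖ ≤ ∫ s in (0 : ℝ)..1, ‖G (z + δ * s)‖ := by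
  unfold avg
  apply intervalIntegral.norm_integral_le_of_norm_le zero_le_one
  · refine Eventually.of_forall fun s _ => ?_
    rw [norm_mul]
    exact mul_le_of_le_one_left (norm_nonneg _) (hw1 s)
  · exact (cont_seg hc hz).norm.intervalIntegrable _ _

theorem avg_norm_le_const (hc : ContinuousOn G {z | 0 ≤ z.im}) (hw1 : ∀ s, ‖w s‖ ≤ 1) {z : ℂ}
    (hz : 0 ≤ z.im) {B : ℝ} (hB : ∀ s ∈ Icc (0 : ℝ) 1, ‖G (z + δ * s)‖ ≤ B) :
    ‖avg w δ G z‖ ≤ B := by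
  refine (avg_norm_le hc hw1 hz).trans ?_
  calc ∫ s in (0 : ℝ)..1, ‖G (z + δ * s)‖ ≤ ∫ s in (0 : ℝ)..1, B := by
        apply intervalIntegral.integral_mono_on zero_le_one
        · exact (cont_seg hc hz).norm.intervalIntegrable _ _
        · simp
        · exact hB
    _ = B := by simp

theorem sq_int (hc : ContinuousOn G {z | 0 ≤ z.im}) (hL : MemLp (fun t : ℝ => G t) 2) :
    Integrable (fun t : ℝ => ‖G t‖ ^ 2) :=
  (memLp_two_iff_integrable_sq_norm (cont_real hc).aestronglyMeasurable).1 hL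

theorem avg_real_bound (hc : ContinuousOn G {z | 0 ≤ z.im}) (hw1 : ∀ s, ‖w s‖ ≤ 1)
    (hL : MemLp (fun t : ℝ => G t) 2) (hδ : 0 < δ) (t : ℝ) :
    ‖avg w δ G t‖ ≤ 1 + δ⁻¹ * ∫ t : ℝ, ‖G t‖ ^ 2 := by
  have hs := cont_seg (δ := δ) hc (z := (t : ℂ)) (by simp)
  refine (avg_norm_le hc hw1 (by simp)).trans ?_
  calc ∫ s in (0 : ℝ)..1, ‖G (t + δ * s)‖ ≤ ∫ s in (0 : ℝ)..1, (1 + ‖G (t + δ * s)‖ ^ 2) := by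
        apply intervalIntegral.integral_mono_on zero_le_one
        · exact hs.norm.intervalIntegrable _ _
        · exact (continuous_const.add (hs.norm.pow 2)).intervalIntegrable _ _
        · intro s _
          nlinarith [sq_nonneg (‖G (t + δ * s)‖ - 1), norm_nonneg (G (t + δ * s))]
    _ = 1 + ∫ s in (0 : ℝ)..1, ‖G (t + δ * s)‖ ^ 2 := by
        rw [intervalIntegral.integral_add]
        · simp
        · simp
        · exact (hs.norm.pow 2).intervalIntegrable _ _
    _ ≤ 1 + δ⁻¹ * ∫ t : ℝ, ‖G t‖ ^ 2 := by
        gcongr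
        have h1 : ∫ s in (0 : ℝ)..1, ‖G (t + δ * s)‖ ^ 2
            = δ⁻¹ * ∫ u in (t + δ * 0)..(t + δ * 1), ‖G (u : ℂ)‖ ^ 2 := by
          have := intervalIntegral.integral_comp_add_mul (a := 0) (b := 1)
            (fun u : ℝ => ‖G (u : ℂ)‖ ^ 2) hδ.ne' t
          rw [smul_eq_mul] at this
          rw [← this]
          apply intervalIntegral.integral_congr
          intro s _
          simp
        rw [h1, intervalIntegral.integral_of_le (by simp [hδ.le])]
        gcongr
        · exact Eventually.of_forall fun _ => by positivity
        · exact sq_int hc hL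
        · exact Measure.restrict_le_self

theorem avg_growth (hc : ContinuousOn G {z | 0 ≤ z.im}) (hw1 : ∀ s, ‖w s‖ ≤ 1) (hδ : 0 < δ)
    (hδ1 : δ ≤ 1) {C : ℝ} (hC : 0 ≤ C)
    (hg : ∀ z : ℂ, 0 < z.im → ‖G z‖ ≤ Real.exp (C * ((1 + ‖z‖ ^ 2) / z.im))) {z : ℂ} (hz : 0 < z.im) :
    ‖avg w δ G z‖ ≤ Real.exp (3 * C * ((1 + ‖z‖ ^ 2) / z.im)) := by
  apply avg_norm_le_const hc hw1 hz.le
  intro s hs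
  have him := im_add_real_mul z δ s
  refine (hg _ (by rw [him]; exact hz)).trans ?_
  rw [him]
  apply Real.exp_le_exp.2
  have h1 : ‖z + δ * s‖ ≤ ‖z‖ + 1 := by
    refine (norm_add_le _ _).trans ?_
    gcongr
    rw [norm_mul, Complex.norm_real, Complex.norm_real, Real.norm_eq_abs, Real.norm_eq_abs,
      abs_of_pos hδ, abs_of_nonneg hs.1]
    nlinarith [hs.1, hs.2]
  have h2 : ‖z + δ * s‖ ^ 2 ≤ 2 * ‖z‖ ^ 2 + 2 := by
    nlinarith [sq_nonneg (‖z‖ - 1), norm_nonneg (z + δ * s), norm_nonneg z]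
  rw [mul_comm 3 C, mul_assoc]
  gcongr
  rw [← mul_div_assoc]
  gcongr
  nlinarith [sq_nonneg ‖z‖]

/-- joint integrability of translates against an `L²` function -/
theorem prod_integrable (hc : ContinuousOn G {z | 0 ≤ z.im}) (hL : MemLp (fun t : ℝ => G t) 2)
    {κ : ℝ → ℂ} (hκ : Continuous κ) (hκL : MemLp κ 2) :
    Integrable (fun q : ℝ × ℝ => G (q.2 + δ * q.1) * κ q.2)
      ((volume.restrict (Ioc (0 : ℝ) 1)).prod volume) := by
  have hcont : Continuous (fun q : ℝ × ℝ => G (q.2 + δ * q.1) * κ q.2) := by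
    apply Continuous.mul _ (hκ.comp continuous_snd)
    exact hc.comp_continuous (by fun_prop) (fun q => by simp)
  have htr : ∀ s : ℝ, MemLp (fun t : ℝ => G (t + δ * s)) 2 := by
    intro s
    have := hL.comp_measurePreserving (measurePreserving_add_right volume (δ * s))
    refine this.ae_eq (Eventually.of_forall fun t => ?_)
    simp
  have hsq : ∀ s : ℝ, ∫ t : ℝ, ‖G (t + δ * s)‖ ^ 2 = ∫ t : ℝ, ‖G t‖ ^ 2 := by
    intro s
    have := integral_add_right_eq_self (μ := volume) (fun t : ℝ => ‖G (t : ℂ)‖ ^ 2) (δ * s)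
    rw [← this]
    simp
  rw [integrable_prod_iff hcont.aestronglyMeasurable]
  refine ⟨Eventually.of_forall fun s => L2_mul_integrable (htr s) hκL, ?_⟩
  have hκ2 : Integrable (fun t : ℝ => ‖κ t‖ ^ 2) :=
    (memLp_two_iff_integrable_sq_norm hκ.aestronglyMeasurable).1 hκL
  apply Integrable.mono' (g := fun _ => (∫ t : ℝ, ‖G t‖ ^ 2) + ∫ t : ℝ, ‖κ t‖ ^ 2) (integrable_const _)
  · exact (hcont.norm.stronglyMeasurable.integral_prod_right (ν := volume)).aestronglyMeasurable
  · refine Eventually.of_forall fun s => ?_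
    rw [Real.norm_eq_abs, abs_of_nonneg (integral_nonneg fun _ => norm_nonneg _), ← hsq s]
    have hG2 : Integrable (fun t : ℝ => ‖G (t + δ * s)‖ ^ 2) :=
      (memLp_two_iff_integrable_sq_norm (htr s).1).1 (htr s)
    rw [← integral_add hG2 hκ2]
    apply integral_mono (L2_mul_integrable (htr s) hκL).norm (hG2.add hκ2)
    intro t
    simp only [Pi.add_apply]
    rw [norm_mul]
    nlinarith [sq_nonneg (‖G (t + δ * s)‖ - ‖κ t‖), sq_nonneg ‖G (t + δ * s)‖, sq_nonneg ‖κ t‖]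

theorem avg_memLp (hc : ContinuousOn G {z | 0 ≤ z.im}) (hL : MemLp (fun t : ℝ => G t) 2) :
    MemLp (fun t : ℝ => avg (fun _ => 1) δ G t) 2 := by
  have hac : Continuous (fun t : ℝ => avg (fun _ => 1) δ G t) := cont_real (avg_cont hc continuous_const)
  rw [memLp_two_iff_integrable_sq_norm hac.aestronglyMeasurable]
  have hcont : Continuous (fun q : ℝ × ℝ => ‖G (q.2 + δ * q.1)‖ ^ 2) := by
    apply Continuous.pow
    apply Continuous.norm
    exact hc.comp_continuous (by fun_prop) (fun q => by simp)
  have h1 : Integrable (fun q : ℝ × ℝ => ‖G (q.2 + δ * q.1)‖ ^ 2)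
      ((volume.restrict (Ioc (0 : ℝ) 1)).prod volume) := by
    rw [integrable_prod_iff hcont.aestronglyMeasurable]
    constructor
    · refine Eventually.of_forall fun s => ?_
      have := (sq_int hc hL).comp_add_right (δ * s)
      simpa using this
    · have : (fun s : ℝ => ∫ t : ℝ, ‖‖G (t + δ * s)‖ ^ 2‖) = fun s => ∫ t : ℝ, ‖G t‖ ^ 2 := by
        funext s
        have := integral_add_right_eq_self (μ := volume) (fun t : ℝ => ‖G (t : ℂ)‖ ^ 2) (δ * s)
        rw [← this]
        simp
      simp only
      rw [this]
      exact integrable_const _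
  have h2 := h1.integral_prod_right
  refine h2.mono' (hac.norm.pow 2).aestronglyMeasurable (Eventually.of_forall fun t => ?_)
  rw [Real.norm_eq_abs, abs_of_nonneg (by positivity)]
  have hs := cont_seg (δ := δ) hc (z := (t : ℂ)) (by simp)
  have h3 : ‖avg (fun _ => 1) δ G t‖ ≤ ∫ s in (0 : ℝ)..1, ‖G (t + δ * s)‖ :=
    avg_norm_le hc (by simp) (by simp)
  set m := ∫ s in (0 : ℝ)..1, ‖G (t + δ * s)‖ with hm
  have h4 : 0 ≤ ∫ s in (0 : ℝ)..1, (‖G (t + δ * s)‖ - m) ^ 2 :=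
    intervalIntegral.integral_nonneg zero_le_one fun s _ => sq_nonneg _
  have h5 : ∫ s in (0 : ℝ)..1, (‖G (t + δ * s)‖ - m) ^ 2
      = (∫ s in (0 : ℝ)..1, ‖G (t + δ * s)‖ ^ 2) - m ^ 2 := by
    have : ∀ s : ℝ, (‖G (t + δ * s)‖ - m) ^ 2
      = ‖G (t + δ * s)‖ ^ 2 - (2 * m) * ‖G (t + δ * s)‖ + m ^ 2 := fun s => by ring
    simp_rw [this]
    rw [intervalIntegral.integral_add, intervalIntegral.integral_sub,
      intervalIntegral.integral_const_mul, ← hm]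
    · simp
      ring
    · exact (hs.norm.pow 2).intervalIntegrable _ _
    · exact (continuous_const.mul hs.norm).intervalIntegrable _ _
    · exact ((hs.norm.pow 2).sub (continuous_const.mul hs.norm)).intervalIntegrable _ _
    · simp
  rw [h5, intervalIntegral.integral_of_le zero_le_one] at h4
  have h6 : ‖avg (fun _ => 1) δ G t‖ ^ 2 ≤ m ^ 2 := by
    gcongr
  linarith

/-- the Cauchy transform of an `L²` function is holomorphic off the real line -/
theorem cauchyInt_diff {h : ℝ → ℂ} (hm : Measurable h) (hL : MemLp h 2) :
    DifferentiableOn ℂ (fun z : ℂ => ∫ t : ℝ, h t / (t - z)) {z | 0 < z.im} ∧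
    DifferentiableOn ℂ (fun z : ℂ => ∫ t : ℝ, h t / (t - z)) {z | z.im < 0} := by
  have hsq : Integrable (fun t : ℝ => ‖h t‖ ^ 2) := (memLp_two_iff_integrable_sq_norm hL.1).1 hL
  have main : ∀ U : Set ℂ, IsOpen U → (∀ z ∈ U, z.im ≠ 0) →
      DifferentiableOn ℂ (fun z : ℂ => ∫ t : ℝ, h t / (t - z)) U := by
    intro U hU hU0
    apply differentiableOn_integral
    · intro z _
      exact hm.div (by fun_prop)
    · intro t
      apply DifferentiableOn.div (by fun_prop) (by fun_prop)
      intro z hz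
      exact real_sub_ne (hU0 z hz) t
    · intro z₀ hz₀
      obtain ⟨R, hR, hRU⟩ := Metric.isOpen_iff.1 hU z₀ hz₀
      have hy := abs_pos.2 (hU0 z₀ hz₀)
      set ρ := min (R / 2) (|z₀.im| / 2) with hρ
      have hρ0 : 0 < ρ := by positivity
      refine ⟨ρ, hρ0, (∫ t : ℝ, ‖h t‖ ^ 2) + 4 * ∫ t : ℝ, ((t - z₀.re) ^ 2 + z₀.im ^ 2)⁻¹, ?_, ?_⟩
      · refine (Metric.closedBall_subset_ball ?_).trans hRU
        have := min_le_left (R / 2) (|z₀.im| / 2)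
        linarith
      · intro z hz
        rw [mem_closedBall_iff_norm] at hz
        have hzr : ‖z - z₀‖ ≤ |z₀.im| / 2 := hz.trans (min_le_right _ _)
        have hz0 : z.im ≠ 0 := by
          intro h0
          have h1 := Complex.abs_im_le_norm (z - z₀)
          rw [Complex.sub_im, h0, zero_sub, abs_neg] at h1
          linarith
        have hIntg : Integrable (fun t : ℝ => h t / (t - z)) := by
          simp only [div_eq_mul_inv]
          exact L2_mul_integrable hL (memLp_inv_sub hz0)
        refine ⟨hIntg, ?_⟩
        rw [← integral_const_mul, ← integral_add hsq ((integrable_inv_normSq (hU0 z₀ hz₀)).const_mul 4)]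
        apply integral_mono hIntg.norm
          (hsq.add ((integrable_inv_normSq (hU0 z₀ hz₀)).const_mul 4))
        intro t
        simp only [Pi.add_apply]
        rw [norm_div, div_eq_mul_inv]
        have h1 : ‖(t : ℂ) - z₀‖ ≤ 2 * ‖(t : ℂ) - z‖ := by
          have e1 : |z₀.im| ≤ ‖(t : ℂ) - z₀‖ := by
            have := Complex.abs_im_le_norm ((t : ℂ) - z₀)
            simpa using this
          have e2 := norm_sub_norm_le ((t : ℂ) - z₀) (z - z₀)
          rw [sub_sub_sub_cancel_right] at e2
          linarith
        have h2 : 0 < ‖(t : ℂ) - z₀‖ := norm_pos_iff.2 (real_sub_ne (hU0 z₀ hz₀) t)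
        have h3 : ‖(t : ℂ) - z‖⁻¹ ≤ 2 * ‖(t : ℂ) - z₀‖⁻¹ := by
          rw [← div_eq_mul_inv, inv_le_comm₀ (by linarith) (by positivity), inv_div]
          linarith
        have h4 : (‖(t : ℂ) - z‖⁻¹) ^ 2 ≤ 4 * ((t - z₀.re) ^ 2 + z₀.im ^ 2)⁻¹ := by
          rw [← norm_real_sub_sq, ← inv_pow]
          calc (‖(t : ℂ) - z‖⁻¹) ^ 2 ≤ (2 * ‖(t : ℂ) - z₀‖⁻¹) ^ 2 := by gcongr
            _ = _ := by ring
        have h5 := two_mul_le_add_sq ‖h t‖ (‖(t : ℂ) - z‖⁻¹)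
        have h6 : 0 ≤ ‖h t‖ * ‖(t : ℂ) - z‖⁻¹ := by positivity
        linarith
  refine ⟨main _ isOpen_uhp fun z hz => (ne_of_gt hz), main _ ?_ fun z hz => (ne_of_lt hz)⟩
  exact isOpen_lt Complex.continuous_im continuous_const

/-- averaging lemma: if all averages are bounded then Cauchy's formulas hold -/
theorem cauchy_of_avg (hd : DifferentiableOn ℂ G {z | 0 < z.im})
    (hc : ContinuousOn G {z | 0 ≤ z.im}) (hL : MemLp (fun t : ℝ => G t) 2)
    (hb : ∀ δ : ℝ, 0 < δ → δ ≤ 1 → ∃ B : ℝ, ∀ z : ℂ, 0 ≤ z.im → ‖avg (fun _ => 1) δ G z‖ ≤ B)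
    {ζ : ℂ} (hζ : 0 < ζ.im) :
    ∫ t : ℝ, G t / (t - ζ) = 2 * Real.pi * I * G ζ ∧ ∫ t : ℝ, G t / (t - conj ζ) = 0 := by
  have hcr := cont_real hc
  obtain ⟨hCd, hCd'⟩ := cauchyInt_diff hcr.measurable hL
  set Φ : ℂ → ℂ := fun z : ℂ => ∫ t : ℝ, G t / (t - z) with hΦ
  -- Fubini
  have hfub : ∀ (δ : ℝ) (x : ℂ), x.im ≠ 0 → ∫ t : ℝ, avg (fun _ => 1) δ G t / (t - x)
      = ∫ s in (0 : ℝ)..1, Φ (x + δ * s) := by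
    intro δ x hx
    have hκ : Continuous (fun t : ℝ => ((t : ℂ) - x)⁻¹) :=
      (Complex.continuous_ofReal.sub continuous_const).inv₀ (real_sub_ne hx)
    have h1 := prod_integrable (δ := δ) hc hL hκ (memLp_inv_sub hx)
    have h2 := integral_integral_swap (f := fun (s t : ℝ) => G (t + δ * s) * ((t : ℂ) - x)⁻¹) h1
    rw [intervalIntegral.integral_of_le zero_le_one]
    calc ∫ t : ℝ, avg (fun _ => 1) δ G t / (t - x)
        = ∫ t : ℝ, ∫ s in Ioc (0 : ℝ) 1, G (t + δ * s) * ((t : ℂ) - x)⁻¹ := by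
          congr 1
          funext t
          unfold avg
          rw [div_eq_mul_inv, intervalIntegral.integral_of_le zero_le_one, integral_mul_const]
          simp
      _ = ∫ s in Ioc (0 : ℝ) 1, ∫ t : ℝ, G (t + δ * s) * ((t : ℂ) - x)⁻¹ := h2.symm
      _ = _ := by
          congr 1
          funext s
          simp only [hΦ]
          rw [← integral_add_right_eq_self (μ := volume) (fun t : ℝ => G (t : ℂ) / (t - (x + δ * s))) (δ * s)]
          congr 1
          funext t
          push_cast
          rw [div_eq_mul_inv]
          congr 2
          ring
  have hzero : ∀ Ψ : ℝ → ℂ, Continuous Ψ → (∀ δ : ℝ, 0 < δ → δ ≤ 1 → ∫ s in (0 : ℝ)..1, Ψ (δ * s) = 0) →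
      Ψ 0 = 0 := by
    intro Ψ hΨ h
    have hcont : Continuous (fun δ : ℝ => ∫ s in (0 : ℝ)..1, Ψ (δ * s)) := by
      apply intervalIntegral.continuous_parametric_intervalIntegral_of_continuous'
      simp only [Function.uncurry_def]
      exact hΨ.comp (by fun_prop)
    have h1 : Tendsto (fun δ : ℝ => ∫ s in (0 : ℝ)..1, Ψ (δ * s)) (𝓝[>] 0)
        (𝓝 (∫ s in (0 : ℝ)..1, Ψ (0 * s))) := (hcont.tendsto 0).mono_left nhdsWithin_le_nhds
    have h2 : Tendsto (fun δ : ℝ => ∫ s in (0 : ℝ)..1, Ψ (δ * s)) (𝓝[>] 0) (𝓝 0) := by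
      apply tendsto_const_nhds.congr'
      filter_upwards [Ioc_mem_nhdsGT (zero_lt_one' ℝ)] with δ hδ
      exact (h δ hδ.1 hδ.2).symm
    have := tendsto_nhds_unique h1 h2
    simpa using this
  constructor
  · have hcΨ : Continuous (fun σ : ℝ => Φ (ζ + σ) - 2 * Real.pi * I * G (ζ + σ)) := by
      have e1 : Continuous (fun σ : ℝ => Φ (ζ + σ)) :=
        hCd.continuousOn.comp_continuous (by fun_prop) (fun s => by simpa using hζ)
      have e2 : Continuous (fun σ : ℝ => G (ζ + σ)) :=
        hd.continuousOn.comp_continuous (by fun_prop) (fun s => by simpa using hζ)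
      exact e1.sub (continuous_const.mul e2)
    have := hzero _ hcΨ ?_
    · simp only [Complex.ofReal_zero, add_zero, sub_eq_zero] at this
      exact this
    intro δ hδ hδ1
    obtain ⟨B, hB⟩ := hb δ hδ hδ1
    have h1 := (cauchy_bdd (avg_diff (δ := δ) hd continuous_const) (avg_cont hc continuous_const) hB
      (avg_memLp hc hL) hζ).1
    rw [hfub δ ζ hζ.ne'] at h1
    rw [intervalIntegral.integral_sub, intervalIntegral.integral_const_mul]
    · simp only [avg, one_mul] at h1
      push_cast
      rw [h1, sub_self]
    · apply Continuous.intervalIntegrable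
      exact hCd.continuousOn.comp_continuous (by fun_prop) (fun s => by simpa using hζ)
    · apply Continuous.intervalIntegrable
      apply continuous_const.mul
      exact hd.continuousOn.comp_continuous (by fun_prop) (fun s => by simpa using hζ)
  · have hcΨ : Continuous (fun σ : ℝ => Φ (conj ζ + σ)) := by
      exact hCd'.continuousOn.comp_continuous (by fun_prop) (fun s => by simpa using hζ)
    have := hzero _ hcΨ ?_
    · simp only [Complex.ofReal_zero, add_zero] at this
      exact this
    intro δ hδ hδ1
    obtain ⟨B, hB⟩ := hb δ hδ hδ1
    have h1 := (cauchy_bdd (avg_diff (δ := δ) hd continuous_const) (avg_cont hc continuous_const) hB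
      (avg_memLp hc hL) hζ).2
    rw [hfub δ (conj ζ) (by simpa using hζ.ne')] at h1
    rw [← h1]
    push_cast
    rfl
end


/-! ### Cauchy formulas for functions of bounded type and non-positive mean type -/

theorem pl_uhp {g : ℂ → ℂ} (hd : DifferentiableOn ℂ g {z | 0 < z.im})
    (hc : ContinuousOn g {z | 0 ≤ z.im}) {A κ C B Y : ℝ} (hκ : 0 ≤ κ)
    (hexp : ∀ z : ℂ, 0 ≤ z.im → ‖g z‖ ≤ A * Real.exp (κ * z.im)) (hre : ∀ t : ℝ, ‖g t‖ ≤ C)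
    (him : ∀ y : ℝ, Y ≤ y → ‖g (y * I)‖ ≤ B) {z : ℂ} (hz : 0 ≤ z.im) : ‖g z‖ ≤ C := by
  have hA : 0 ≤ A := by
    have := hexp 0 (by simp)
    simp at this
    exact (norm_nonneg _).trans this
  have h := PhragmenLindelof.right_half_plane_of_bounded_on_real (f := fun z => g (I * z)) (C := C)
    (z := -I * z) ?_ ?_ ?_ ?_ ?_
  · have e : I * (-I * z) = z := by
      rw [← mul_assoc]
      simp
    simpa only [e] using h
  · constructor
    · apply hd.comp (by fun_prop)
      intro w hw
      simpa using hw
    · have hcl : closure {z : ℂ | 0 < z.re} ⊆ {z : ℂ | 0 ≤ z.re} := by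
        apply closure_minimal
        · intro w hw
          exact le_of_lt (show 0 < w.re from hw)
        · exact isClosed_le continuous_const Complex.continuous_re
      apply hc.comp (by fun_prop)
      intro w hw
      simpa using hcl hw
  · refine ⟨1, by norm_num, κ, ?_⟩
    apply Asymptotics.IsBigO.of_bound A
    rw [eventually_inf_principal]
    refine Eventually.of_forall fun w hw => ?_
    have hw' : 0 < w.re := hw
    rw [Real.norm_eq_abs, Real.abs_exp, Real.rpow_one]
    refine (hexp (I * w) (by simpa using hw'.le)).trans ?_
    gcongr
    simpa using (Complex.re_le_norm w)
  · refine ⟨B, ?_⟩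
    rw [eventually_map]
    filter_upwards [eventually_ge_atTop Y] with y hy
    rw [mul_comm]
    exact him y hy
  · intro x
    have e : I * (x * I) = ((-x : ℝ) : ℂ) := by
      rw [mul_comm, mul_assoc, I_mul_I]
      simp
    simp only [e]
    exact hre _
  · simpa using hz

theorem meanType_bound {N : ℂ → ℂ} {C : ℝ} (hC : 0 ≤ C)
    (hg : ∀ z : ℂ, 0 < z.im → ‖N z‖ ≤ Real.exp (C * ((1 + ‖z‖ ^ 2) / z.im)))
    (hmt : NonposMeanType N) {ε : ℝ} (hε : 0 < ε) :
    ∃ Y : ℝ, ∀ y : ℝ, Y ≤ y → ‖N (y * I)‖ ≤ Real.exp (ε * y) := by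
  have hbd : IsBoundedUnder (· ≤ ·) atTop (fun y : ℝ => Real.log ‖N ((y : ℂ) * I)‖ / y) := by
    refine ⟨2 * C, ?_⟩
    rw [eventually_map]
    filter_upwards [eventually_ge_atTop 1] with y hy
    rw [div_le_iff₀ (by linarith)]
    by_cases h0 : N (y * I) = 0
    · rw [h0]
      simp
      positivity
    · rw [Real.log_le_iff_le_exp (norm_pos_iff.2 h0)]
      refine (hg (y * I) (by simp; linarith)).trans ?_
      apply Real.exp_le_exp.2
      have e1 : ‖(y : ℂ) * I‖ = y := by simp; linarith
      have e2 : ((y : ℂ) * I).im = y := by simp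
      rw [e1, e2, ← mul_div_assoc, div_le_iff₀ (by linarith)]
      have : 1 + y ^ 2 ≤ 2 * y ^ 2 := by nlinarith
      nlinarith
  have h1 := Filter.eventually_lt_of_limsup_lt (lt_of_le_of_lt hmt hε) hbd
  obtain ⟨Y, hY⟩ := eventually_atTop.1 h1
  refine ⟨max Y 1, fun y hy => ?_⟩
  have h2 := hY y ((le_max_left _ _).trans hy)
  have hy1 : 1 ≤ y := (le_max_right _ _).trans hy
  rw [div_lt_iff₀ (by linarith)] at h2
  by_cases h0 : N (y * I) = 0
  · rw [h0]
    simp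
    positivity
  · exact (Real.log_le_iff_le_exp (norm_pos_iff.2 h0)).1 h2.le

theorem norm_exp_I_mul (k : ℝ) (z : ℂ) : ‖exp (I * k * z)‖ = Real.exp (-k * z.im) := by
  rw [Complex.norm_exp]
  simp

/-- pointwise bound from Cauchy's formula -/
theorem bound_of_cauchy {G : ℂ → ℂ} (hc : ContinuousOn G {z | 0 ≤ z.im})
    (hL : MemLp (fun t : ℝ => G t) 2) {ζ : ℂ} (hζ : 0 < ζ.im)
    (h : ∫ t : ℝ, G t / (t - ζ) = 2 * Real.pi * I * G ζ) :
    ‖G ζ‖ ≤ (∫ t : ℝ, ‖G t‖ ^ 2) + Real.pi / ζ.im := by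
  have h1 : ‖∫ t : ℝ, G t / (t - ζ)‖ ≤ (∫ t : ℝ, ‖G t‖ ^ 2) + Real.pi / ζ.im := by
    rw [← integral_inv_normSq hζ, ← integral_add (sq_int hc hL) (integrable_inv_normSq hζ.ne')]
    apply norm_integral_le_of_norm_le ((sq_int hc hL).add (integrable_inv_normSq hζ.ne'))
    refine Eventually.of_forall fun t => ?_
    simp only [Pi.add_apply]
    rw [norm_div, div_eq_mul_inv, ← norm_real_sub_sq, ← inv_pow]
    have := two_mul_le_add_sq ‖G t‖ (‖(t : ℂ) - ζ‖⁻¹)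
    have h6 : 0 ≤ ‖G t‖ * ‖(t : ℂ) - ζ‖⁻¹ := by positivity
    linarith
  rw [h] at h1
  have h2 : ‖2 * Real.pi * I * G ζ‖ = 2 * Real.pi * ‖G ζ‖ := by
    simp [abs_of_pos Real.pi_pos]
  rw [h2] at h1
  have := Real.pi_gt_three
  have := norm_nonneg (G ζ)
  nlinarith

theorem cauchy_of_boundedType {N : ℂ → ℂ} (hd : DifferentiableOn ℂ N {z | 0 < z.im})
    (hc : ContinuousOn N {z | 0 ≤ z.im}) (hL : MemLp (fun t : ℝ => N t) 2)
    (hbt : OfBoundedType N) (hmt : NonposMeanType N) {ζ : ℂ} (hζ : 0 < ζ.im) :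
    ∫ t : ℝ, N t / (t - ζ) = 2 * Real.pi * I * N ζ ∧ ∫ t : ℝ, N t / (t - conj ζ) = 0 := by
  obtain ⟨C, hC, hg⟩ := boundedType_growth hbt
  -- exponential type of the averages
  have hI0 : 0 ≤ ∫ t : ℝ, ‖N t‖ ^ 2 := integral_nonneg fun _ => by positivity
  have havg : ∀ (w : ℝ → ℂ), Continuous w → (∀ s, ‖w s‖ ≤ 1) → ∀ δ : ℝ, 0 < δ → δ ≤ 1 →
      ∀ z : ℂ, 0 ≤ z.im → ‖avg w δ N z‖
        ≤ (1 + δ⁻¹ * ∫ t : ℝ, ‖N t‖ ^ 2) * Real.exp (16 * (3 * C) * z.im) := by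
    intro w hw hw1 δ hδ hδ1
    apply half_disc_estimate (avg_diff hd hw) (avg_cont hc hw) _ (by positivity)
      (avg_real_bound hc hw1 hL hδ)
    · intro z hz
      exact avg_growth hc hw1 hδ hδ1 hC hg hz
    · have : 0 ≤ δ⁻¹ * ∫ t : ℝ, ‖N t‖ ^ 2 := by positivity
      linarith
  -- pass 1
  set k : ℝ := 16 * (3 * C) with hk
  have hk0 : 0 ≤ k := by positivity
  set M : ℂ → ℂ := fun z => exp (I * k * z) * N z with hM
  have hMd : DifferentiableOn ℂ M {z | 0 < z.im} := by
    apply DifferentiableOn.mul _ hd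
    fun_prop
  have hMc : ContinuousOn M {z | 0 ≤ z.im} := by
    apply ContinuousOn.mul _ hc
    fun_prop
  have hMr : ∀ t : ℝ, ‖M t‖ = ‖N t‖ := by
    intro t
    simp only [hM]
    rw [norm_mul, norm_exp_I_mul]
    simp
  have hML : MemLp (fun t : ℝ => M t) 2 := by
    refine hL.of_le (cont_real hMc).aestronglyMeasurable (Eventually.of_forall fun t => ?_)
    rw [hMr]
  have hMb : ∀ δ : ℝ, 0 < δ → δ ≤ 1 → ∃ B : ℝ, ∀ z : ℂ, 0 ≤ z.im → ‖avg (fun _ => 1) δ M z‖ ≤ B := by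
    intro δ hδ hδ1
    refine ⟨1 + δ⁻¹ * ∫ t : ℝ, ‖N t‖ ^ 2, fun z hz => ?_⟩
    have e : avg (fun _ => 1) δ M z
        = exp (I * k * z) * avg (fun s => exp (I * k * (δ * s : ℝ))) δ N z := by
      unfold avg
      rw [← intervalIntegral.integral_const_mul]
      apply intervalIntegral.integral_congr
      intro s _
      simp only [hM]
      rw [one_mul, mul_add, Complex.exp_add]
      push_cast
      ring
    rw [e, norm_mul, norm_exp_I_mul]
    have h1 := havg (fun s => exp (I * k * (δ * s : ℝ))) (by fun_prop)
      (fun s => by rw [norm_exp_I_mul]; simp) δ hδ hδ1 z hz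
    calc Real.exp (-k * z.im) * ‖avg (fun s => exp (I * k * (δ * s : ℝ))) δ N z‖
        ≤ Real.exp (-k * z.im) * ((1 + δ⁻¹ * ∫ t : ℝ, ‖N t‖ ^ 2) * Real.exp (k * z.im)) := by
          gcongr
      _ = (1 + δ⁻¹ * ∫ t : ℝ, ‖N t‖ ^ 2) * (Real.exp (-k * z.im) * Real.exp (k * z.im)) := by ring
      _ = _ := by
          rw [← Real.exp_add]
          simp
  have hNexp : ∀ z : ℂ, 0 < z.im →
      ‖N z‖ ≤ ((∫ t : ℝ, ‖N t‖ ^ 2) + Real.pi / z.im) * Real.exp (k * z.im) := by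
    intro z hz
    have h1 := bound_of_cauchy hMc hML hz (cauchy_of_avg hMd hMc hML hMb hz).1
    simp only [hMr] at h1
    have h2 : ‖N z‖ = ‖M z‖ * Real.exp (k * z.im) := by
      simp only [hM]
      rw [norm_mul, norm_exp_I_mul, mul_right_comm, ← Real.exp_add]
      simp
    rw [h2]
    gcongr
  -- pass 2: boundedness on `im ≥ 1`
  set K : ℝ := ((∫ t : ℝ, ‖N t‖ ^ 2) + Real.pi) * Real.exp k with hK
  have hNb : ∀ z : ℂ, 1 ≤ z.im → ‖N z‖ ≤ K := by
    intro z hz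
    have hε : ∀ ε : ℝ, 0 < ε → ‖N z‖ ≤ K * Real.exp (ε * (z - I).im) := by
      intro ε hε
      obtain ⟨Y, hY⟩ := meanType_bound hC hg hmt hε
      have himI : ∀ w : ℂ, 0 ≤ w.im → 1 ≤ (w + I).im := by
        intro w hw
        simpa using hw
      have hP := pl_uhp (g := fun w => exp (I * ε * w) * N (w + I)) (C := K) (A := K) (κ := k)
        (B := Real.exp ε) (Y := max Y 0) (z := z - I) ?_ ?_ hk0 ?_ ?_ ?_ ?_
      · simp only [sub_add_cancel] at hP
        rw [norm_mul, norm_exp_I_mul] at hP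
        calc ‖N z‖ = Real.exp (-ε * (z - I).im) * ‖N z‖ * Real.exp (ε * (z - I).im) := by
              rw [mul_right_comm, ← Real.exp_add]
              simp
          _ ≤ K * Real.exp (ε * (z - I).im) := by gcongr
      · apply DifferentiableOn.mul (by fun_prop)
        apply hd.comp (by fun_prop)
        intro w hw
        exact lt_of_lt_of_le one_pos (himI w (le_of_lt hw))
      · apply ContinuousOn.mul (by fun_prop)
        apply hc.comp (by fun_prop)
        intro w hw
        exact le_trans zero_le_one (himI w hw)
      · intro w hw
        have h1 := himI w hw
        rw [norm_mul, norm_exp_I_mul]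
        have h2 : Real.exp (-ε * w.im) ≤ 1 := by
          rw [Real.exp_le_one_iff]
          nlinarith
        refine (mul_le_of_le_one_left (norm_nonneg _) h2).trans ?_
        refine (hNexp (w + I) (by linarith)).trans ?_
        have h3 : Real.pi / (w + I).im ≤ Real.pi := div_le_self Real.pi_pos.le h1
        rw [hK, mul_assoc ((∫ t : ℝ, ‖N t‖ ^ 2) + Real.pi), ← Real.exp_add]
        have h4 : k * (w + I).im = k + k * w.im := by simp; ring
        rw [h4]
        gcongr
      · intro t
        rw [norm_mul, norm_exp_I_mul]
        have h1 := himI t (by simp)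
        have h0 := hNexp (t + I) (by linarith)
        simp at h0 ⊢
        exact h0
      · intro y hy
        have hy0 : 0 ≤ y := (le_max_right _ _).trans hy
        have hyY : Y ≤ y := (le_max_left _ _).trans hy
        rw [norm_mul, norm_exp_I_mul]
        have h1 := hY (y + 1) (by linarith)
        have e : (y : ℂ) * I + I = ((y + 1 : ℝ) : ℂ) * I := by push_cast; ring
        rw [e]
        calc Real.exp (-ε * ((y : ℂ) * I).im) * ‖N (((y + 1 : ℝ) : ℂ) * I)‖
            ≤ Real.exp (-ε * ((y : ℂ) * I).im) * Real.exp (ε * (y + 1)) := by gcongr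
          _ = Real.exp ε := by
            rw [← Real.exp_add]
            congr 1
            simp
            ring
      · simpa using hz
    have ht : Tendsto (fun ε : ℝ => K * Real.exp (ε * (z - I).im)) (𝓝[>] 0) (𝓝 K) := by
      have : Continuous (fun ε : ℝ => K * Real.exp (ε * (z - I).im)) := by fun_prop
      have h1 := (this.tendsto 0).mono_left (nhdsWithin_le_nhds (s := Ioi 0))
      simpa using h1
    apply ge_of_tendsto ht
    filter_upwards [self_mem_nhdsWithin] with ε hε'
    exact hε ε hε'
  apply cauchy_of_avg hd hc hL _ hζ
  intro δ hδ hδ1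
  refine ⟨1 + δ⁻¹ * ∫ t : ℝ, ‖N t‖ ^ 2, fun z hz => ?_⟩
  apply pl_uhp (avg_diff hd continuous_const) (avg_cont hc continuous_const) hk0
    (havg (fun _ => 1) continuous_const (by simp) δ hδ hδ1)
    (avg_real_bound hc (by simp) hL hδ) (Y := 1) (B := K) _ hz
  intro y hy
  apply avg_norm_le_const hc (by simp) (by simp; linarith)
  intro s _
  apply hNb
  simpa using hy


/-! ### A Liouville theorem, functions of bounded type -/

theorem liouville_im {f : ℂ → ℂ} (hf : Differentiable ℂ f) {C : ℝ}
    (hC : ∀ z : ℂ, z.im ≠ 0 → ‖f z‖ ≤ C / |z.im|) (z : ℂ) : f z = 0 := by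
  have hC0 : 0 ≤ C := by
    have := hC I (by simp)
    simp at this
    exact (norm_nonneg _).trans this
  have key : ∀ R : ℝ, ‖z‖ < R → ‖f z‖ * (R ^ 2 - ‖z‖ ^ 2) ≤ 2 * R * C := by
    intro R hR
    have hR0 : 0 < R := (norm_nonneg z).trans_lt hR
    have h1 := Complex.norm_le_of_forall_mem_frontier_norm_le (f := fun w => f w * (w ^ 2 - (R : ℂ) ^ 2))
      (U := Metric.ball 0 R) Metric.isBounded_ball (C := 2 * R * C)
      (Differentiable.diffContOnCl (by fun_prop)) ?_ (z := z) (subset_closure (by simpa using hR))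
    · rw [norm_mul] at h1
      refine le_trans ?_ h1
      gcongr
      have := norm_sub_norm_le ((R : ℂ) ^ 2) (z ^ 2)
      rw [norm_pow, norm_pow, Complex.norm_real, Real.norm_eq_abs, sq_abs, norm_sub_rev] at this
      exact this
    · intro w hw
      rw [frontier_ball _ hR0.ne', mem_sphere_zero_iff_norm] at hw
      rw [norm_mul]
      have hn : w.re ^ 2 + w.im ^ 2 = R ^ 2 := by
        rw [← hw, ← Complex.normSq_eq_norm_sq, normSq_apply]
        ring
      have h2 : ‖w ^ 2 - (R : ℂ) ^ 2‖ = 2 * R * |w.im| := by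
        rw [← sq_eq_sq₀ (norm_nonneg _) (by positivity), mul_pow, sq_abs,
          ← Complex.normSq_eq_norm_sq, normSq_apply]
        have e1 : (w ^ 2 - (R : ℂ) ^ 2).re = w.re ^ 2 - w.im ^ 2 - R ^ 2 := by
          simp [sq]
        have e2 : (w ^ 2 - (R : ℂ) ^ 2).im = 2 * w.re * w.im := by
          simp [sq]
          ring
        rw [e1, e2, mul_pow, ← hn]
        ring
      rw [h2]
      by_cases h0 : w.im = 0
      · rw [h0]
        simp
        positivity
      · calc ‖f w‖ * (2 * R * |w.im|) ≤ C / |w.im| * (2 * R * |w.im|) := by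
              gcongr
              exact hC w h0
          _ = 2 * R * C := by
              have := abs_pos.2 h0
              field_simp
  by_contra hne
  have hpos : 0 < ‖f z‖ := norm_pos_iff.2 hne
  have h1 := key (2 * ‖z‖ + 4 * C / ‖f z‖ + 1) (by
    have : 0 ≤ 4 * C / ‖f z‖ := by positivity
    linarith [norm_nonneg z])
  set R := 2 * ‖z‖ + 4 * C / ‖f z‖ + 1 with hR
  have h2 : 0 ≤ 4 * C / ‖f z‖ := by positivity
  have h3 : 4 * C ≤ ‖f z‖ * (R - 1) := by
    have : 4 * C / ‖f z‖ ≤ R - 1 := by linarith [norm_nonneg z]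
    rw [div_le_iff₀ hpos] at this
    linarith
  have h4 : 0 < R := by linarith [norm_nonneg z]
  have h5 : R ^ 2 / 2 < R ^ 2 - ‖z‖ ^ 2 := by nlinarith [norm_nonneg z]
  have h6 : ‖f z‖ * (R ^ 2 / 2) < 2 * R * C := lt_of_lt_of_le (mul_lt_mul_of_pos_left h5 hpos) h1
  have h7 : ‖f z‖ * R < 4 * C := by
    by_contra hcon
    push Not at hcon
    nlinarith
  nlinarith

theorem OfBoundedType.of_bounded {N : ℂ → ℂ} (hd : DifferentiableOn ℂ N UHP) {C : ℝ}
    (hC : ∀ z ∈ UHP, ‖N z‖ ≤ C) : OfBoundedType N :=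
  ⟨N, fun _ => 1, hd, differentiableOn_const _, ⟨C, hC⟩, ⟨1, fun _ _ => by simp⟩,
    fun z _ => ⟨one_ne_zero, by simp⟩⟩

theorem OfBoundedType.congr {N M : ℂ → ℂ} (h : OfBoundedType N) (e : ∀ z ∈ UHP, M z = N z) :
    OfBoundedType M := by
  obtain ⟨u, v, hu, hv, hA, hB, h⟩ := h
  exact ⟨u, v, hu, hv, hA, hB, fun z hz => ⟨(h z hz).1, by rw [e z hz, (h z hz).2]⟩⟩

theorem bounded_mul_aux {u v : ℂ → ℂ} (hu : ∃ C : ℝ, ∀ z ∈ UHP, ‖u z‖ ≤ C)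
    (hv : ∃ C : ℝ, ∀ z ∈ UHP, ‖v z‖ ≤ C) : ∃ C : ℝ, ∀ z ∈ UHP, ‖u z * v z‖ ≤ C := by
  obtain ⟨A, hA⟩ := hu
  obtain ⟨B, hB⟩ := hv
  refine ⟨A * B, fun z hz => ?_⟩
  rw [norm_mul]
  exact mul_le_mul (hA z hz) (hB z hz) (norm_nonneg _) ((norm_nonneg _).trans (hA z hz))

theorem OfBoundedType.mul {N M : ℂ → ℂ} (hN : OfBoundedType N) (hM : OfBoundedType M) :
    OfBoundedType (fun z => N z * M z) := by
  obtain ⟨u, v, hu, hv, hA, hB, h⟩ := hN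
  obtain ⟨u', v', hu', hv', hA', hB', h'⟩ := hM
  refine ⟨fun z => u z * u' z, fun z => v z * v' z, hu.mul hu', hv.mul hv',
    bounded_mul_aux hA hA', bounded_mul_aux hB hB', fun z hz => ⟨?_, ?_⟩⟩
  · exact mul_ne_zero (h z hz).1 (h' z hz).1
  · simp only
    rw [(h z hz).2, (h' z hz).2, div_mul_div_comm]

theorem OfBoundedType.add {N M : ℂ → ℂ} (hN : OfBoundedType N) (hM : OfBoundedType M) :
    OfBoundedType (fun z => N z + M z) := by
  obtain ⟨u, v, hu, hv, hA, hB, h⟩ := hN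
  obtain ⟨u', v', hu', hv', hA', hB', h'⟩ := hM
  refine ⟨fun z => u z * v' z + v z * u' z, fun z => v z * v' z, (hu.mul hv').add (hv.mul hu'),
    hv.mul hv', ?_, bounded_mul_aux hB hB', fun z hz => ⟨?_, ?_⟩⟩
  · obtain ⟨C1, h1⟩ := bounded_mul_aux hA hB'
    obtain ⟨C2, h2⟩ := bounded_mul_aux hB hA'
    exact ⟨C1 + C2, fun z hz => (norm_add_le _ _).trans (add_le_add (h1 z hz) (h2 z hz))⟩
  · exact mul_ne_zero (h z hz).1 (h' z hz).1
  · simp only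
    rw [(h z hz).2, (h' z hz).2, div_add_div _ _ (h z hz).1 (h' z hz).1]

theorem OfBoundedType.const_mul {N : ℂ → ℂ} (hN : OfBoundedType N) (k : ℂ) :
    OfBoundedType (fun z => k * N z) :=
  (OfBoundedType.of_bounded (N := fun _ => k) (differentiableOn_const _) (C := ‖k‖)
    (fun _ _ => le_rfl)).mul hN

theorem cauchyInt_bt_nonneg {ρ : ℝ → ℝ} (hm : Measurable ρ) (h0 : ∀ t, 0 ≤ ρ t)
    (hL : MemLp (fun t => (ρ t : ℂ)) 2) : OfBoundedType (fun z : ℂ => ∫ t : ℝ, (ρ t : ℂ) / (t - z)) := by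
  have hd := (cauchyInt_diff (Complex.measurable_ofReal.comp hm) hL).1
  simp only [Function.comp] at hd
  set G : ℂ → ℂ := fun z : ℂ => ∫ t : ℝ, (ρ t : ℂ) / (t - z) with hG
  have him : ∀ z ∈ UHP, 0 ≤ (G z).im := by
    intro z hz
    have hz' : 0 < z.im := hz
    have hIntg : Integrable (fun t : ℝ => (ρ t : ℂ) / (t - z)) := by
      simp only [div_eq_mul_inv]
      exact L2_mul_integrable hL (memLp_inv_sub hz'.ne')
    simp only [hG]
    have := integral_im hIntg
    simp only [RCLike.im_to_complex] at this
    rw [← this]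
    apply integral_nonneg
    intro t
    have h1 := normSq_nonneg ((t : ℂ) - z)
    have h2 := h0 t
    have e : ((ρ t : ℂ) / (t - z)).im = ρ t * z.im / normSq ((t : ℂ) - z) := by
      rw [Complex.div_im]
      simp
      ring
    show 0 ≤ ((ρ t : ℂ) / (t - z)).im
    rw [e]
    positivity
  have hge : ∀ z ∈ UHP, 1 ≤ ‖G z + I‖ := by
    intro z hz
    have h1 := Complex.abs_im_le_norm (G z + I)
    have h2 := him z hz
    have h3 := le_abs_self (G z + I).im
    simp only [Complex.add_im, Complex.I_im] at h1 h3
    linarith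
  have hne : ∀ z ∈ UHP, G z + I ≠ 0 := by
    intro z hz
    rw [← norm_pos_iff]
    linarith [hge z hz]
  have hvd : DifferentiableOn ℂ (fun z => (G z + I)⁻¹) UHP := (hd.add_const I).inv hne
  have hvb : ∀ z ∈ UHP, ‖(G z + I)⁻¹‖ ≤ 1 := by
    intro z hz
    rw [norm_inv]
    exact inv_le_one_of_one_le₀ (hge z hz)
  refine ⟨fun z => 1 - I * (G z + I)⁻¹, fun z => (G z + I)⁻¹, ?_, hvd, ⟨2, ?_⟩, ⟨1, hvb⟩, ?_⟩
  · exact (differentiableOn_const _).sub (hvd.const_mul I)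
  · intro z hz
    refine (norm_sub_le _ _).trans ?_
    rw [norm_mul]
    have := hvb z hz
    simp at this ⊢
    linarith
  · intro z hz
    have h1 := hne z hz
    refine ⟨inv_ne_zero h1, ?_⟩
    field_simp
    ring

theorem cauchyInt_bt {h : ℝ → ℂ} (hm : Measurable h) (hL : MemLp h 2) :
    OfBoundedType (fun z : ℂ => ∫ t : ℝ, h t / (t - z)) := by
  have main : ∀ σ : ℝ → ℝ, Measurable σ → (∀ t, |σ t| ≤ ‖h t‖) →
      OfBoundedType (fun z : ℂ => ∫ t : ℝ, ((max (σ t) 0 : ℝ) : ℂ) / (t - z)) ∧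
      MemLp (fun t => ((max (σ t) 0 : ℝ) : ℂ)) 2 := by
    intro σ hσ hle
    have hm2 : Measurable (fun t => max (σ t) 0) := hσ.max measurable_const
    have hL2 : MemLp (fun t => ((max (σ t) 0 : ℝ) : ℂ)) 2 := by
      refine hL.of_le (Complex.measurable_ofReal.comp hm2).aestronglyMeasurable
        (Eventually.of_forall fun t => ?_)
      rw [Complex.norm_real, Real.norm_eq_abs, abs_of_nonneg (le_max_right _ _)]
      exact max_le ((le_abs_self _).trans (hle t)) (norm_nonneg _)
    exact ⟨cauchyInt_bt_nonneg hm2 (fun t => le_max_right _ _) hL2, hL2⟩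
  have hre : Measurable (fun t => (h t).re) := Complex.measurable_re.comp hm
  have him : Measurable (fun t => (h t).im) := Complex.measurable_im.comp hm
  obtain ⟨b1, l1⟩ := main (fun t => (h t).re) hre fun t => Complex.abs_re_le_norm _
  obtain ⟨b2, l2⟩ := main (fun t => -(h t).re) hre.neg fun t => by
    rw [abs_neg]; exact Complex.abs_re_le_norm _
  obtain ⟨b3, l3⟩ := main (fun t => (h t).im) him fun t => Complex.abs_im_le_norm _
  obtain ⟨b4, l4⟩ := main (fun t => -(h t).im) him.neg fun t => by
    rw [abs_neg]; exact Complex.abs_im_le_norm _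
  refine ((b1.add (b2.const_mul (-1))).add ((b3.const_mul I).add (b4.const_mul (-I)))).congr ?_
  intro z hz
  have hz' : z.im ≠ 0 := ne_of_gt (show 0 < z.im from hz)
  have hi : ∀ {g : ℝ → ℂ}, MemLp g 2 → Integrable (fun t : ℝ => g t / (t - z)) := by
    intro g hg
    simp only [div_eq_mul_inv]
    exact L2_mul_integrable hg (memLp_inv_sub hz')
  have hmm : ∀ x : ℝ, x = max x 0 - max (-x) 0 := by
    intro x
    rcases le_total 0 x with hx | hx
    · rw [max_eq_left hx, max_eq_right (by linarith)]; ring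
    · rw [max_eq_right hx, max_eq_left (by linarith)]; ring
  rw [← integral_const_mul, ← integral_const_mul, ← integral_const_mul,
    ← integral_add (hi l1) ((hi l2).const_mul _),
    ← integral_add ((hi l3).const_mul _) ((hi l4).const_mul _), ← integral_add]
  · congr 1
    funext t
    have e : h t = ((max (h t).re 0 - max (-(h t).re) 0 : ℝ) : ℂ)
        + ((max (h t).im 0 - max (-(h t).im) 0 : ℝ) : ℂ) * I := by
      rw [← hmm, ← hmm]
      exact (Complex.re_add_im _).symm
    conv_lhs => rw [e]
    push_cast
    ring
  · exact (hi l1).add ((hi l2).const_mul _)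
  · exact ((hi l3).const_mul _).add ((hi l4).const_mul _)

theorem nonposMeanType_of_bounded {N : ℂ → ℂ} {C : ℝ} (hC : ∀ y : ℝ, 1 ≤ y → ‖N (y * I)‖ ≤ C) :
    NonposMeanType N := by
  unfold NonposMeanType
  rw [limsup_eq]
  set S := {a : ℝ | ∀ᶠ y : ℝ in atTop, Real.log ‖N ((y : ℂ) * I)‖ / y ≤ a} with hS
  by_cases hb : BddBelow S
  · apply le_of_forall_pos_le_add
    intro ε hε
    rw [zero_add]
    apply csInf_le hb
    set L := Real.log (max C 1) with hL
    have hL0 : 0 ≤ L := Real.log_nonneg (le_max_right _ _)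
    show ∀ᶠ y : ℝ in atTop, Real.log ‖N ((y : ℂ) * I)‖ / y ≤ ε
    filter_upwards [eventually_ge_atTop 1, eventually_ge_atTop (L / ε)] with y hy hy2
    rw [div_le_iff₀ (by linarith)]
    rw [div_le_iff₀ hε] at hy2
    refine le_trans ?_ (hy2.trans_eq (mul_comm _ _))
    by_cases h0 : N (y * I) = 0
    · rw [h0]
      simpa using hL0
    · apply Real.log_le_log (norm_pos_iff.2 h0)
      exact (hC y hy).trans (le_max_left _ _)
  · rw [Real.sInf_of_not_bddBelow hb]


/-! ### Calculus of locally absolutely continuous functions -/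

theorem ac_congr {f h : ℝ → ℂ} {x y : ℝ} (hf : AbsolutelyContinuousOnInterval f x y)
    (e : ∀ t ∈ uIcc x y, h t = f t) : AbsolutelyContinuousOnInterval h x y := by
  rw [absolutelyContinuousOnInterval_iff] at hf ⊢
  intro ε hε
  obtain ⟨δ, hδ, H⟩ := hf ε hε
  refine ⟨δ, hδ, fun E hE hs => ?_⟩
  have := H E hE hs
  rwa [Finset.sum_congr rfl fun i hi => by rw [e _ (hE.1 i hi).1, e _ (hE.1 i hi).2]]

theorem ac_inv {f : ℝ → ℂ} {x y : ℝ} (hf : AbsolutelyContinuousOnInterval f x y)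
    (h0 : ∀ t ∈ uIcc x y, f t ≠ 0) : AbsolutelyContinuousOnInterval (fun t => (f t)⁻¹) x y := by
  obtain ⟨C, hC⟩ := isCompact_uIcc.exists_bound_of_continuousOn (hf.continuousOn.inv₀ h0)
  rw [absolutelyContinuousOnInterval_iff] at hf ⊢
  intro ε hε
  have hK : 0 < C ^ 2 + 1 := by positivity
  obtain ⟨δ, hδ, H⟩ := hf (ε / (C ^ 2 + 1)) (by positivity)
  refine ⟨δ, hδ, fun E hE hs => ?_⟩
  have h1 := H E hE hs
  rw [lt_div_iff₀ hK, mul_comm, Finset.mul_sum] at h1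
  refine lt_of_le_of_lt (Finset.sum_le_sum fun i hi => ?_) h1
  have ha := (hE.1 i hi).1
  have hb := (hE.1 i hi).2
  rw [dist_eq_norm, dist_eq_norm, inv_sub_inv (h0 _ ha) (h0 _ hb), norm_div, norm_mul, norm_sub_rev,
    div_eq_mul_inv, mul_inv, mul_comm]
  have c1 := hC _ ha
  have c2 := hC _ hb
  rw [Pi.inv_apply, norm_inv] at c1 c2
  gcongr
  have : (0 : ℝ) ≤ ‖f (E.2 i).1‖⁻¹ := by positivity
  have : (0 : ℝ) ≤ ‖f (E.2 i).2‖⁻¹ := by positivity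
  nlinarith

theorem ac_primitive {g : ℝ → ℂ} {x y : ℝ} (hg : IntervalIntegrable g volume x y) :
    AbsolutelyContinuousOnInterval (fun u => ∫ t in x..u, g t) x y := by
  have h1 := hg.norm.absolutelyContinuousOnInterval_intervalIntegral (c := x) left_mem_uIcc
  rw [absolutelyContinuousOnInterval_iff] at h1 ⊢
  intro ε hε
  obtain ⟨δ, hδ, H⟩ := h1 ε hε
  refine ⟨δ, hδ, fun E hE hs => lt_of_le_of_lt (Finset.sum_le_sum fun i hi => ?_) (H E hE hs)⟩
  have hu : ∀ {v}, v ∈ uIcc x y → IntervalIntegrable g volume x v := fun hv =>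
    hg.mono_set (uIcc_subset_uIcc_left hv)
  have ha := hu (hE.1 i hi).1
  have hb := hu (hE.1 i hi).2
  rw [dist_eq_norm, dist_eq_norm, intervalIntegral.integral_interval_sub_left ha hb,
    intervalIntegral.integral_interval_sub_left ha.norm hb.norm, Real.norm_eq_abs]
  exact intervalIntegral.norm_integral_le_abs_integral_norm

namespace HasACDeriv

variable {a b : ℝ} {f g h k : ℝ → ℂ}

theorem uIcc_sub {x y : ℝ} (hx : x ∈ Ioo a b) (hy : y ∈ Ioo a b) : uIcc x y ⊆ Ioo a b :=
  ordConnected_Ioo.uIcc_subset hx hy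

theorem ac (H : HasACDeriv a b f g) {x y : ℝ} (hx : x ∈ Ioo a b) (hy : y ∈ Ioo a b) :
    AbsolutelyContinuousOnInterval f x y := by
  have h1 := ac_primitive (H y hy x hx).1
  have h2 : AbsolutelyContinuousOnInterval (fun _ : ℝ => f x) x y := by
    simp only [AbsolutelyContinuousOnInterval, dist_self, Finset.sum_const_zero]
    exact tendsto_const_nhds
  refine ac_congr (h2.add h1) fun t ht => ?_
  exact (H t (uIcc_sub hx hy ht) x hx).2

theorem ae (H : HasACDeriv a b f g) {x y : ℝ} (hx : x ∈ Ioo a b) (hy : y ∈ Ioo a b) :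
    ∀ᵐ t, t ∈ uIcc x y → HasDerivAt f (g t) t := by
  filter_upwards [(H y hy x hx).1.ae_hasDerivAt_integral] with t ht htm
  have h1 := (ht htm x left_mem_uIcc).const_add (f x)
  refine h1.congr_of_eventuallyEq ?_
  filter_upwards [isOpen_Ioo.mem_nhds (uIcc_sub hx hy htm)] with u hu
  exact (H u hu x hx).2

theorem of_ac (hg : ∀ x ∈ Ioo a b, ∀ y ∈ Ioo a b, IntervalIntegrable g volume y x)
    (hac : ∀ x ∈ Ioo a b, ∀ y ∈ Ioo a b, AbsolutelyContinuousOnInterval f x y)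
    (hd : ∀ x ∈ Ioo a b, ∀ y ∈ Ioo a b, ∀ᵐ t, t ∈ uIcc x y → HasDerivAt f (g t) t) :
    HasACDeriv a b f g := by
  intro x hx y hy
  refine ⟨hg x hx y hy, ?_⟩
  have hi := hg x hx y hy
  have h1 := ac_primitive hi
  obtain ⟨C, hC⟩ := ((hac y hy x hx).sub h1).const_of_ae_hasDerivAt_zero (by
    filter_upwards [hd y hy x hx, hi.ae_hasDerivAt_integral] with t h2 h3 ht
    simpa using (h2 ht).sub (h3 ht y left_mem_uIcc))
  have e1 := hC x right_mem_uIcc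
  have e2 := hC y left_mem_uIcc
  simp only [Pi.sub_apply, intervalIntegral.integral_same, sub_zero] at e1 e2
  rw [e2, ← e1]
  ring

theorem continuousOn (H : HasACDeriv a b f g) : ContinuousOn f (Ioo a b) := by
  intro x hx
  obtain ⟨u, hu1, hu2⟩ := exists_between hx.1
  obtain ⟨v, hv1, hv2⟩ := exists_between hx.2
  have h1 : ContinuousOn f (uIcc u v) :=
    (H.ac ⟨hu1, hu2.trans hx.2⟩ ⟨hx.1.trans hv1, hv2⟩).continuousOn
  rw [uIcc_of_le (hu2.trans hv1).le] at h1
  exact (h1.continuousAt (Icc_mem_nhds hu2 hv1)).continuousWithinAt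

theorem contU (H : HasACDeriv a b f g) {x y : ℝ} (hx : x ∈ Ioo a b) (hy : y ∈ Ioo a b) :
    ContinuousOn f (uIcc x y) := H.continuousOn.mono (uIcc_sub hx hy)

theorem mul (H : HasACDeriv a b f g) (K : HasACDeriv a b h k) :
    HasACDeriv a b (fun t => f t * h t) (fun t => g t * h t + f t * k t) := by
  refine of_ac ?_ ?_ ?_
  · intro x hx y hy
    exact ((H x hx y hy).1.mul_continuousOn (K.contU hy hx)).add
      ((K x hx y hy).1.continuousOn_mul (H.contU hy hx))
  · intro x hx y hy
    exact (H.ac hx hy).smul (K.ac hx hy)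
  · intro x hx y hy
    filter_upwards [H.ae hx hy, K.ae hx hy] with t h1 h2 ht
    exact (h1 ht).mul (h2 ht)

theorem inv (H : HasACDeriv a b f g) (h0 : ∀ t ∈ Ioo a b, f t ≠ 0) :
    HasACDeriv a b (fun t => (f t)⁻¹) (fun t => - g t / f t ^ 2) := by
  refine of_ac ?_ ?_ ?_
  · intro x hx y hy
    simp only [div_eq_mul_inv]
    refine (H x hx y hy).1.neg.mul_continuousOn ?_
    exact ((H.contU hy hx).pow 2).inv₀ fun t ht => pow_ne_zero 2 (h0 t (uIcc_sub hy hx ht))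
  · intro x hx y hy
    exact ac_inv (H.ac hx hy) fun t ht => h0 t (uIcc_sub hx hy ht)
  · intro x hx y hy
    filter_upwards [H.ae hx hy] with t h1 ht
    exact (h1 ht).inv (h0 t (uIcc_sub hx hy ht))

theorem add (H : HasACDeriv a b f g) (K : HasACDeriv a b h k) :
    HasACDeriv a b (fun t => f t + h t) (fun t => g t + k t) := by
  intro x hx y hy
  refine ⟨(H x hx y hy).1.add (K x hx y hy).1, ?_⟩
  show f x + h x = f y + h y + _
  rw [intervalIntegral.integral_add (H x hx y hy).1 (K x hx y hy).1, (H x hx y hy).2,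
    (K x hx y hy).2]
  ring

theorem const_mul (H : HasACDeriv a b f g) (z : ℂ) :
    HasACDeriv a b (fun t => z * f t) (fun t => z * g t) := by
  intro x hx y hy
  refine ⟨(H x hx y hy).1.const_mul z, ?_⟩
  show z * f x = z * f y + _
  rw [intervalIntegral.integral_const_mul, (H x hx y hy).2]
  ring

theorem sub (H : HasACDeriv a b f g) (K : HasACDeriv a b h k) :
    HasACDeriv a b (fun t => f t - h t) (fun t => g t - k t) := by
  intro x hx y hy
  refine ⟨(H x hx y hy).1.sub (K x hx y hy).1, ?_⟩
  show f x - h x = f y - h y + _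
  rw [intervalIntegral.integral_sub (H x hx y hy).1 (K x hx y hy).1, (H x hx y hy).2,
    (K x hx y hy).2]
  ring

theorem congr (H : HasACDeriv a b f g) (hf : ∀ t ∈ Ioo a b, h t = f t)
    (hg : ∀ᵐ t, t ∈ Ioo a b → k t = g t) : HasACDeriv a b h k := by
  intro x hx y hy
  have hs : uIoc y x ⊆ Ioo a b := uIoc_subset_uIcc.trans (uIcc_sub hy hx)
  have he : ∀ᵐ t, t ∈ uIoc y x → g t = k t := by
    filter_upwards [hg] with t ht htm
    exact (ht (hs htm)).symm
  refine ⟨(H x hx y hy).1.congr_ae ?_, ?_⟩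
  · rw [EventuallyEq, ae_restrict_iff' measurableSet_uIoc]
    exact he
  · rw [hf x hx, hf y hy, (H x hx y hy).2, intervalIntegral.integral_congr_ae he]

theorem conj' (H : HasACDeriv a b f g) :
    HasACDeriv a b (fun t => conj (f t)) (fun t => conj (g t)) := by
  intro x hx y hy
  constructor
  · have := (H x hx y hy).1
    rw [intervalIntegrable_iff] at this ⊢
    exact (Complex.conjLIE.toContinuousLinearEquiv.integrable_comp_iff).2 this
  · show conj (f x) = conj (f y) + _
    rw [(H x hx y hy).2, map_add]
    congr 1
    simp only [intervalIntegral.intervalIntegral_eq_integral_uIoc]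
    rw [integral_conj]
    split_ifs <;> simp

theorem primitive (hg : ∀ x ∈ Ioo a b, ∀ y ∈ Ioo a b, IntervalIntegrable g volume y x) {c : ℝ}
    (hc : c ∈ Ioo a b) : HasACDeriv a b (fun x => ∫ t in c..x, g t) g := by
  intro x hx y hy
  refine ⟨hg x hx y hy, ?_⟩
  rw [intervalIntegral.integral_add_adjacent_intervals (hg y hy c hc) (hg x hx y hy)]

theorem primitive' (hg : ∀ x ∈ Ioo a b, ∀ y ∈ Ioo a b, IntervalIntegrable g volume y x) {c : ℝ}
    (hc : c ∈ Ioo a b) : HasACDeriv a b (fun x => ∫ t in x..c, g t) (fun t => - g t) := by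
  refine ((primitive hg hc).const_mul (-1)).congr ?_ (Eventually.of_forall fun t _ => by simp)
  intro t _
  rw [intervalIntegral.integral_symm]
  simp

end HasACDeriv


/-! ### Sturm-Liouville systems -/

theorem tendsto_left_integral {g : ℝ → ℂ} {a c : ℝ} (hac : a < c) (hg : IntegrableOn g (Ioo a c)) :
    Tendsto (fun y => ∫ t in y..c, g t) (𝓝[>] a) (𝓝 (∫ t in Ioo a c, g t)) := by
  have h1 : IntegrableOn g (uIcc a c) := by
    rw [uIcc_of_le hac.le, integrableOn_Icc_iff_integrableOn_Ioo]
    exact hg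
  have h2 := intervalIntegral.continuousOn_primitive_interval_left h1 a left_mem_uIcc
  rw [uIcc_of_le hac.le] at h2
  have h3 : Tendsto (fun y => ∫ t in y..c, g t) (𝓝[>] a) (𝓝 (∫ t in a..c, g t)) := by
    refine tendsto_nhdsWithin_mono_left (s := Ioc a c) Ioc_subset_Icc_self h2 |>.mono_left ?_
    rw [nhdsWithin_Ioc_eq_nhdsGT hac]
  rwa [intervalIntegral.integral_of_le hac.le, integral_Ioc_eq_integral_Ioo] at h3

theorem integrableOn_mul_mul {S : Set ℝ} {r : ℝ → ℝ} {f h : ℝ → ℂ} (hr : Measurable r)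
    (hr0 : ∀ᵐ t ∂(volume.restrict S), 0 < r t)
    (mf : AEStronglyMeasurable f (volume.restrict S))
    (mh : AEStronglyMeasurable h (volume.restrict S))
    (hf : IntegrableOn (fun x => ‖f x‖ ^ 2 * r x) S)
    (hh : IntegrableOn (fun x => ‖h x‖ ^ 2 * r x) S) :
    IntegrableOn (fun x => f x * h x * (r x : ℂ)) S := by
  refine Integrable.mono' (hf.add hh) ((mf.mul mh).mul
    (Complex.measurable_ofReal.comp hr).aestronglyMeasurable) ?_
  filter_upwards [hr0] with t ht
  rw [norm_mul, norm_mul, Complex.norm_real, Real.norm_eq_abs, abs_of_pos ht]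
  simp only [Pi.add_apply]
  rw [← add_mul]
  gcongr
  nlinarith [sq_nonneg (‖f t‖ - ‖h t‖), sq_nonneg (‖f t‖), sq_nonneg (‖h t‖)]

namespace SLSys

variable {a b : ℝ} {p q r s : ℝ → ℝ} {f fq w h hq v : ℝ → ℂ}

theorem wr (F : SLSys a b p q r s f fq w) (G : SLSys a b p q r s h hq v) :
    HasACDeriv a b (Wr f fq h hq) (fun x => (r x : ℂ) * (w x * h x - f x * v x)) := by
  refine ((F.fst.mul G.snd).sub (F.snd.mul G.fst)).congr (fun t _ => rfl)
    (Eventually.of_forall fun t _ => ?_)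
  ring

theorem conj' (F : SLSys a b p q r s f fq w) :
    SLSys a b p q r s (fun x => conj (f x)) (fun x => conj (fq x)) (fun x => conj (w x)) := by
  refine ⟨F.fst.conj'.congr (fun _ _ => rfl) (Eventually.of_forall fun t _ => ?_),
    F.snd.conj'.congr (fun _ _ => rfl) (Eventually.of_forall fun t _ => ?_)⟩ <;> simp

theorem sub (F : SLSys a b p q r s f fq w) (G : SLSys a b p q r s h hq v) :
    SLSys a b p q r s (fun x => f x - h x) (fun x => fq x - hq x) (fun x => w x - v x) := by
  refine ⟨(F.fst.sub G.fst).congr (fun _ _ => rfl) (Eventually.of_forall fun t _ => ?_),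
    (F.snd.sub G.snd).congr (fun _ _ => rfl) (Eventually.of_forall fun t _ => ?_)⟩
  · ring
  · ring

theorem congrw (F : SLSys a b p q r s f fq w) (e : ∀ x, w x = v x) :
    SLSys a b p q r s f fq v := by
  have : w = v := funext e
  rwa [← this]

theorem eq_zero_local (hyp : SLHyp a b p q r s) {z : ℂ}
    (F : SLSys a b p q r s f fq (fun x => z * f x)) {x0 : ℝ} (hx0 : x0 ∈ Ioo a b)
    (h0 : f x0 = 0) (h0q : fq x0 = 0) : ∀ᶠ x in 𝓝 x0, f x = 0 ∧ fq x = 0 := by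
  set κ : ℝ → ℝ := fun t => |(p t)⁻¹| + 2 * |s t| + |q t| + ‖z‖ * |r t| with hκ
  have hκ0 : ∀ t, 0 ≤ κ t := fun t => by simp only [hκ]; positivity
  have hκi : ∀ x ∈ Ioo a b, ∀ y ∈ Ioo a b, IntervalIntegrable κ volume y x := by
    intro x hx y hy
    exact ((((hyp.ip x hx y hy).abs).add ((hyp.is' x hx y hy).abs.const_mul 2)).add
      (hyp.iq x hx y hy).abs).add ((hyp.ir x hx y hy).abs.const_mul ‖z‖)
  obtain ⟨u, hu1, hu2⟩ := exists_between hx0.1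
  obtain ⟨v, hv1, hv2⟩ := exists_between hx0.2
  have hu : u ∈ Ioo a b := ⟨hu1, hu2.trans hx0.2⟩
  have hv : v ∈ Ioo a b := ⟨hx0.1.trans hv1, hv2⟩
  have huv : u < v := hu2.trans hv1
  have hcont : ContinuousOn (fun x => ∫ t in x0..x, κ t) (Icc u v) := by
    have := intervalIntegral.continuousOn_primitive_interval' (hκi v hv u hu) (a := x0)
      (by rw [uIcc_of_le huv.le]; exact ⟨hu2.le, hv1.le⟩)
    rwa [uIcc_of_le huv.le] at this
  have hsmall : ∀ᶠ x in 𝓝 x0, |∫ t in x0..x, κ t| < 1 / 2 := by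
    have h1 := (hcont.continuousAt (Icc_mem_nhds hu2 hv1)).abs
    have h2 : ContinuousAt (fun x => |∫ t in x0..x, κ t|) x0 := h1
    refine h2.eventually (gt_mem_nhds ?_)
    simp
  obtain ⟨δ, hδ, hball⟩ := Metric.eventually_nhds_iff_ball.1
    (hsmall.and (isOpen_Ioo.mem_nhds hx0))
  have hJ : ∀ x ∈ Icc (x0 - δ / 2) (x0 + δ / 2), |∫ t in x0..x, κ t| < 1 / 2 ∧ x ∈ Ioo a b := by
    intro x hx
    apply hball
    rw [Metric.mem_ball, Real.dist_eq, abs_lt]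
    constructor <;> linarith [hx.1, hx.2]
  set J := Icc (x0 - δ / 2) (x0 + δ / 2) with hJd
  have hx0J : x0 ∈ J := ⟨by linarith, by linarith⟩
  have hJsub : J ⊆ Ioo a b := fun x hx => (hJ x hx).2
  have hNc : ContinuousOn (fun x => max ‖f x‖ ‖fq x‖) J := by
    have h1 : ContinuousOn f J := F.fst.continuousOn.mono hJsub
    have h2 : ContinuousOn fq J := F.snd.continuousOn.mono hJsub
    exact ContinuousOn.sup h1.norm h2.norm
  obtain ⟨m, hmJ, hm⟩ := isCompact_Icc.exists_isMaxOn ⟨x0, hx0J⟩ hNc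
  set M := max ‖f m‖ ‖fq m‖ with hM
  have hb : ∀ x ∈ J, ‖f x‖ ≤ M ∧ ‖fq x‖ ≤ M := by
    intro x hx
    have : max ‖f x‖ ‖fq x‖ ≤ M := hm hx
    exact max_le_iff.1 this
  have hM0 : 0 ≤ M := (norm_nonneg _).trans (le_max_left _ _)
  have key : ∀ (f' G : ℝ → ℂ), HasACDeriv a b f' G → f' x0 = 0 →
      (∀ t ∈ J, ‖G t‖ ≤ κ t * M) → ‖f' m‖ ≤ M * (1 / 2) := by
    intro f' G H hz hG
    have h1 := (H m (hJsub hmJ) x0 hx0).2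
    rw [hz, zero_add] at h1
    rw [h1]
    have hsub : uIoc x0 m ⊆ J := uIoc_subset_uIcc.trans (ordConnected_Icc.uIcc_subset hx0J hmJ)
    have h2 := intervalIntegral.norm_integral_le_abs_of_norm_le (μ := volume) (a := x0) (b := m) (f := G)
      (g := fun t => κ t * M) (by
        rw [ae_restrict_iff' measurableSet_uIoc]
        exact Eventually.of_forall fun t ht => hG t (hsub ht))
      ((hκi m (hJsub hmJ) x0 hx0).mul_const M)
    refine h2.trans ?_
    rw [intervalIntegral.integral_mul_const, abs_mul, abs_of_nonneg hM0, mul_comm]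
    gcongr
    exact (hJ m hmJ).1.le
  have k1 := key f _ F.fst h0 (fun t ht => by
    obtain ⟨b1, b2⟩ := hb t ht
    refine (norm_sub_le _ _).trans ?_
    rw [norm_div, norm_mul, Complex.norm_real, Complex.norm_real, Real.norm_eq_abs, Real.norm_eq_abs]
    have : ‖fq t‖ / |p t| ≤ M * |(p t)⁻¹| := by
      rw [abs_inv, div_eq_mul_inv]
      gcongr
    have : |s t| * ‖f t‖ ≤ |s t| * M := by gcongr
    have : 0 ≤ (|s t| + |q t| + ‖z‖ * |r t|) * M := by positivity
    simp only [hκ]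
    nlinarith)
  have k2 := key fq _ F.snd h0q (fun t ht => by
    obtain ⟨b1, b2⟩ := hb t ht
    refine (norm_sub_le _ _).trans ((add_le_add_left (norm_add_le _ _) _).trans ?_)
    rw [norm_mul, norm_mul, norm_mul, norm_mul, Complex.norm_real, Complex.norm_real,
      Complex.norm_real, Real.norm_eq_abs, Real.norm_eq_abs, Real.norm_eq_abs]
    have : |s t| * ‖fq t‖ ≤ |s t| * M := by gcongr
    have : |q t| * ‖f t‖ ≤ |q t| * M := by gcongr
    have : |r t| * (‖z‖ * ‖f t‖) ≤ |r t| * (‖z‖ * M) := by gcongr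
    have : 0 ≤ (|s t| + |(p t)⁻¹|) * M := by positivity
    simp only [hκ]
    nlinarith)
  have hM00 : M = 0 := by
    have : M ≤ M * (1 / 2) := max_le k1 k2
    linarith
  filter_upwards [Icc_mem_nhds (show x0 - δ / 2 < x0 by linarith) (show x0 < x0 + δ / 2 by linarith)]
    with x hx
  obtain ⟨b1, b2⟩ := hb x hx
  rw [hM00] at b1 b2
  exact ⟨norm_le_zero_iff.1 b1, norm_le_zero_iff.1 b2⟩

theorem eq_zero (hyp : SLHyp a b p q r s) {z : ℂ}
    (F : SLSys a b p q r s f fq (fun x => z * f x)) {x0 : ℝ} (hx0 : x0 ∈ Ioo a b)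
    (h0 : f x0 = 0) (h0q : fq x0 = 0) : ∀ x ∈ Ioo a b, f x = 0 ∧ fq x = 0 := by
  set Z : Set ℝ := {x | x ∈ Ioo a b ∧ f x = 0 ∧ fq x = 0} with hZ
  have hZo : IsOpen Z := by
    rw [isOpen_iff_mem_nhds]
    intro x hx
    filter_upwards [eq_zero_local hyp F hx.1 hx.2.1 hx.2.2, isOpen_Ioo.mem_nhds hx.1] with y h1 h2
    exact ⟨h2, h1⟩
  have hsub := isPreconnected_Ioo.subset_of_closure_inter_subset hZo ⟨x0, hx0, hx0, h0, h0q⟩ (by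
    rintro x ⟨hx1, hx2⟩
    have hfr : ∃ᶠ y in 𝓝 x, y ∈ Z := mem_closure_iff_frequently.1 hx1
    have c1 : ContinuousAt f x := F.fst.continuousOn.continuousAt (isOpen_Ioo.mem_nhds hx2)
    have c2 : ContinuousAt fq x := F.snd.continuousOn.continuousAt (isOpen_Ioo.mem_nhds hx2)
    refine ⟨hx2, ?_, ?_⟩
    · by_contra hne
      obtain ⟨y, hy, hy2⟩ := (hfr.and_eventually (c1.eventually_ne hne)).exists
      exact hy2 hy.2.1
    · by_contra hne
      obtain ⟨y, hy, hy2⟩ := (hfr.and_eventually (c2.eventually_ne hne)).exists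
      exact hy2 hy.2.2)
  exact fun x hx => (hsub hx).2

end SLSys


/-! ### Basic facts on the solution family -/

section family

variable {a b : ℝ} {p q r s : ℝ → ℝ} {φ φq : ℂ → ℝ → ℂ}

theorem rpos_sub (hyp : SLHyp a b p q r s) {c : ℝ} (hc : c ≤ b) :
    ∀ᵐ t ∂(volume.restrict (Ioo a c)), 0 < r t :=
  ae_restrict_of_ae_restrict_of_subset (Ioo_subset_Ioo_right hc) hyp.rpos

theorem phi_contOn (hφ : RealEntireSolFam a b p q r s φ φq) (z : ℂ) :
    ContinuousOn (φ z) (Ioo a b) := (hφ.sol z).fst.continuousOn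

theorem phi_aesm (hφ : RealEntireSolFam a b p q r s φ φq) (z : ℂ) {c : ℝ} (hc : c ≤ b) :
    AEStronglyMeasurable (φ z) (volume.restrict (Ioo a c)) :=
  ((phi_contOn hφ z).mono (Ioo_subset_Ioo_right hc)).aestronglyMeasurable measurableSet_Ioo

theorem phi_mul_int (hyp : SLHyp a b p q r s) (hφ : RealEntireSolFam a b p q r s φ φq) (z ζ : ℂ)
    {c : ℝ} (hc : c ∈ Ioo a b) : IntegrableOn (fun t => φ z t * φ ζ t * (r t : ℂ)) (Ioo a c) :=
  integrableOn_mul_mul hyp.mr (rpos_sub hyp hc.2.le) (phi_aesm hφ z hc.2.le) (phi_aesm hφ ζ hc.2.le)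
    (hφ.sqint z c hc) (hφ.sqint ζ c hc)

theorem wr_eq (hyp : SLHyp a b p q r s) (hφ : RealEntireSolFam a b p q r s φ φq) (z ζ : ℂ)
    {x : ℝ} (hx : x ∈ Ioo a b) : Wr (φ z) (φq z) (φ ζ) (φq ζ) x =
      (z - ζ) * ∫ t in Ioo a x, φ z t * φ ζ t * (r t : ℂ) := by
  have H := (hφ.sol z).wr (hφ.sol ζ)
  have h1 := (tendsto_left_integral hx.1 (phi_mul_int hyp hφ z ζ hx)).const_mul (z - ζ)
  have h2 := (hφ.bc z ζ).add h1
  rw [zero_add] at h2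
  refine tendsto_nhds_unique (Tendsto.congr' ?_ tendsto_const_nhds) h2
  have : Ioo a x ∈ 𝓝[>] a := Ioo_mem_nhdsGT hx.1
  filter_upwards [this] with y hy
  rw [(H x hx y ⟨hy.1, hy.2.trans hx.2⟩).2, ← intervalIntegral.integral_const_mul]
  congr 2
  funext t
  ring

theorem not_both (hyp : SLHyp a b p q r s) (hφ : RealEntireSolFam a b p q r s φ φq) (z : ℂ)
    {x : ℝ} (hx : x ∈ Ioo a b) (h1 : φ z x = 0) (h2 : φq z x = 0) : False := by
  obtain ⟨y, hy, h⟩ := hφ.nontriv z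
  have := (hφ.sol z).eq_zero hyp hx h1 h2 y hy
  tauto

theorem K_pos (hyp : SLHyp a b p q r s) (hφ : RealEntireSolFam a b p q r s φ φq) (z : ℂ)
    {x : ℝ} (hx : x ∈ Ioo a b) : 0 < ∫ t in Ioo a x, ‖φ z t‖ ^ 2 * r t := by
  have hr := rpos_sub hyp hx.2.le
  have h0 : 0 ≤ᵐ[volume.restrict (Ioo a x)] fun t => ‖φ z t‖ ^ 2 * r t := by
    filter_upwards [hr] with t ht
    simp only [Pi.zero_apply]
    positivity
  refine lt_of_le_of_ne (integral_nonneg_of_ae h0) fun hzero => ?_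
  have h1 := (integral_eq_zero_iff_of_nonneg_ae h0 (hφ.sqint z x hx)).1 hzero.symm
  have h2 : φ z =ᵐ[volume.restrict (Ioo a x)] fun _ => 0 := by
    filter_upwards [hr, h1] with t ht ht1
    simp only [Pi.zero_apply, mul_eq_zero, ht.ne', or_false] at ht1
    simpa using ht1
  have hsub : Ioo a x ⊆ Ioo a b := Ioo_subset_Ioo_right hx.2.le
  have h3 : EqOn (φ z) (fun _ => 0) (Ioo a x) :=
    Measure.eqOn_open_of_ae_eq h2 isOpen_Ioo ((phi_contOn hφ z).mono hsub) continuousOn_const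
  obtain ⟨u, hu1, hu2⟩ := exists_between hx.1
  obtain ⟨v, hv1, hv2⟩ := exists_between hu2
  have hu : u ∈ Ioo a b := ⟨hu1, hu2.trans hx.2⟩
  have hv : v ∈ Ioo a b := ⟨hu1.trans hv1, hv2.trans hx.2⟩
  have hp : ∀ᵐ t, t ∈ Ioo a b → p t ≠ 0 := (ae_restrict_iff' measurableSet_Ioo).1 hyp.pne
  have h4 : ∀ᵐ t, t ∈ Ioo u v → φq z t = 0 := by
    filter_upwards [hp, (hφ.sol z).fst.ae hu hv] with t ht1 ht2 ht
    have htx : t ∈ Ioo a x := ⟨hu1.trans ht.1, ht.2.trans hv2⟩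
    have d1 := ht2 (by rw [uIcc_of_le hv1.le]; exact Ioo_subset_Icc_self ht)
    have d2 : HasDerivAt (φ z) 0 t := by
      refine (hasDerivAt_const t (0 : ℂ)).congr_of_eventuallyEq ?_
      filter_upwards [isOpen_Ioo.mem_nhds htx] with y hy
      exact h3 hy
    have d3 := d1.unique d2
    have e : φ z t = 0 := h3 htx
    rw [e, mul_zero, sub_zero, div_eq_zero_iff] at d3
    rcases d3 with d3 | d3
    · exact d3
    · exact absurd (by exact_mod_cast d3) (ht1 (hsub htx))
  have h5 : ∃ t ∈ Ioo u v, φq z t = 0 := by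
    by_contra hcon
    push Not at hcon
    have : ∀ᵐ t : ℝ, t ∉ Ioo u v := by
      filter_upwards [h4] with t ht htm
      exact hcon t htm (ht htm)
    have h6 : volume (Ioo u v) = 0 := by
      rw [measure_eq_zero_iff_ae_notMem]
      exact this
    rw [Real.volume_Ioo] at h6
    simp at h6
    linarith
  obtain ⟨t, ht, ht0⟩ := h5
  have htx : t ∈ Ioo a x := ⟨hu1.trans ht.1, ht.2.trans hv2⟩
  exact not_both hyp hφ z (hsub htx) (h3 htx) ht0

theorem wr_conj (hyp : SLHyp a b p q r s) (hφ : RealEntireSolFam a b p q r s φ φq) (z : ℂ)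
    {x : ℝ} (hx : x ∈ Ioo a b) : φ z x * conj (φq z x) - φq z x * conj (φ z x) =
      2 * z.im * I * ((∫ t in Ioo a x, ‖φ z t‖ ^ 2 * r t : ℝ) : ℂ) := by
  have h := wr_eq hyp hφ z (conj z) hx
  simp only [Wr, (hφ.real z x hx).1, (hφ.real z x hx).2] at h
  rw [h, Complex.sub_conj, ← integral_complex_ofReal]
  push_cast
  congr 1
  refine setIntegral_congr_fun measurableSet_Ioo fun t ht => ?_
  have ht' : t ∈ Ioo a b := ⟨ht.1, ht.2.trans hx.2⟩
  simp only [(hφ.real z t ht').1, Complex.mul_conj, Complex.normSq_eq_norm_sq]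
  push_cast
  ring

theorem phi_ne (hyp : SLHyp a b p q r s) (hφ : RealEntireSolFam a b p q r s φ φq) {z : ℂ}
    (hz : z.im ≠ 0) {x : ℝ} (hx : x ∈ Ioo a b) : φ z x ≠ 0 := by
  intro h
  have h1 := wr_conj hyp hφ z hx
  rw [h] at h1
  have h2 := (K_pos hyp hφ z hx).ne'
  simp only [map_zero, zero_mul, mul_zero, sub_zero] at h1
  have := h1.symm
  simp only [mul_eq_zero, ofReal_eq_zero, I_ne_zero, hz, h2, OfNat.ofNat_ne_zero, or_false] at this

theorem dBE_sharp (hφ : RealEntireSolFam a b p q r s φ φq) {c : ℝ} (hc : c ∈ Ioo a b) (z : ℂ) :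
    conj (dBE φ φq c (conj z)) = φ z c - I * φq z c := by
  simp only [dBE, (hφ.real z c hc).1, (hφ.real z c hc).2, map_add, map_mul, conj_conj, conj_I]
  ring

theorem dBE_normSq (hyp : SLHyp a b p q r s) (hφ : RealEntireSolFam a b p q r s φ φq) {c : ℝ}
    (hc : c ∈ Ioo a b) (z : ℂ) : ‖dBE φ φq c z‖ ^ 2 - ‖conj (dBE φ φq c (conj z))‖ ^ 2 =
      4 * z.im * ∫ t in Ioo a c, ‖φ z t‖ ^ 2 * r t := by
  rw [dBE_sharp hφ hc, dBE, ← Complex.normSq_eq_norm_sq, ← Complex.normSq_eq_norm_sq,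
    normSq_apply, normSq_apply]
  have h := congrArg Complex.im (wr_conj hyp hφ z hc)
  rw [show 2 * z.im * I * ((∫ t in Ioo a c, ‖φ z t‖ ^ 2 * r t : ℝ) : ℂ)
    = ((2 * z.im * ∫ t in Ioo a c, ‖φ z t‖ ^ 2 * r t : ℝ) : ℂ) * I by push_cast; ring] at h
  simp only [Complex.sub_im, Complex.mul_im, conj_re, conj_im, Complex.ofReal_re, Complex.I_im,
    Complex.I_re, Complex.ofReal_im, mul_one, zero_mul, mul_zero, add_zero] at h
  simp only [Complex.add_re, Complex.add_im, Complex.sub_re, Complex.sub_im, Complex.mul_re,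
    Complex.mul_im, Complex.I_im, Complex.I_re, zero_mul, one_mul, zero_sub, zero_add, add_zero]
  linarith

theorem dBE_ne (hyp : SLHyp a b p q r s) (hφ : RealEntireSolFam a b p q r s φ φq) {c : ℝ}
    (hc : c ∈ Ioo a b) {z : ℂ} (hz : 0 ≤ z.im) : dBE φ φq c z ≠ 0 := by
  intro h0
  rcases hz.eq_or_lt with h | h
  · have hzc : conj z = z := Complex.conj_eq_iff_im.2 h.symm
    have h1 := dBE_sharp hφ hc z
    rw [hzc, h0, map_zero] at h1
    simp only [dBE] at h0
    have e1 : φ z c = 0 := by linear_combination (h0 - h1) / 2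
    have e2 : φq z c = 0 := by
      have : I * φq z c = 0 := by linear_combination (h0 + h1) / 2
      simpa using this
    exact not_both hyp hφ z hc e1 e2
  · have h1 := dBE_normSq hyp hφ hc z
    rw [h0] at h1
    have := mul_pos h (K_pos hyp hφ z hc)
    have := sq_nonneg ‖conj (dBE φ φq c (conj z))‖
    simp only [norm_zero] at h1
    nlinarith

theorem dBE_sharp_le (hyp : SLHyp a b p q r s) (hφ : RealEntireSolFam a b p q r s φ φq) {c : ℝ}
    (hc : c ∈ Ioo a b) {z : ℂ} (hz : 0 ≤ z.im) :
    ‖conj (dBE φ φq c (conj z))‖ ≤ ‖dBE φ φq c z‖ := by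
  have h1 := dBE_normSq hyp hφ hc z
  have h2 := mul_nonneg hz (K_pos hyp hφ z hc).le
  exact (sq_le_sq₀ (norm_nonneg _) (norm_nonneg _)).1 (by linarith)

theorem dBE_diff (hφ : RealEntireSolFam a b p q r s φ φq) {c : ℝ}
    (hc : c ∈ Ioo a b) : Differentiable ℂ (dBE φ φq c) :=
  (hφ.entire c hc).1.add ((hφ.entire c hc).2.const_mul I)

theorem dBE_sharp_diff (hφ : RealEntireSolFam a b p q r s φ φq) {c : ℝ}
    (hc : c ∈ Ioo a b) : Differentiable ℂ (fun z => conj (dBE φ φq c (conj z))) := by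
  rw [funext (dBE_sharp hφ hc)]
  exact (hφ.entire c hc).1.sub ((hφ.entire c hc).2.const_mul I)

/-- The kernel identity. -/
theorem dBK_eq (hyp : SLHyp a b p q r s) (hφ : RealEntireSolFam a b p q r s φ φq) {c : ℝ}
    (hc : c ∈ Ioo a b) (w z : ℂ) : (z - conj w) * dBK a c r φ w z = I / 2 *
      (dBE φ φq c z * conj (dBE φ φq c w) - conj (dBE φ φq c (conj z)) * dBE φ φq c (conj w)) := by
  have h := wr_eq hyp hφ z (conj w) hc
  have e : dBK a c r φ w z = ∫ t in Ioo a c, φ z t * φ (conj w) t * (r t : ℂ) := by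
    refine setIntegral_congr_fun measurableSet_Ioo fun t ht => ?_
    simp only [(hφ.real w t ⟨ht.1, ht.2.trans hc.2⟩).1]
  rw [e, ← h, dBE_sharp hφ hc]
  simp only [dBE, Wr, (hφ.real w c hc).1, (hφ.real w c hc).2, map_add, map_mul, conj_I]
  ring_nf
  simp only [I_sq]
  ring

end family


/-! ### Inhomogeneous solutions -/

/-- Local integrability of `h r`. -/
def LocI (a b : ℝ) (r : ℝ → ℝ) (h : ℝ → ℂ) : Prop :=
  ∀ x ∈ Ioo a b, ∀ y ∈ Ioo a b, IntervalIntegrable (fun t => h t * (r t : ℂ)) volume y x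

def omg (r : ℝ → ℝ) (c : ℝ) (f g : ℝ → ℂ) (y : ℝ) : ℂ := -∫ t in y..c, f t * g t * (r t : ℂ)

def isol (p r : ℝ → ℝ) (c : ℝ) (f g : ℝ → ℂ) (κ : ℂ) (x : ℝ) : ℂ :=
  ∫ t in x..c, (omg r c f g t - κ) / ((p t : ℂ) * f t ^ 2)

def usol (p r : ℝ → ℝ) (c : ℝ) (f g : ℝ → ℂ) (κ : ℂ) (x : ℝ) : ℂ :=
  f x * isol p r c f g κ x

def uqsol (p r : ℝ → ℝ) (c : ℝ) (f fq g : ℝ → ℂ) (κ : ℂ) (x : ℝ) : ℂ :=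
  fq x * isol p r c f g κ x - (omg r c f g x - κ) * (f x)⁻¹

section inhom

variable {a b : ℝ} {p q r s : ℝ → ℝ} {f fq g h : ℝ → ℂ} {c : ℝ} {z : ℂ}

theorem intervalIntegrable_coe {k : ℝ → ℝ} {x y : ℝ} (hk : IntervalIntegrable k volume y x) :
    IntervalIntegrable (fun t => (k t : ℂ)) volume y x :=
  ⟨hk.1.ofReal, hk.2.ofReal⟩

theorem LocI.of_cont (hyp : SLHyp a b p q r s) (hh : ContinuousOn h (Ioo a b)) : LocI a b r h := by
  intro x hx y hy
  exact (intervalIntegrable_coe (hyp.ir x hx y hy)).continuousOn_mul (hh.mono (HasACDeriv.uIcc_sub hy hx))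

theorem LocI.add (hg : LocI a b r g) (hh : LocI a b r h) : LocI a b r (fun t => g t + h t) := by
  intro x hx y hy
  simpa only [add_mul] using (hg x hx y hy).add (hh x hx y hy)

theorem LocI.const_mul (hg : LocI a b r g) (k : ℂ) : LocI a b r (fun t => k * g t) := by
  intro x hx y hy
  simpa only [mul_assoc] using (hg x hx y hy).const_mul k

theorem LocI.mul_cont (hg : LocI a b r g) (hf : ContinuousOn f (Ioo a b)) :
    ∀ x ∈ Ioo a b, ∀ y ∈ Ioo a b,
      IntervalIntegrable (fun t => f t * g t * (r t : ℂ)) volume y x := by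
  intro x hx y hy
  simpa only [mul_assoc] using (hg x hx y hy).continuousOn_mul (hf.mono (HasACDeriv.uIcc_sub hy hx))

theorem omg_ac (hf : ContinuousOn f (Ioo a b)) (hc : c ∈ Ioo a b) (hg : LocI a b r g) :
    HasACDeriv a b (omg r c f g) (fun t => f t * g t * (r t : ℂ)) := by
  refine ((HasACDeriv.primitive' (hg.mul_cont hf) hc).const_mul (-1)).congr ?_ ?_
  · intro t _
    simp [omg]
  · exact Eventually.of_forall fun t _ => by simp

theorem pinv_int (hyp : SLHyp a b p q r s) (hf : ContinuousOn f (Ioo a b))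
    (h0 : ∀ t ∈ Ioo a b, f t ≠ 0) (hh : ContinuousOn h (Ioo a b)) :
    ∀ x ∈ Ioo a b, ∀ y ∈ Ioo a b,
      IntervalIntegrable (fun t => h t / ((p t : ℂ) * f t ^ 2)) volume y x := by
  intro x hx y hy
  have hs := HasACDeriv.uIcc_sub hy hx
  have h1 : ContinuousOn (fun t => h t * (f t ^ 2)⁻¹) (uIcc y x) :=
    ((hh.mul ((hf.pow 2).inv₀ fun t ht => pow_ne_zero 2 (h0 t ht)))).mono hs
  have h2 := (intervalIntegrable_coe (hyp.ip x hx y hy)).continuousOn_mul h1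
  refine h2.congr fun t _ => ?_
  simp only [Complex.ofReal_inv, div_eq_mul_inv, mul_inv]
  ring

theorem isol_ac (hyp : SLHyp a b p q r s) (hf : ContinuousOn f (Ioo a b))
    (h0 : ∀ t ∈ Ioo a b, f t ≠ 0) (hc : c ∈ Ioo a b) (hg : LocI a b r g) (κ : ℂ) :
    HasACDeriv a b (isol p r c f g κ)
      (fun t => - ((omg r c f g t - κ) / ((p t : ℂ) * f t ^ 2))) :=
  HasACDeriv.primitive' (pinv_int hyp hf h0
    ((omg_ac hf hc hg).continuousOn.sub continuousOn_const)) hc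

theorem usol_sys (hyp : SLHyp a b p q r s) (F : SLSys a b p q r s f fq (fun x => z * f x))
    (h0 : ∀ t ∈ Ioo a b, f t ≠ 0) (hc : c ∈ Ioo a b) (hg : LocI a b r g) (κ : ℂ) :
    SLSys a b p q r s (usol p r c f g κ) (uqsol p r c f fq g κ)
      (fun x => z * usol p r c f g κ x + g x) := by
  have hf := F.fst.continuousOn
  have hI := isol_ac hyp hf h0 hc hg κ
  have hω := omg_ac hf hc hg
  have hκ : HasACDeriv a b (fun _ => κ) (fun _ => 0) := fun x _ y _ => ⟨by simp, by simp⟩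
  have hp : ∀ᵐ t, t ∈ Ioo a b → p t ≠ 0 := (ae_restrict_iff' measurableSet_Ioo).1 hyp.pne
  constructor
  · refine (F.fst.mul hI).congr (fun _ _ => rfl) ?_
    filter_upwards [hp] with t ht1 ht
    have e1 : (p t : ℂ) ≠ 0 := by exact_mod_cast ht1 ht
    have e2 := h0 t ht
    simp only [usol, uqsol]
    field_simp
    ring
  · refine ((F.snd.mul hI).sub ((hω.sub hκ).mul (F.fst.inv h0))).congr (fun _ _ => rfl) ?_
    filter_upwards [hp] with t ht1 ht
    have e1 : (p t : ℂ) ≠ 0 := by exact_mod_cast ht1 ht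
    have e2 := h0 t ht
    simp only [usol, uqsol]
    field_simp
    ring

theorem isol_c (κ : ℂ) : isol p r c f g κ c = 0 := by simp [isol]
theorem usol_c (κ : ℂ) : usol p r c f g κ c = 0 := by simp [usol, isol_c]
theorem uqsol_c (κ : ℂ) : uqsol p r c f fq g κ c = κ * (f c)⁻¹ := by
  simp [uqsol, isol_c, omg]

theorem SLSys.add {f fq w h hq v : ℝ → ℂ} (F : SLSys a b p q r s f fq w)
    (G : SLSys a b p q r s h hq v) :
    SLSys a b p q r s (fun x => f x + h x) (fun x => fq x + hq x) (fun x => w x + v x) := by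
  refine ⟨(F.fst.add G.fst).congr (fun _ _ => rfl) (Eventually.of_forall fun t _ => ?_),
    (F.snd.add G.snd).congr (fun _ _ => rfl) (Eventually.of_forall fun t _ => ?_)⟩
  · ring
  · ring

theorem SLSys.const_mul {f fq w : ℝ → ℂ} (F : SLSys a b p q r s f fq w) (k : ℂ) :
    SLSys a b p q r s (fun x => k * f x) (fun x => k * fq x) (fun x => k * w x) := by
  refine ⟨(F.fst.const_mul k).congr (fun _ _ => rfl) (Eventually.of_forall fun t _ => ?_),
    (F.snd.const_mul k).congr (fun _ _ => rfl) (Eventually.of_forall fun t _ => ?_)⟩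
  · ring
  · ring

/-- Solutions with zero data at `c` are unique. -/
theorem usol_unique (hyp : SLHyp a b p q r s) (F : SLSys a b p q r s f fq (fun x => z * f x))
    (h0 : ∀ t ∈ Ioo a b, f t ≠ 0) (hc : c ∈ Ioo a b) (hg : LocI a b r g) {u uq : ℝ → ℂ}
    (U : SLSys a b p q r s u uq (fun x => z * u x + g x)) (hu : u c = 0) (huq : uq c = 0) :
    ∀ x ∈ Ioo a b, u x = usol p r c f g 0 x := by
  intro x hx
  have D := (U.sub (usol_sys hyp F h0 hc hg 0)).congrw
    (v := fun x => z * (u x - usol p r c f g 0 x)) (fun x => by ring)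
  have := D.eq_zero hyp hc (by rw [hu, usol_c, sub_zero]) (by rw [huq, uqsol_c]; simp) x hx
  exact sub_eq_zero.1 this.1

theorem usol_lin (hyp : SLHyp a b p q r s) (F : SLSys a b p q r s f fq (fun x => z * f x))
    (h0 : ∀ t ∈ Ioo a b, f t ≠ 0) (hc : c ∈ Ioo a b) (hg : LocI a b r g) (hh : LocI a b r h) (k : ℂ) :
    ∀ x ∈ Ioo a b, usol p r c f (fun t => g t + k * h t) 0 x =
      usol p r c f g 0 x + k * usol p r c f h 0 x := by
  intro x hx
  symm
  have U := ((usol_sys hyp F h0 hc hg 0).add ((usol_sys hyp F h0 hc hh 0).const_mul k)).congrw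
    (v := fun x => z * (usol p r c f g 0 x + k * usol p r c f h 0 x) + (g x + k * h x))
    (fun x => by ring)
  refine usol_unique hyp F h0 hc (hg.add (hh.const_mul k)) U ?_ ?_ x hx
  · simp [usol_c]
  · simp [uqsol_c]

theorem usol_congr (hc : c ∈ Ioo a b) (e : ∀ t ∈ Ioo a b, g t = h t) (κ : ℂ) :
    ∀ x ∈ Ioo a b, usol p r c f g κ x = usol p r c f h κ x := by
  intro x hx
  simp only [usol, isol]
  congr 1
  refine intervalIntegral.integral_congr fun t ht => ?_
  have ht' := HasACDeriv.uIcc_sub hx hc ht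
  simp only [omg]
  congr 3
  refine intervalIntegral.integral_congr fun y hy => ?_
  simp only [e y (HasACDeriv.uIcc_sub ht' hc hy)]

/-- Bound for the Volterra operator. -/
theorem usol_bound (hyp : SLHyp a b p q r s) (hf : ContinuousOn f (Ioo a b))
    (h0 : ∀ t ∈ Ioo a b, f t ≠ 0) (hc : c ∈ Ioo a b) {x1 : ℝ} (hx1 : x1 ∈ Ioo a c) :
    ∃ B : ℝ, 0 ≤ B ∧ ∀ g, LocI a b r g → ∀ x ∈ Icc x1 c,
      ‖usol p r c f g 0 x‖ ≤ B * ∫ t in x..c, ‖g t‖ * |r t| := by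
  have hx1' : x1 ∈ Ioo a b := ⟨hx1.1, hx1.2.trans hc.2⟩
  have hsub : Icc x1 c ⊆ Ioo a b := ordConnected_Ioo.out hx1' hc
  obtain ⟨A, hA⟩ := isCompact_Icc.exists_bound_of_continuousOn (hf.mono hsub)
  have hA0 : 0 ≤ A := (norm_nonneg _).trans (hA c ⟨hx1.2.le, le_rfl⟩)
  have hP := pinv_int hyp hf h0 (h := fun _ => 1) continuousOn_const
  set P : ℝ → ℂ := fun t => 1 / ((p t : ℂ) * f t ^ 2) with hPd
  set D := ∫ t in x1..c, ‖P t‖ with hD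
  have hD0 : 0 ≤ D := intervalIntegral.integral_nonneg hx1.2.le fun t _ => norm_nonneg _
  refine ⟨A * (A * D), by positivity, fun g hg x hx => ?_⟩
  set G : ℝ → ℝ := fun y => ∫ t in y..c, ‖g t‖ * |r t| with hG
  have hgi : ∀ x ∈ Ioo a b, ∀ y ∈ Ioo a b,
      IntervalIntegrable (fun t => ‖g t‖ * |r t|) volume y x := by
    intro x hx y hy
    simpa [norm_mul] using (hg x hx y hy).norm
  have hGn : 0 ≤ G x := intervalIntegral.integral_nonneg hx.2 fun t _ => by positivity
  have hω : ∀ t ∈ Icc x c, ‖omg r c f g t‖ ≤ A * G x := by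
    intro t ht
    have htI : t ∈ Icc x1 c := ⟨hx.1.trans ht.1, ht.2⟩
    rw [omg, norm_neg]
    calc ‖∫ y in t..c, f y * g y * (r y : ℂ)‖ ≤ ∫ y in t..c, A * (‖g y‖ * |r y|) := by
          refine intervalIntegral.norm_integral_le_of_norm_le ht.2 ?_ ?_
          · refine Eventually.of_forall fun y hy => ?_
            rw [norm_mul, norm_mul, Complex.norm_real, Real.norm_eq_abs, mul_assoc]
            gcongr
            exact hA y ⟨htI.1.trans hy.1.le, hy.2⟩
          · exact (hgi c hc t (hsub htI)).const_mul A
      _ = A * ∫ y in t..c, (‖g y‖ * |r y|) := intervalIntegral.integral_const_mul _ _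
      _ ≤ A * G x := by
          gcongr
          simp only [hG]
          rw [← intervalIntegral.integral_add_adjacent_intervals (hgi t (hsub htI) x (hsub hx))
            (hgi c hc t (hsub htI))]
          have : 0 ≤ ∫ y in x..t, ‖g y‖ * |r y| :=
            intervalIntegral.integral_nonneg ht.1 fun t _ => by positivity
          linarith
  have hI : ‖isol p r c f g 0 x‖ ≤ A * G x * D := by
    calc ‖isol p r c f g 0 x‖ ≤ ∫ t in x..c, A * G x * ‖P t‖ := by
          refine intervalIntegral.norm_integral_le_of_norm_le hx.2 ?_ ?_
          · refine Eventually.of_forall fun y hy => ?_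
            rw [sub_zero, div_eq_mul_one_div, norm_mul]
            gcongr
            exact hω y ⟨hy.1.le, hy.2⟩
          · exact ((hP c hc x (hsub hx)).norm).const_mul _
      _ = A * G x * ∫ t in x..c, ‖P t‖ := intervalIntegral.integral_const_mul _ _
      _ ≤ A * G x * D := by
          gcongr
          rw [hD, ← intervalIntegral.integral_add_adjacent_intervals (hP x (hsub hx) x1 hx1').norm
            (hP c hc x (hsub hx)).norm]
          have : 0 ≤ ∫ y in x1..x, ‖P y‖ :=
            intervalIntegral.integral_nonneg hx.1 fun t _ => norm_nonneg _
          linarith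
  rw [usol, norm_mul]
  calc ‖f x‖ * ‖isol p r c f g 0 x‖ ≤ A * (A * G x * D) := by
        gcongr
        exact hA x hx
    _ = A * (A * D) * G x := by ring

/-- If `f` vanishes on an interval then so does `τ f`. -/
theorem SLSys.w_zero {w : ℝ → ℂ} (hyp : SLHyp a b p q r s) (F : SLSys a b p q r s f fq w) {u v : ℝ}
    (hu : u ∈ Ioo a b) (hv : v ∈ Ioo a b) (huv : u < v) (h0 : ∀ t ∈ Ioo u v, f t = 0) :
    ∀ᵐ t, t ∈ Ioo u v → w t = 0 := by
  have hsub : Ioo u v ⊆ Ioo a b := Ioo_subset_Ioo hu.1.le hv.2.le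
  have gen : ∀ {k l : ℝ → ℂ}, HasACDeriv a b k l → (∀ t ∈ Ioo u v, k t = 0) →
      ∀ᵐ t, t ∈ Ioo u v → l t = 0 := by
    intro k l H hk
    filter_upwards [H.ae hu hv] with t ht htm
    have d1 := ht (by rw [uIcc_of_le huv.le]; exact Ioo_subset_Icc_self htm)
    have d2 : HasDerivAt k 0 t := by
      refine (hasDerivAt_const t (0 : ℂ)).congr_of_eventuallyEq ?_
      filter_upwards [isOpen_Ioo.mem_nhds htm] with y hy
      exact hk y hy
    exact d1.unique d2
  have hp : ∀ᵐ t, t ∈ Ioo a b → p t ≠ 0 := (ae_restrict_iff' measurableSet_Ioo).1 hyp.pne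
  have hr : ∀ᵐ t, t ∈ Ioo a b → 0 < r t := (ae_restrict_iff' measurableSet_Ioo).1 hyp.rpos
  have h1 : fq =ᵐ[volume.restrict (Ioo u v)] fun _ => 0 := by
    rw [EventuallyEq, ae_restrict_iff' measurableSet_Ioo]
    filter_upwards [hp, gen F.fst h0] with t t1 t2 ht
    have := t2 ht
    rw [h0 t ht, mul_zero, sub_zero, div_eq_zero_iff] at this
    rcases this with d3 | d3
    · exact d3
    · exact absurd (by exact_mod_cast d3) (t1 (hsub ht))
  have h2 : EqOn fq (fun _ => 0) (Ioo u v) :=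
    Measure.eqOn_open_of_ae_eq h1 isOpen_Ioo (F.snd.continuousOn.mono hsub) continuousOn_const
  filter_upwards [hr, gen F.snd (fun t ht => h2 ht)] with t t1 t2 ht
  have := t2 ht
  rw [h0 t ht, h2 ht] at this
  simp only [mul_zero, add_zero, zero_sub, neg_eq_zero, mul_eq_zero, ofReal_eq_zero,
    (t1 (hsub ht)).ne', false_or] at this
  exact this

end inhom


/-! ### The energy estimate -/

section energy

variable {a b : ℝ} {p q r s : ℝ → ℝ} {φ φq : ℂ → ℝ → ℂ}

theorem LocI.of_sq (hyp : SLHyp a b p q r s) {g : ℝ → ℂ} (hgm : AEStronglyMeasurable g volume)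
    (hg2 : IntegrableOn (fun t => ‖g t‖ ^ 2 * r t) (Ioo a b)) : LocI a b r g := by
  intro x hx y hy
  have hs : uIoc y x ⊆ Ioo a b := uIoc_subset_uIcc.trans (HasACDeriv.uIcc_sub hy hx)
  rw [intervalIntegrable_iff]
  have h1 : IntegrableOn (fun t => ‖g t‖ ^ 2 * r t) (uIoc y x) := hg2.mono_set hs
  have h2 : IntegrableOn r (uIoc y x) := intervalIntegrable_iff.1 (hyp.ir x hx y hy)
  refine Integrable.mono' (h1.add h2) (hgm.restrict.mul
    (Complex.measurable_ofReal.comp hyp.mr).aestronglyMeasurable) ?_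
  have hr := ae_restrict_of_ae_restrict_of_subset hs hyp.rpos
  filter_upwards [hr] with t ht
  rw [norm_mul, Complex.norm_real, Real.norm_eq_abs, abs_of_pos ht, Pi.add_apply]
  nlinarith [sq_nonneg (‖g t‖ - 1), sq_nonneg (‖g t‖)]

theorem energy (hyp : SLHyp a b p q r s) (hφ : RealEntireSolFam a b p q r s φ φq) {z : ℂ}
    (hz : z.im ≠ 0) {c : ℝ} (hc : c ∈ Ioo a b) {g : ℝ → ℂ} (hgm : AEStronglyMeasurable g volume)
    (hg2 : IntegrableOn (fun t => ‖g t‖ ^ 2 * r t) (Ioo a b)) {x0 : ℝ} (hx0 : x0 ∈ Ioo a c) :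
    ∫ t in x0..c, ‖usol p r c (φ z) g (omg r c (φ z) g x0) t‖ ^ 2 * |r t| ≤
      (∫ t in Ioo a b, ‖g t‖ ^ 2 * r t) / z.im ^ 2 := by
  have hg := LocI.of_sq hyp hgm hg2
  have hx0' : x0 ∈ Ioo a b := ⟨hx0.1, hx0.2.trans hc.2⟩
  have hne : ∀ t ∈ Ioo a b, φ z t ≠ 0 := fun t ht => phi_ne hyp hφ hz ht
  set κ := omg r c (φ z) g x0 with hκ
  have U := usol_sys hyp (hφ.sol z) hne hc hg κ
  set u := usol p r c (φ z) g κ with hu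
  set uq := uqsol p r c (φ z) (φq z) g κ with huq
  set J := isol p r c (φ z) g κ x0 with hJ
  have H := (U.wr U.conj') c hc x0 hx0'
  obtain ⟨Hi, He⟩ := H
  have hWc : Wr u uq (fun x => conj (u x)) (fun x => conj (uq x)) c = 0 := by
    have : u c = 0 := usol_c κ
    simp [Wr, this]
  have hu0 : u x0 = φ z x0 * J := rfl
  have huq0 : uq x0 = φq z x0 * J := by
    simp only [huq, uqsol, hκ, sub_self, zero_mul, sub_zero]
    rw [← hJ]
  set K := ∫ t in Ioo a x0, ‖φ z t‖ ^ 2 * r t with hK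
  have hKp : 0 < K := K_pos hyp hφ z hx0'
  have hW0 : Wr u uq (fun x => conj (u x)) (fun x => conj (uq x)) x0 =
      ((2 * z.im * (‖J‖ ^ 2 * K) : ℝ) : ℂ) * I := by
    have h1 := wr_conj hyp hφ z hx0'
    have h2 := Complex.mul_conj J
    rw [Complex.normSq_eq_norm_sq] at h2
    simp only [Wr, hu0, huq0, map_mul]
    rw [show φ z x0 * J * (conj (φq z x0) * conj J) - φq z x0 * J * (conj (φ z x0) * conj J)
      = (J * conj J) * (φ z x0 * conj (φq z x0) - φq z x0 * conj (φ z x0)) by ring, h1, h2]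
    push_cast
    ring
  rw [hWc, hW0] at He
  have hsub : uIoc x0 c ⊆ Ioo a b := uIoc_subset_uIcc.trans (HasACDeriv.uIcc_sub hx0' hc)
  have hr : ∀ᵐ t, t ∈ Ioo a b → 0 < r t := (ae_restrict_iff' measurableSet_Ioo).1 hyp.rpos
  set A := ∫ t in x0..c, ‖u t‖ ^ 2 * |r t| with hA
  have huc : ContinuousOn u (Ioo a b) := U.fst.continuousOn
  have hAi : IntervalIntegrable (fun t => ‖u t‖ ^ 2 * |r t|) volume x0 c :=
    (hyp.ir c hc x0 hx0').abs.continuousOn_mul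
      ((huc.mono (HasACDeriv.uIcc_sub hx0' hc)).norm.pow 2)
  have hAi' : IntervalIntegrable (fun t => ‖u t‖ ^ 2 * r t) volume x0 c :=
    (hyp.ir c hc x0 hx0').continuousOn_mul
      ((huc.mono (HasACDeriv.uIcc_sub hx0' hc)).norm.pow 2)
  have hAA : ∫ t in x0..c, ‖u t‖ ^ 2 * r t = A := by
    refine intervalIntegral.integral_congr_ae ?_
    filter_upwards [hr] with t ht htm
    rw [abs_of_pos (ht (hsub htm))]
  have hGi0 : IntegrableOn (fun t => ‖g t‖ ^ 2 * r t) (Ioc x0 c) := by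
    rw [uIoc_of_le hx0.2.le] at hsub
    exact hg2.mono_set hsub
  have hGi : IntervalIntegrable (fun t => ‖g t‖ ^ 2 * r t) volume x0 c := by
    rw [intervalIntegrable_iff, uIoc_of_le hx0.2.le]
    exact hGi0
  set G := ∫ t in Ioo a b, ‖g t‖ ^ 2 * r t with hG
  have hGle : ∫ t in x0..c, ‖g t‖ ^ 2 * r t ≤ G := by
    rw [intervalIntegral.integral_of_le hx0.2.le]
    refine setIntegral_mono_set hg2 ?_ (HasSubset.Subset.eventuallyLE ?_)
    · filter_upwards [hyp.rpos] with t ht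
      simp only [Pi.zero_apply]
      positivity
    · rwa [uIoc_of_le hx0.2.le] at hsub
  -- imaginary part of the energy identity
  have Him := congrArg Complex.im He
  have hL := Complex.imCLM.intervalIntegral_comp_comm Hi
  simp only [Complex.imCLM_apply] at hL
  rw [Complex.add_im, ← hL, Complex.mul_im, Complex.ofReal_re, Complex.ofReal_im, Complex.I_im,
    Complex.I_re] at Him
  have Hii : IntervalIntegrable (fun t => ((r t : ℂ) * ((z * u t + g t) * conj (u t)
      - u t * conj (z * u t + g t))).im) volume x0 c := by
    exact ⟨Hi.1.im, Hi.2.im⟩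
  have hpt : ∀ t, ((r t : ℂ) * ((z * u t + g t) * conj (u t)
      - u t * conj (z * u t + g t))).im = 2 * z.im * (‖u t‖ ^ 2 * r t)
        + 2 * ((g t * conj (u t)).im * r t) := by
    intro t
    rw [← Complex.normSq_eq_norm_sq, normSq_apply]
    simp only [Complex.mul_im, Complex.sub_im, Complex.add_im, Complex.mul_re, Complex.add_re,
      Complex.sub_re, conj_re, conj_im, Complex.ofReal_re, Complex.ofReal_im]
    ring
  simp only [hpt] at Him Hii
  have hSi : IntervalIntegrable (fun t => 2 * ((g t * conj (u t)).im * r t)) volume x0 c := by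
    have := Hii.sub (hAi'.const_mul (2 * z.im))
    refine this.congr fun t _ => ?_
    ring
  rw [intervalIntegral.integral_add (hAi'.const_mul _) hSi, intervalIntegral.integral_const_mul,
    intervalIntegral.integral_const_mul, hAA] at Him
  set S := ∫ t in x0..c, (g t * conj (u t)).im * r t with hS
  set y := |z.im| with hy
  have hy0 : 0 < y := abs_pos.2 hz
  have hSle : |S| ≤ ∫ t in x0..c, ((2 * y)⁻¹ * (‖g t‖ ^ 2 * r t) + y / 2 * (‖u t‖ ^ 2 * r t)) := by
    rw [← Real.norm_eq_abs]
    refine intervalIntegral.norm_integral_le_of_norm_le hx0.2.le ?_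
      ((hGi.const_mul _).add (hAi'.const_mul _))
    filter_upwards [hr] with t ht htm
    have hrt := ht (hsub (by rwa [uIoc_of_le hx0.2.le]))
    rw [norm_mul, Real.norm_eq_abs, Real.norm_eq_abs, abs_of_pos hrt, ← mul_assoc, ← mul_assoc,
      ← add_mul]
    gcongr
    refine (Complex.abs_im_le_norm _).trans ?_
    rw [norm_mul, RCLike.norm_conj]
    have : (2 * y)⁻¹ * ‖g t‖ ^ 2 + y / 2 * ‖u t‖ ^ 2 - ‖g t‖ * ‖u t‖
      = (2 * y)⁻¹ * (‖g t‖ - y * ‖u t‖) ^ 2 := by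
      field_simp
      ring
    have : 0 ≤ (2 * y)⁻¹ * (‖g t‖ - y * ‖u t‖) ^ 2 := by positivity
    linarith
  rw [intervalIntegral.integral_add (hGi.const_mul _) (hAi'.const_mul _),
    intervalIntegral.integral_const_mul, intervalIntegral.integral_const_mul, hAA] at hSle
  have hA0 : 0 ≤ A := intervalIntegral.integral_nonneg hx0.2.le fun t _ => by positivity
  have hfin : y * (A + ‖J‖ ^ 2 * K) = |S| := by
    have e : z.im * (A + ‖J‖ ^ 2 * K) = - S := by
      simp only [Complex.zero_im] at Him
      linarith
    have := congrArg abs e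
    rwa [abs_mul, abs_neg, abs_of_nonneg (by positivity : 0 ≤ A + ‖J‖ ^ 2 * K)] at this
  have h1 : y * A ≤ (2 * y)⁻¹ * G + y / 2 * A := by
    have : 0 ≤ y * (‖J‖ ^ 2 * K) := by positivity
    have : (2 * y)⁻¹ * ∫ t in x0..c, ‖g t‖ ^ 2 * r t ≤ (2 * y)⁻¹ * G := by gcongr
    linarith
  rw [← sq_abs z.im, ← hy, le_div_iff₀ (by positivity)]
  have h2 : (2 * y)⁻¹ * G * (2 * y) = G := by field_simp
  nlinarith

theorem usol_kappa (hyp : SLHyp a b p q r s) {f g : ℝ → ℂ} (hf : ContinuousOn f (Ioo a b))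
    (h0 : ∀ t ∈ Ioo a b, f t ≠ 0) {c : ℝ} (hc : c ∈ Ioo a b) (hg : LocI a b r g) (κ : ℂ)
    {x : ℝ} (hx : x ∈ Ioo a b) :
    usol p r c f g 0 x = usol p r c f g κ x +
      κ * (f x * ∫ t in x..c, 1 / ((p t : ℂ) * f t ^ 2)) := by
  have hω := (omg_ac hf hc hg).continuousOn
  have h1 := pinv_int hyp hf h0 hω c hc x hx
  have h2 := pinv_int hyp hf h0 (h := fun _ => 1) continuousOn_const c hc x hx
  simp only [usol, isol, sub_zero, sub_div]
  rw [intervalIntegral.integral_sub h1 (by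
    refine (h2.const_mul κ).congr fun t _ => ?_
    ring)]
  have : ∫ t in x..c, κ / ((p t : ℂ) * f t ^ 2) = κ * ∫ t in x..c, 1 / ((p t : ℂ) * f t ^ 2) := by
    rw [← intervalIntegral.integral_const_mul]
    refine intervalIntegral.integral_congr fun t _ => ?_
    ring
  rw [this]
  ring

theorem usol_L1 (hyp : SLHyp a b p q r s) (hφ : RealEntireSolFam a b p q r s φ φq) {z : ℂ}
    (hz : z.im ≠ 0) {c : ℝ} (hc : c ∈ Ioo a b) {g : ℝ → ℂ} (hgm : AEStronglyMeasurable g volume)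
    (hg2 : IntegrableOn (fun t => ‖g t‖ ^ 2 * r t) (Ioo a b))
    (hhat : ∫ t in Ioo a c, φ z t * g t * (r t : ℂ) = 0) {x1 : ℝ} (hx1 : x1 ∈ Ioo a c) :
    ∫ t in x1..c, ‖usol p r c (φ z) g 0 t‖ * |r t| ≤
      ((∫ t in Ioo a b, ‖g t‖ ^ 2 * r t) + ∫ t in x1..c, |r t|) / (2 * |z.im|) := by
  have hg := LocI.of_sq hyp hgm hg2
  have hx1' : x1 ∈ Ioo a b := ⟨hx1.1, hx1.2.trans hc.2⟩
  have hne : ∀ t ∈ Ioo a b, φ z t ≠ 0 := fun t ht => phi_ne hyp hφ hz ht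
  have hf := phi_contOn hφ z
  set G := ∫ t in Ioo a b, ‖g t‖ ^ 2 * r t with hG
  set ρ := ∫ t in x1..c, |r t| with hρ
  set y := |z.im| with hy
  have hy0 : 0 < y := abs_pos.2 hz
  set θ : ℝ → ℂ := fun x => φ z x * ∫ t in x..c, 1 / ((p t : ℂ) * φ z t ^ 2) with hθ
  have hθc : ContinuousOn θ (Ioo a b) :=
    hf.mul (HasACDeriv.primitive' (pinv_int hyp hf hne (h := fun _ => 1) continuousOn_const)
      hc).continuousOn
  have hsub := HasACDeriv.uIcc_sub hx1' hc
  have hri := (hyp.ir c hc x1 hx1').abs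
  have hcu : ∀ κ, ContinuousOn (usol p r c (φ z) g κ) (Ioo a b) := fun κ =>
    (usol_sys hyp (hφ.sol z) hne hc hg κ).fst.continuousOn
  have hi1 : ∀ κ, IntervalIntegrable (fun t => ‖usol p r c (φ z) g κ t‖ * |r t|) volume x1 c :=
    fun κ => hri.continuousOn_mul ((hcu κ).mono hsub).norm
  have hi2 : ∀ κ, IntervalIntegrable (fun t => ‖usol p r c (φ z) g κ t‖ ^ 2 * |r t|) volume x1 c :=
    fun κ => hri.continuousOn_mul (((hcu κ).mono hsub).norm.pow 2)
  have hiθ : IntervalIntegrable (fun t => ‖θ t‖ * |r t|) volume x1 c :=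
    hri.continuousOn_mul (hθc.mono hsub).norm
  set T := ∫ t in x1..c, ‖θ t‖ * |r t| with hT
  have key : ∀ x0 ∈ Ioo a x1, ∫ t in x1..c, ‖usol p r c (φ z) g 0 t‖ * |r t| ≤
      (G + ρ) / (2 * y) + ‖omg r c (φ z) g x0‖ * T := by
    intro x0 hx0
    have hx0c : x0 ∈ Ioo a c := ⟨hx0.1, hx0.2.trans hx1.2⟩
    have hx0' : x0 ∈ Ioo a b := ⟨hx0.1, hx0c.2.trans hc.2⟩
    have hE := energy hyp hφ hz hc hgm hg2 hx0c
    set κ := omg r c (φ z) g x0 with hκ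
    have hE2 : ∫ t in x1..c, ‖usol p r c (φ z) g κ t‖ ^ 2 * |r t| ≤ G / y ^ 2 := by
      rw [hy, sq_abs]
      refine le_trans ?_ hE
      have hi3 : IntervalIntegrable (fun t => ‖usol p r c (φ z) g κ t‖ ^ 2 * |r t|) volume x0 x1 :=
        (hyp.ir x1 hx1' x0 hx0').abs.continuousOn_mul
          (((hcu κ).mono (HasACDeriv.uIcc_sub hx0' hx1')).norm.pow 2)
      rw [← intervalIntegral.integral_add_adjacent_intervals hi3 (hi2 κ)]
      have : 0 ≤ ∫ t in x0..x1, ‖usol p r c (φ z) g κ t‖ ^ 2 * |r t| :=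
        intervalIntegral.integral_nonneg hx0.2.le fun t _ => by positivity
      linarith
    have hpt : ∀ t ∈ Icc x1 c, ‖usol p r c (φ z) g 0 t‖ * |r t| ≤
        (y / 2 * (‖usol p r c (φ z) g κ t‖ ^ 2 * |r t|) + (2 * y)⁻¹ * |r t|)
          + ‖κ‖ * (‖θ t‖ * |r t|) := by
      intro t ht
      have htb : t ∈ Ioo a b := hsub (by rwa [uIcc_of_le hx1.2.le])
      rw [usol_kappa hyp hf hne hc hg κ htb]
      have h1 : ‖usol p r c (φ z) g κ t + κ * θ t‖ ≤ ‖usol p r c (φ z) g κ t‖ + ‖κ‖ * ‖θ t‖ :=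
        (norm_add_le _ _).trans (by rw [norm_mul])
      have h2 : ‖usol p r c (φ z) g κ t‖ ≤ y / 2 * ‖usol p r c (φ z) g κ t‖ ^ 2 + (2 * y)⁻¹ := by
        set n := ‖usol p r c (φ z) g κ t‖
        have e : y / 2 * n ^ 2 + (2 * y)⁻¹ - n = (2 * y)⁻¹ * (y * n - 1) ^ 2 := by
          field_simp
          ring
        have : 0 ≤ (2 * y)⁻¹ * (y * n - 1) ^ 2 := by positivity
        linarith
      have h3 : ‖usol p r c (φ z) g κ t + κ * θ t‖ * |r t| ≤
        (y / 2 * ‖usol p r c (φ z) g κ t‖ ^ 2 + (2 * y)⁻¹ + ‖κ‖ * ‖θ t‖) * |r t| := by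
        gcongr
        linarith
      refine h3.trans_eq ?_
      ring
    refine (intervalIntegral.integral_mono_on hx1.2.le (hi1 0)
      ((((hi2 κ).const_mul _).add (hri.const_mul _)).add (hiθ.const_mul _)) hpt).trans ?_
    rw [intervalIntegral.integral_add (((hi2 κ).const_mul _).add (hri.const_mul _))
      (hiθ.const_mul _), intervalIntegral.integral_add ((hi2 κ).const_mul _) (hri.const_mul _),
      intervalIntegral.integral_const_mul, intervalIntegral.integral_const_mul,
      intervalIntegral.integral_const_mul]
    have h4 : y / 2 * ∫ t in x1..c, ‖usol p r c (φ z) g κ t‖ ^ 2 * |r t| ≤ y / 2 * (G / y ^ 2) := by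
      gcongr
    have h5 : y / 2 * (G / y ^ 2) + (2 * y)⁻¹ * ρ = (G + ρ) / (2 * y) := by
      field_simp
    linarith
  have hlim : Tendsto (fun x0 => (G + ρ) / (2 * y) + ‖omg r c (φ z) g x0‖ * T) (𝓝[>] a)
      (𝓝 ((G + ρ) / (2 * y) + ‖(0 : ℂ)‖ * T)) := by
    refine tendsto_const_nhds.add (Tendsto.mul_const _ ?_)
    refine Tendsto.norm ?_
    have h1 := (tendsto_left_integral hc.1 (g := fun t => φ z t * g t * (r t : ℂ))
      (integrableOn_mul_mul hyp.mr (rpos_sub hyp hc.2.le) (phi_aesm hφ z hc.2.le) hgm.restrict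
        (hφ.sqint z c hc) (hg2.mono_set (Ioo_subset_Ioo_right hc.2.le)))).neg
    rw [hhat, neg_zero] at h1
    exact h1
  rw [norm_zero, zero_mul, add_zero] at hlim
  refine ge_of_tendsto hlim ?_
  filter_upwards [Ioo_mem_nhdsGT hx1.1] with x0 hx0
  exact key x0 hx0

end energy


/-! ### Completeness -/

theorem liouville_im' {f : ℂ → ℂ} (hf : Differentiable ℂ f) {C : ℝ} (hC0 : 0 ≤ C)
    (hC : ∀ z : ℂ, z.im ≠ 0 → ‖f z‖ ≤ C * (1 + ‖z‖) / |z.im|) (z : ℂ) : f z = f 0 := by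
  have hd : Differentiable ℂ (dslope f 0) := by
    rw [← differentiableOn_univ]
    exact (Complex.differentiableOn_dslope univ_mem).2 hf.differentiableOn
  obtain ⟨M, hM⟩ := (isCompact_closedBall (0 : ℂ) 1).exists_bound_of_continuousOn
    hd.continuous.continuousOn
  have hM0 : 0 ≤ M := (norm_nonneg _).trans (hM 0 (by simp))
  have key := liouville_im hd (C := M + 2 * C + ‖f 0‖) ?_
  · have h1 := key z
    by_cases hz : z = 0
    · rw [hz]
    rw [dslope_of_ne _ hz, slope_def_field, sub_zero, div_eq_zero_iff] at h1
    rcases h1 with h1 | h1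
    · exact sub_eq_zero.1 h1
    · exact absurd h1 hz
  · intro w hw
    have hw0 : w ≠ 0 := by
      rintro rfl
      simp at hw
    have hp : 0 < |w.im| := abs_pos.2 hw
    have hle : |w.im| ≤ ‖w‖ := Complex.abs_im_le_norm w
    rw [le_div_iff₀ hp]
    rcases le_total ‖w‖ 1 with h1 | h1
    · have h2 := hM w (by simpa using h1)
      have : ‖dslope f 0 w‖ * |w.im| ≤ M * 1 := by
        gcongr
        exact hle.trans h1
      have := norm_nonneg (f 0)
      linarith
    · rw [dslope_of_ne _ hw0, slope_def_field, sub_zero, norm_div, div_mul_eq_mul_div,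
        div_le_iff₀ (by positivity)]
      have h2 := hC w hw
      rw [le_div_iff₀ hp] at h2
      have h3 : ‖f w - f 0‖ ≤ ‖f w‖ + ‖f 0‖ := norm_sub_le _ _
      have h4 : ‖f w - f 0‖ * |w.im| ≤ (‖f w‖ + ‖f 0‖) * |w.im| := by gcongr
      have h5 : ‖f 0‖ * |w.im| ≤ ‖f 0‖ * ‖w‖ := by gcongr
      have h6 : C * 1 ≤ C * ‖w‖ := by gcongr
      have h7 : 0 ≤ M * ‖w‖ := by positivity
      nlinarith

section compl

variable {a b : ℝ} {p q r s : ℝ → ℝ} {f fq g h : ℝ → ℂ} {c : ℝ} {z : ℂ}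

theorem rho_pow (hyp : SLHyp a b p q r s) (hc : c ∈ Ioo a b) {x : ℝ} (hx : x ∈ Ioo a b) (n : ℕ) :
    ∫ t in x..c, (∫ y in t..c, |r y|) ^ n * |r t| = (∫ y in x..c, |r y|) ^ (n + 1) / (n + 1) := by
  have hi : ∀ x ∈ Ioo a b, ∀ y ∈ Ioo a b,
      IntervalIntegrable (fun t => ((|r t| : ℝ) : ℂ)) volume y x := fun x hx y hy =>
    intervalIntegrable_coe (hyp.ir x hx y hy).abs
  have H := HasACDeriv.primitive' hi hc
  have Hn : ∀ n : ℕ, HasACDeriv a b (fun x => (∫ t in x..c, ((|r t| : ℝ) : ℂ)) ^ (n + 1))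
      (fun x => -((n + 1 : ℂ) * ((∫ t in x..c, ((|r t| : ℝ) : ℂ)) ^ n * ((|r x| : ℝ) : ℂ)))) := by
    intro n
    induction n with
    | zero => simpa using H
    | succ n ih =>
      refine (ih.mul H).congr (fun t _ => by ring) (Eventually.of_forall fun t _ => ?_)
      push_cast
      ring
  have h1 := (Hn n c hc x hx).2
  rw [intervalIntegral.integral_neg, intervalIntegral.integral_const_mul] at h1
  simp only [intervalIntegral.integral_same, intervalIntegral.integral_ofReal] at h1
  rw [zero_pow (by omega)] at h1
  have h2 : (∫ t in x..c, ((∫ y in t..c, |r y| : ℝ) : ℂ) ^ n * ((|r t| : ℝ) : ℂ)) =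
      ((∫ t in x..c, (∫ y in t..c, |r y|) ^ n * |r t| : ℝ) : ℂ) := by
    rw [← intervalIntegral.integral_ofReal]
    simp
  rw [h2] at h1
  have h3 : (0 : ℝ) = (∫ y in x..c, |r y|) ^ (n + 1) +
      -((n + 1) * ∫ t in x..c, (∫ y in t..c, |r y|) ^ n * |r t|) := by exact_mod_cast h1
  rw [eq_div_iff (by positivity)]
  linarith

/-- Iterated Volterra operator. -/
def itV (p r : ℝ → ℝ) (c : ℝ) (f h : ℝ → ℂ) (n : ℕ) : ℝ → ℂ :=
  (fun h => usol p r c f h 0)^[n] h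

theorem itV_zero : itV p r c f h 0 = h := rfl
theorem itV_succ (n : ℕ) : itV p r c f h (n + 1) = usol p r c f (itV p r c f h n) 0 :=
  Function.iterate_succ_apply' _ _ _

theorem itV_cont (hyp : SLHyp a b p q r s) (F : SLSys a b p q r s f fq (fun x => z * f x))
    (h0 : ∀ t ∈ Ioo a b, f t ≠ 0) (hc : c ∈ Ioo a b) (hh : ContinuousOn h (Ioo a b)) (n : ℕ) :
    ContinuousOn (itV p r c f h n) (Ioo a b) := by
  induction n with
  | zero => exact hh
  | succ n ih =>
    rw [itV_succ]
    exact (usol_sys hyp F h0 hc (LocI.of_cont hyp ih) 0).fst.continuousOn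

theorem itV_bound (hyp : SLHyp a b p q r s) (F : SLSys a b p q r s f fq (fun x => z * f x))
    (h0 : ∀ t ∈ Ioo a b, f t ≠ 0) (hc : c ∈ Ioo a b) {x1 : ℝ} (hx1 : x1 ∈ Ioo a c) {B : ℝ}
    (hB0 : 0 ≤ B) (hB : ∀ g, LocI a b r g → ∀ x ∈ Icc x1 c,
      ‖usol p r c f g 0 x‖ ≤ B * ∫ t in x..c, ‖g t‖ * |r t|) (hh : ContinuousOn h (Ioo a b))
    {M : ℝ} (hM : ∀ x ∈ Icc x1 c, ‖h x‖ ≤ M) (n : ℕ) : ∀ x ∈ Icc x1 c,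
      ‖itV p r c f h n x‖ ≤ M * (B * ∫ t in x..c, |r t|) ^ n / n.factorial := by
  have hx1' : x1 ∈ Ioo a b := ⟨hx1.1, hx1.2.trans hc.2⟩
  have hsub : Icc x1 c ⊆ Ioo a b := ordConnected_Ioo.out hx1' hc
  induction n with
  | zero => simpa [itV_zero] using hM
  | succ n ih =>
    intro x hx
    have hcn := itV_cont hyp F h0 hc hh n
    have hl := LocI.of_cont hyp hcn
    have hρ : ContinuousOn (fun t => ∫ y in t..c, |r y|) (Icc x1 c) := by
      have hi : ∀ x ∈ Ioo a b, ∀ y ∈ Ioo a b,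
          IntervalIntegrable (fun t => ((|r t| : ℝ) : ℂ)) volume y x := fun x hx y hy =>
        intervalIntegrable_coe (hyp.ir x hx y hy).abs
      have H := (HasACDeriv.primitive' hi hc).continuousOn.mono hsub
      have := Complex.continuous_re.comp_continuousOn H
      refine this.congr fun t ht => ?_
      simp only [Function.comp_apply, intervalIntegral.integral_ofReal, Complex.ofReal_re]
    rw [itV_succ]
    refine (hB _ hl x hx).trans ?_
    have hmono : ∫ t in x..c, ‖itV p r c f h n t‖ * |r t| ≤
        ∫ t in x..c, M * B ^ n / n.factorial * ((∫ y in t..c, |r y|) ^ n * |r t|) := by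
      refine intervalIntegral.integral_mono_on hx.2 ?_ ?_ ?_
      · simpa [norm_mul] using (hl c hc x (hsub hx)).norm
      · refine IntervalIntegrable.const_mul ?_ _
        refine (hyp.ir c hc x (hsub hx)).abs.continuousOn_mul ((hρ.pow n).mono ?_)
        rw [uIcc_of_le hx.2]
        exact Icc_subset_Icc_left hx.1
      · intro t ht
        have := ih t ⟨hx.1.trans ht.1, ht.2⟩
        rw [mul_pow] at this
        calc ‖itV p r c f h n t‖ * |r t| ≤
            (M * (B ^ n * (∫ y in t..c, |r y|) ^ n) / n.factorial) * |r t| := by gcongr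
          _ = _ := by ring
    rw [intervalIntegral.integral_const_mul, rho_pow hyp hc (hsub hx)] at hmono
    calc _ ≤ B * (M * B ^ n / n.factorial * ((∫ y in x..c, |r y|) ^ (n + 1) / (n + 1))) := by gcongr
      _ = _ := by
        rw [Nat.factorial_succ, mul_pow, pow_succ B]
        push_cast
        field_simp

theorem itV_series (hyp : SLHyp a b p q r s) (F : SLSys a b p q r s f fq (fun x => z * f x))
    (h0 : ∀ t ∈ Ioo a b, f t ≠ 0) (hc : c ∈ Ioo a b) {u a0 : ℝ → ℂ} (hu : ContinuousOn u (Ioo a b))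
    (ha : ContinuousOn a0 (Ioo a b)) (k : ℂ)
    (he : ∀ x ∈ Ioo a b, u x = a0 x + k * usol p r c f u 0 x) (N : ℕ) : ∀ x ∈ Ioo a b,
    u x = ∑ j ∈ Finset.range N, k ^ j * itV p r c f a0 j x + k ^ N * itV p r c f u N x := by
  have h1 : ∀ n : ℕ, ∀ x ∈ Ioo a b,
      itV p r c f u n x = itV p r c f a0 n x + k * itV p r c f u (n + 1) x := by
    intro n
    induction n with
    | zero => exact he
    | succ n ih =>
      intro x hx
      rw [itV_succ, itV_succ, itV_succ (n + 1), usol_congr hc ih 0 x hx]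
      exact usol_lin hyp F h0 hc (LocI.of_cont hyp (itV_cont hyp F h0 hc ha n))
        (LocI.of_cont hyp (itV_cont hyp F h0 hc hu (n + 1))) k x hx
  induction N with
  | zero => simp [itV_zero]
  | succ N ih =>
    intro x hx
    rw [Finset.sum_range_succ]
    conv_lhs => rw [ih x hx, h1 N x hx]
    ring

theorem itV_tsum (hyp : SLHyp a b p q r s) (F : SLSys a b p q r s f fq (fun x => z * f x))
    (h0 : ∀ t ∈ Ioo a b, f t ≠ 0) (hc : c ∈ Ioo a b) {x1 : ℝ} (hx1 : x1 ∈ Ioo a c)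
    {a0 : ℝ → ℂ} (ha : ContinuousOn a0 (Ioo a b)) {x : ℝ} (hx : x ∈ Icc x1 c) :
    ∃ G : ℂ → ℂ, Differentiable ℂ G ∧ ∀ (k : ℂ) (u : ℝ → ℂ), ContinuousOn u (Ioo a b) →
    (∀ x ∈ Ioo a b, u x = a0 x + k * usol p r c f u 0 x) → u x = G k := by
  have hx1' : x1 ∈ Ioo a b := ⟨hx1.1, hx1.2.trans hc.2⟩
  have hsub : Icc x1 c ⊆ Ioo a b := ordConnected_Ioo.out hx1' hc
  obtain ⟨B, hB0, hB⟩ := usol_bound hyp F.fst.continuousOn h0 hc hx1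
  have hbd : ∀ {h : ℝ → ℂ}, ContinuousOn h (Ioo a b) → ∃ M : ℝ, ∀ n : ℕ,
      ‖itV p r c f h n x‖ ≤ M * (B * ∫ t in x..c, |r t|) ^ n / n.factorial := by
    intro h hh
    obtain ⟨M, hM⟩ := isCompact_Icc.exists_bound_of_continuousOn (hh.mono hsub)
    exact ⟨M, fun n => itV_bound hyp F h0 hc hx1 hB0 hB hh hM n x hx⟩
  have hρ0 : 0 ≤ B * ∫ t in x..c, |r t| := 
    mul_nonneg hB0 (intervalIntegral.integral_nonneg hx.2 fun _ _ => abs_nonneg _)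
  set ρ := B * ∫ t in x..c, |r t| with hρ
  obtain ⟨M, hM⟩ := hbd ha
  have hsum : ∀ R : ℝ, Summable fun n : ℕ => M * ((R * ρ) ^ n / n.factorial) := fun R =>
    (Real.summable_pow_div_factorial _).mul_left M
  have hle : ∀ R : ℝ, ∀ k : ℂ, ‖k‖ ≤ R → ∀ n : ℕ, ‖k ^ n * itV p r c f a0 n x‖ ≤
      M * ((R * ρ) ^ n / n.factorial) := by
    intro R k hk n
    have hR : 0 ≤ R := (norm_nonneg _).trans hk
    rw [norm_mul, norm_pow]
    calc ‖k‖ ^ n * ‖itV p r c f a0 n x‖ ≤ R ^ n * (M * ρ ^ n / n.factorial) := by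
          gcongr
          exact hM n
      _ = _ := by rw [mul_pow]; ring
  refine ⟨fun k => ∑' n : ℕ, k ^ n * itV p r c f a0 n x, ?_, ?_⟩
  · intro k
    have hd : DifferentiableOn ℂ (fun k : ℂ => ∑' n : ℕ, k ^ n * itV p r c f a0 n x)
        (Metric.ball 0 (‖k‖ + 1)) := by
      refine differentiableOn_tsum_of_summable_norm (hsum (‖k‖ + 1)) ?_ Metric.isOpen_ball ?_
      · intro n
        fun_prop
      · intro n w hw
        exact hle _ w (by simpa using (mem_ball_zero_iff.1 hw).le) n
    exact hd.differentiableAt (Metric.isOpen_ball.mem_nhds (by simp))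
  · intro k u hu he
    have hs : Summable fun n : ℕ => k ^ n * itV p r c f a0 n x :=
      Summable.of_norm_bounded (hsum ‖k‖) (hle ‖k‖ k le_rfl)
    obtain ⟨M', hM'⟩ := hbd hu
    have ht : Tendsto (fun N : ℕ => k ^ N * itV p r c f u N x) atTop (𝓝 0) := by
      refine squeeze_zero_norm (a := fun n : ℕ => M' * ((‖k‖ * ρ) ^ n / n.factorial)) ?_ ?_
      · intro n
        rw [norm_mul, norm_pow]
        calc ‖k‖ ^ n * ‖itV p r c f u n x‖ ≤ ‖k‖ ^ n * (M' * ρ ^ n / n.factorial) := by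
              gcongr
              exact hM' n
          _ = _ := by rw [mul_pow]; ring
      · simpa using (FloorSemiring.tendsto_pow_div_factorial_atTop (‖k‖ * ρ)).const_mul M'
    have h2 := hs.hasSum.tendsto_sum_nat
    have h3 := h2.add ht
    rw [add_zero] at h3
    refine tendsto_nhds_unique ?_ h3
    refine tendsto_const_nhds.congr fun N => ?_
    exact itV_series hyp F h0 hc hu ha k he N x (hsub hx)

end compl


theorem complete_x1 {a b : ℝ} {p q r s : ℝ → ℝ} {φ φq : ℂ → ℝ → ℂ} (hyp : SLHyp a b p q r s)
    (hφ : RealEntireSolFam a b p q r s φ φq) {c : ℝ} (hc : c ∈ Ioo a b) {g : ℝ → ℂ}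
    (hgm : AEStronglyMeasurable g volume)
    (hg2 : IntegrableOn (fun t => ‖g t‖ ^ 2 * r t) (Ioo a b))
    (hhat : ∀ z : ℂ, z.im ≠ 0 → ∫ t in Ioo a c, φ z t * g t * (r t : ℂ) = 0) {x1 : ℝ}
    (hx1 : x1 ∈ Ioo a c) : ∀ᵐ t, t ∈ Ioo x1 c → g t = 0 := by
  have hg := LocI.of_sq hyp hgm hg2
  have hx1' : x1 ∈ Ioo a b := ⟨hx1.1, hx1.2.trans hc.2⟩
  have hsub : Icc x1 c ⊆ Ioo a b := ordConnected_Ioo.out hx1' hc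
  have hne : ∀ z : ℂ, z.im ≠ 0 → ∀ t ∈ Ioo a b, φ z t ≠ 0 := fun z hz t ht => phi_ne hyp hφ hz ht
  have hI : (I : ℂ).im ≠ 0 := by simp
  have h2I : (2 * I : ℂ).im ≠ 0 := by simp
  have hsys : ∀ z : ℂ, z.im ≠ 0 → SLSys a b p q r s (usol p r c (φ z) g 0)
      (uqsol p r c (φ z) (φq z) g 0) (fun x => z * usol p r c (φ z) g 0 x + g x) :=
    fun z hz => usol_sys hyp (hφ.sol z) (hne z hz) hc hg 0
  have hcont : ∀ z : ℂ, z.im ≠ 0 → ContinuousOn (usol p r c (φ z) g 0) (Ioo a b) :=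
    fun z hz => (hsys z hz).fst.continuousOn
  have heq : ∀ z : ℂ, z.im ≠ 0 → ∀ x ∈ Ioo a b, usol p r c (φ z) g 0 x =
      usol p r c (φ I) g 0 x + (z - I) * usol p r c (φ I) (usol p r c (φ z) g 0) 0 x := by
    intro z hz x hx
    have hl := LocI.of_cont hyp (hcont z hz)
    rw [← usol_lin hyp (hφ.sol I) (hne I hI) hc hg hl (z - I) x hx]
    refine usol_unique hyp (hφ.sol I) (hne I hI) hc (hg.add (hl.const_mul _))
      ((hsys z hz).congrw fun x => by ring) (usol_c _) (by rw [uqsol_c, zero_mul]) x hx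
  have hconst : ∀ x ∈ Icc x1 c, usol p r c (φ (2 * I)) g 0 x = usol p r c (φ I) g 0 x := by
    intro x hx
    obtain ⟨G, hG, hGu⟩ := itV_tsum hyp (hφ.sol I) (hne I hI) hc hx1 (hcont I hI) hx
    obtain ⟨B, hB0, hB⟩ := usol_bound hyp (phi_contOn hφ I) (hne I hI) hc hx1
    have hval : ∀ z : ℂ, z.im ≠ 0 → usol p r c (φ z) g 0 x = G (z - I) := fun z hz =>
      hGu (z - I) _ (hcont z hz) (heq z hz)
    set D := (∫ t in Ioo a b, ‖g t‖ ^ 2 * r t) + ∫ t in x1..c, |r t| with hD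
    have hD0 : 0 ≤ D := by
      refine add_nonneg (integral_nonneg_of_ae ?_)
        (intervalIntegral.integral_nonneg hx1.2.le fun _ _ => abs_nonneg _)
      filter_upwards [hyp.rpos] with t ht
      positivity
    set A := ‖usol p r c (φ I) g 0 x‖ with hA
    have hL := liouville_im' (f := fun z => G (z - I)) (hG.comp (by fun_prop)) (C := A + B * D)
      (by positivity) ?_
    · have h1 := hL I
      have h2 := hL (2 * I)
      rw [hval _ h2I, hval _ hI, h1, h2]
    · intro z hz
      have hp : 0 < |z.im| := abs_pos.2 hz
      have hle : |z.im| ≤ ‖z‖ := Complex.abs_im_le_norm z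
      have h1 := usol_L1 hyp hφ hz hc hgm hg2 (hhat z hz) hx1
      have hl := LocI.of_cont hyp (hcont z hz)
      have hgi : ∀ x ∈ Ioo a b, ∀ y ∈ Ioo a b,
          IntervalIntegrable (fun t => ‖usol p r c (φ z) g 0 t‖ * |r t|) volume y x := by
        intro x hx y hy
        simpa [norm_mul] using (hl x hx y hy).norm
      have h2 : ∫ t in x..c, ‖usol p r c (φ z) g 0 t‖ * |r t| ≤
          ∫ t in x1..c, ‖usol p r c (φ z) g 0 t‖ * |r t| := by
        rw [← intervalIntegral.integral_add_adjacent_intervals (hgi x (hsub hx) x1 hx1')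
          (hgi c hc x (hsub hx))]
        have : 0 ≤ ∫ t in x1..x, ‖usol p r c (φ z) g 0 t‖ * |r t| :=
          intervalIntegral.integral_nonneg hx.1 fun t _ => by positivity
        linarith
      have h3 := (h2.trans h1)
      have h4 : D / (2 * |z.im|) ≤ D / |z.im| := by
        gcongr
        linarith
      have h5 : ‖z - I‖ ≤ 1 + ‖z‖ := by
        have := norm_sub_le z I
        rw [Complex.norm_I] at this
        linarith
      have h6 : ‖G (z - I)‖ ≤ A + (1 + ‖z‖) * (B * (D / |z.im|)) := by
        rw [← hval z hz, heq z hz x (hsub hx)]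
        refine (norm_add_le _ _).trans ?_
        rw [norm_mul]
        gcongr
        refine (hB _ hl x hx).trans ?_
        gcongr
        exact h3.trans h4
      refine h6.trans ?_
      rw [le_div_iff₀ hp]
      have e : (A + (1 + ‖z‖) * (B * (D / |z.im|))) * |z.im| =
          A * |z.im| + (1 + ‖z‖) * (B * D) := by
        field_simp
      rw [e]
      have hA0 : 0 ≤ A := norm_nonneg _
      nlinarith
  have hS := ((hsys (2 * I) h2I).sub (hsys I hI)).w_zero hyp hx1' hc hx1.2 (by
    intro t ht
    rw [hconst t (Ioo_subset_Icc_self ht), sub_self])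
  have hz0 : usol p r c (φ I) g 0 =ᵐ[volume.restrict (Ioo x1 c)] fun _ => 0 := by
    rw [EventuallyEq, ae_restrict_iff' measurableSet_Ioo]
    filter_upwards [hS] with t ht htm
    have h1 := ht htm
    rw [hconst t (Ioo_subset_Icc_self htm)] at h1
    have h2 : I * usol p r c (φ I) g 0 t = 0 := by linear_combination h1
    simpa using h2
  have hz1 : EqOn (usol p r c (φ I) g 0) (fun _ => 0) (Ioo x1 c) :=
    Measure.eqOn_open_of_ae_eq hz0 isOpen_Ioo
      ((hcont I hI).mono (Ioo_subset_Icc_self.trans hsub)) continuousOn_const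
  have hS2 := (hsys I hI).w_zero hyp hx1' hc hx1.2 hz1
  filter_upwards [hS2] with t ht htm
  have := ht htm
  rw [hz1 htm] at this
  simpa using this

theorem complete_ae {a b : ℝ} {p q r s : ℝ → ℝ} {φ φq : ℂ → ℝ → ℂ} (hyp : SLHyp a b p q r s)
    (hφ : RealEntireSolFam a b p q r s φ φq) {c : ℝ} (hc : c ∈ Ioo a b) {g : ℝ → ℂ}
    (hgm : AEStronglyMeasurable g volume)
    (hg2 : IntegrableOn (fun t => ‖g t‖ ^ 2 * r t) (Ioo a b))
    (hhat : ∀ z : ℂ, z.im ≠ 0 → ∫ t in Ioo a c, φ z t * g t * (r t : ℂ) = 0) :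
    ∀ᵐ t, t ∈ Ioo a c → g t = 0 := by
  have hac : 0 < c - a := sub_pos.2 hc.1
  have h1 : ∀ n : ℕ, ∀ᵐ t, t ∈ Ioo (a + (c - a) / (n + 2)) c → g t = 0 := by
    intro n
    refine complete_x1 hyp hφ hc hgm hg2 hhat ⟨?_, ?_⟩
    · have : 0 < (c - a) / (n + 2) := by positivity
      linarith
    · have : (c - a) / (n + 2) < c - a := by
        apply div_lt_self hac
        have : (0 : ℝ) ≤ n := Nat.cast_nonneg n
        linarith
      linarith
  filter_upwards [ae_all_iff.2 h1] with t ht htm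
  obtain ⟨n, hn⟩ := exists_nat_gt ((c - a) / (t - a))
  refine ht n ⟨?_, htm.2⟩
  have h2 : 0 < t - a := sub_pos.2 htm.1
  rw [div_lt_iff₀ h2] at hn
  have : (c - a) / (n + 2) < t - a := by
    rw [div_lt_iff₀ (by positivity)]
    nlinarith
  linarith


/-! ### The kernel -/

theorem fatou_real {α : Type*} [MeasurableSpace α] {μ : Measure α} {F : ℕ → α → ℝ} {f : α → ℝ}
    {C : ℝ} (hi : ∀ n, Integrable (F n) μ) (hp : ∀ n, 0 ≤ᵐ[μ] F n) (hC : ∀ n, ∫ x, F n x ∂μ ≤ C)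
    (hf : Integrable f μ) (hf0 : 0 ≤ᵐ[μ] f)
    (hl : ∀ᵐ x ∂μ, Tendsto (fun n => F n x) atTop (𝓝 (f x))) : ∫ x, f x ∂μ ≤ C := by
  have hC0 : 0 ≤ C := (integral_nonneg_of_ae (hp 0)).trans (hC 0)
  rw [← ENNReal.ofReal_le_ofReal_iff hC0, ofReal_integral_eq_lintegral_ofReal hf hf0]
  calc ∫⁻ x, ENNReal.ofReal (f x) ∂μ
      = ∫⁻ x, liminf (fun n => ENNReal.ofReal (F n x)) atTop ∂μ := by
        refine lintegral_congr_ae ?_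
        filter_upwards [hl] with x hx
        exact ((ENNReal.continuous_ofReal.tendsto _).comp hx).liminf_eq.symm
    _ ≤ liminf (fun n => ∫⁻ x, ENNReal.ofReal (F n x) ∂μ) atTop :=
        lintegral_liminf_le' fun n => (hi n).aemeasurable.ennreal_ofReal
    _ ≤ ENNReal.ofReal C := by
        refine liminf_le_of_frequently_le' (Frequently.of_forall fun n => ?_)
        rw [← ofReal_integral_eq_lintegral_ofReal (hi n) (hp n)]
        exact ENNReal.ofReal_le_ofReal (hC n)

theorem lip_ball {P : ℂ → ℂ} (hP : Differentiable ℂ P) (R : ℝ) :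
    ∃ L : ℝ, 0 ≤ L ∧ (∀ z ∈ Metric.closedBall (0 : ℂ) R, ‖P z‖ ≤ L) ∧
      ∀ z ∈ Metric.closedBall (0 : ℂ) R, ∀ w ∈ Metric.closedBall (0 : ℂ) R,
        ‖P w - P z‖ ≤ L * ‖w - z‖ := by
  obtain ⟨A, hA⟩ := (isCompact_closedBall (0 : ℂ) R).exists_bound_of_continuousOn
    hP.continuous.continuousOn
  obtain ⟨B, hB⟩ := (isCompact_closedBall (0 : ℂ) R).exists_bound_of_continuousOn
    ((hP.contDiff (n := 1)).continuous_deriv le_rfl).continuousOn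
  refine ⟨max 0 (max A B), le_max_left _ _,
    fun z hz => (hA z hz).trans ((le_max_left _ _).trans (le_max_right _ _)), ?_⟩
  intro z hz w hw
  exact (convex_closedBall (0 : ℂ) R).norm_image_sub_le_of_norm_deriv_le
    (fun x _ => hP x) (fun x hx => (hB x hx).trans ((le_max_right _ _).trans (le_max_right _ _)))
    hz hw

section kern

variable {a b : ℝ} {p q r s : ℝ → ℝ} {φ φq : ℂ → ℝ → ℂ} {c : ℝ}

theorem K_bdd_nonreal (hyp : SLHyp a b p q r s) (hφ : RealEntireSolFam a b p q r s φ φq)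
    (hc : c ∈ Ioo a b) (R : ℝ) : ∃ C : ℝ, ∀ z : ℂ, ‖z‖ ≤ R → z.im ≠ 0 →
      ∫ t in Ioo a c, ‖φ z t‖ ^ 2 * r t ≤ C := by
  obtain ⟨A, hA0, hA, hA'⟩ := lip_ball (hφ.entire c hc).1 R
  obtain ⟨B, hB0, hB, hB'⟩ := lip_ball (hφ.entire c hc).2 R
  refine ⟨2 * (A * B), fun z hz him => ?_⟩
  have h1 := wr_conj hyp hφ z hc
  have hz1 : z ∈ Metric.closedBall (0 : ℂ) R := by simpa using hz
  have hz2 : conj z ∈ Metric.closedBall (0 : ℂ) R := by simpa using hz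
  have h2 : φ z c * conj (φq z c) - φq z c * conj (φ z c) =
      φ z c * (φq (conj z) c - φq z c) - φq z c * (φ (conj z) c - φ z c) := by
    rw [(hφ.real z c hc).1, (hφ.real z c hc).2]
    ring
  have hd : ‖conj z - z‖ = 2 * |z.im| := by
    rw [norm_sub_rev, Complex.sub_conj]
    simp
  have h3 : ‖φ z c * (φq (conj z) c - φq z c) - φq z c * (φ (conj z) c - φ z c)‖ ≤
      A * (B * (2 * |z.im|)) + B * (A * (2 * |z.im|)) := by
    refine (norm_sub_le _ _).trans ?_
    rw [norm_mul, norm_mul, ← hd]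
    gcongr
    · exact hA z hz1
    · exact hB' z hz1 _ hz2
    · exact hB z hz1
    · exact hA' z hz1 _ hz2
  rw [← h2, h1, norm_mul, norm_mul, norm_mul, Complex.norm_I, Complex.norm_real, Complex.norm_real,
    Real.norm_eq_abs, Real.norm_eq_abs, abs_of_pos (K_pos hyp hφ z hc)] at h3
  have hp : 0 < |z.im| := abs_pos.2 him
  simp only [Complex.norm_ofNat, mul_one] at h3
  refine le_of_mul_le_mul_left ?_ (mul_pos two_pos hp)
  linarith

theorem K_bdd (hyp : SLHyp a b p q r s) (hφ : RealEntireSolFam a b p q r s φ φq)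
    (hc : c ∈ Ioo a b) (R : ℝ) : ∃ C : ℝ, ∀ z : ℂ, ‖z‖ ≤ R →
      ∫ t in Ioo a c, ‖φ z t‖ ^ 2 * r t ≤ C := by
  obtain ⟨C, hC⟩ := K_bdd_nonreal hyp hφ hc (R + 1)
  refine ⟨C, fun z hz => ?_⟩
  by_cases him : z.im = 0
  · have hpos : ∀ w : ℂ, 0 ≤ᵐ[volume.restrict (Ioo a c)] fun t => ‖φ w t‖ ^ 2 * r t := by
      intro w
      filter_upwards [rpos_sub hyp hc.2.le] with t ht
      simp only [Pi.zero_apply]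
      positivity
    refine fatou_real (F := fun n : ℕ => fun t => ‖φ (z + ((1 / ((n : ℝ) + 1) : ℝ) : ℂ) * I) t‖ ^ 2 * r t)
      (fun n => hφ.sqint _ c hc) (fun n => hpos _) (fun n => hC _ ?_ ?_) (hφ.sqint _ c hc) (hpos _) ?_
    · refine (norm_add_le _ _).trans ?_
      rw [norm_mul, Complex.norm_I, mul_one, Complex.norm_real, Real.norm_eq_abs,
        abs_of_pos (by positivity)]
      have : 1 / ((n : ℝ) + 1) ≤ 1 := by
        rw [div_le_one (by positivity)]
        have : (0 : ℝ) ≤ n := Nat.cast_nonneg n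
        linarith
      linarith
    · simp only [add_im, mul_im, ofReal_re, I_im, mul_one, ofReal_im, I_re, mul_zero, add_zero, him,
        zero_add]
      positivity
    · rw [ae_restrict_iff' measurableSet_Ioo]
      refine Eventually.of_forall fun t ht => ?_
      have hcont : Continuous fun w => ‖φ w t‖ ^ 2 * r t :=
        ((hφ.entire t ⟨ht.1, ht.2.trans hc.2⟩).1.continuous.norm.pow 2).mul continuous_const
      have h1 : Tendsto (fun n : ℕ => z + ((1 / ((n : ℝ) + 1) : ℝ) : ℂ) * I) atTop (𝓝 z) := by
        have := (Complex.continuous_ofReal.tendsto 0).comp tendsto_one_div_add_atTop_nhds_zero_nat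
        have h2 := (this.mul_const I).const_add z
        simpa using h2
      exact (hcont.tendsto z).comp h1
  · exact hC z (by linarith) him

/-- the kernel vectors -/
theorem phi_memLp (hyp : SLHyp a b p q r s) (hφ : RealEntireSolFam a b p q r s φ φq)
    (hc : c ∈ Ioo a b) (z : ℂ) :
    MemLp (fun x => φ z x * (√(r x) : ℂ)) 2 (volume.restrict (Ioo a c)) := by
  have hm : AEStronglyMeasurable (fun x => φ z x * (√(r x) : ℂ)) (volume.restrict (Ioo a c)) :=
    (phi_aesm hφ z hc.2.le).mul
      (Complex.measurable_ofReal.comp hyp.mr.sqrt).aestronglyMeasurable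
  rw [memLp_two_iff_integrable_sq_norm hm]
  refine (hφ.sqint z c hc).congr ?_
  filter_upwards [rpos_sub hyp hc.2.le] with t ht
  rw [norm_mul, mul_pow, Complex.norm_real, Real.norm_eq_abs, sq_abs, Real.sq_sqrt ht.le]

theorem tr_diff (hyp : SLHyp a b p q r s) (hφ : RealEntireSolFam a b p q r s φ φq)
    (hc : c ∈ Ioo a b) {f : ℝ → ℂ} (hf : MemLp f 2 (volume.restrict (Ioo a c))) :
    Differentiable ℂ fun z => ∫ x in Ioo a c, φ z x * (√(r x) : ℂ) * f x := by
  obtain ⟨g, hgm, hg⟩ := hf.1.aemeasurable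
  have hgL : MemLp g 2 (volume.restrict (Ioo a c)) := hf.ae_eq hg
  have hsub : Ioo a c ⊆ Ioo a b := Ioo_subset_Ioo_right hc.2.le
  set F : ℂ → ℝ → ℂ := fun z x => (Ioo a c).indicator (φ z) x * (√(r x) : ℂ) * g x with hF
  have hFe : ∀ z, (fun x => φ z x * (√(r x) : ℂ) * f x) =ᵐ[volume.restrict (Ioo a c)] F z := by
    intro z
    filter_upwards [hg, ae_restrict_mem measurableSet_Ioo] with x hx hxm
    simp only [hF, indicator_of_mem hxm, hx]
  have e : (fun z => ∫ x in Ioo a c, φ z x * (√(r x) : ℂ) * f x) =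
      fun z => ∫ x, F z x ∂(volume.restrict (Ioo a c)) := by
    funext z
    exact integral_congr_ae (hFe z)
  rw [e, ← differentiableOn_univ]
  refine differentiableOn_integral ?_ ?_ ?_
  · intro z _
    refine ((Measurable.mul ?_ (Complex.measurable_ofReal.comp hyp.mr.sqrt)).mul hgm)
    have := (((phi_contOn hφ z).mono hsub).measurable_piecewise (g := fun _ => 0)
      continuousOn_const measurableSet_Ioo)
    change Measurable ((Ioo a c).piecewise (φ z) 0) at this
    rwa [piecewise_eq_indicator] at this
  · intro x
    by_cases hx : x ∈ Ioo a c
    · simp only [hF, indicator_of_mem hx]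
      exact (((hφ.entire x (hsub hx)).1.mul_const _).mul_const _).differentiableOn
    · simp only [hF, indicator_of_notMem hx, zero_mul]
      exact differentiableOn_const _
  · intro z₀ _
    obtain ⟨C, hC⟩ := K_bdd hyp hφ hc (‖z₀‖ + 1)
    refine ⟨1, one_pos, C + ∫ x in Ioo a c, ‖g x‖ ^ 2, subset_univ _, fun z hz => ?_⟩
    have hK := hC z (by
      have h1 := mem_closedBall_iff_norm.1 hz
      have := norm_sub_norm_le z z₀
      linarith)
    have hg2 := (memLp_two_iff_integrable_sq_norm hgL.1).1 hgL
    have hi : Integrable (F z) (volume.restrict (Ioo a c)) := by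
      refine Integrable.congr ?_ (hFe z)
      exact L2_mul_integrable (phi_memLp hyp hφ hc z) hf
    refine ⟨hi, ?_⟩
    calc ∫ x, ‖F z x‖ ∂(volume.restrict (Ioo a c)) ≤
        ∫ x in Ioo a c, (‖φ z x‖ ^ 2 * r x + ‖g x‖ ^ 2) := by
          refine integral_mono_ae hi.norm ((hφ.sqint z c hc).add hg2) ?_
          filter_upwards [rpos_sub hyp hc.2.le, ae_restrict_mem measurableSet_Ioo] with x hx hxm
          simp only [hF, indicator_of_mem hxm]
          rw [norm_mul, norm_mul, Complex.norm_real, Real.norm_eq_abs, abs_of_nonneg (Real.sqrt_nonneg _)]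
          have := Real.sq_sqrt hx.le
          nlinarith [sq_nonneg (‖φ z x‖ * √(r x) - ‖g x‖), sq_nonneg (‖φ z x‖ * √(r x)), sq_nonneg ‖g x‖]
      _ = (∫ x in Ioo a c, ‖φ z x‖ ^ 2 * r x) + ∫ x in Ioo a c, ‖g x‖ ^ 2 :=
          integral_add (hφ.sqint z c hc) hg2
      _ ≤ _ := by gcongr

end kern


/-! ### Reproducing formulas -/

section repro

variable {a b : ℝ} {p q r s : ℝ → ℝ} {φ φq : ℂ → ℝ → ℂ} {c : ℝ}

theorem dBK_sqrt (hyp : SLHyp a b p q r s) (hφ : RealEntireSolFam a b p q r s φ φq)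
    (hc : c ∈ Ioo a b) (w z : ℂ) : dBK a c r φ w z =
      ∫ x in Ioo a c, φ z x * (√(r x) : ℂ) * (φ (conj w) x * (√(r x) : ℂ)) := by
  refine integral_congr_ae ?_
  filter_upwards [rpos_sub hyp hc.2.le, ae_restrict_mem measurableSet_Ioo] with x hx hxm
  rw [(hφ.real w x ⟨hxm.1, hxm.2.trans hc.2⟩).1]
  have : (r x : ℂ) = (√(r x) : ℂ) * (√(r x) : ℂ) := by
    exact_mod_cast (Real.mul_self_sqrt hx.le).symm
  rw [this]
  ring

theorem dBK_diff (hyp : SLHyp a b p q r s) (hφ : RealEntireSolFam a b p q r s φ φq)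
    (hc : c ∈ Ioo a b) (w : ℂ) : Differentiable ℂ (dBK a c r φ w) := by
  rw [funext (dBK_sqrt hyp hφ hc w)]
  exact tr_diff hyp hφ hc (phi_memLp hyp hφ hc (conj w))

theorem dBK_conj (hφ : RealEntireSolFam a b p q r s φ φq)
    (hc : c ∈ Ioo a b) (w z : ℂ) : conj (dBK a c r φ w z) = dBK a c r φ (conj w) (conj z) := by
  rw [dBK, dBK, ← integral_conj]
  refine setIntegral_congr_fun measurableSet_Ioo fun x hx => ?_
  have hx' : x ∈ Ioo a b := ⟨hx.1, hx.2.trans hc.2⟩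
  simp only [(hφ.real w x hx').1, (hφ.real z x hx').1, map_mul, conj_conj, conj_ofReal]

theorem E_real_ne (hyp : SLHyp a b p q r s) (hφ : RealEntireSolFam a b p q r s φ φq)
    (hc : c ∈ Ioo a b) (t : ℝ) : dBE φ φq c t ≠ 0 := dBE_ne hyp hφ hc (by simp)

theorem E_real_cont (hφ : RealEntireSolFam a b p q r s φ φq)
    (hc : c ∈ Ioo a b) : Continuous fun t : ℝ => dBE φ φq c t :=
  (dBE_diff hφ hc).continuous.comp Complex.continuous_ofReal

theorem KE_decay (hyp : SLHyp a b p q r s) (hφ : RealEntireSolFam a b p q r s φ φq)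
    (hc : c ∈ Ioo a b) (w : ℂ) : ∃ C R₀ : ℝ, ∀ z : ℂ, 0 ≤ z.im → R₀ ≤ ‖z‖ →
      ‖dBK a c r φ w z / dBE φ φq c z‖ ≤ C / ‖z‖ := by
  refine ⟨‖dBE φ φq c w‖ + ‖dBE φ φq c (conj w)‖, 2 * ‖w‖ + 1, fun z hz hzn => ?_⟩
  have hE := norm_pos_iff.2 (dBE_ne hyp hφ hc hz)
  have hz0 : 0 < ‖z‖ := by
    have := norm_nonneg w
    linarith
  have h1 := congrArg norm (dBK_eq hyp hφ hc w z)
  have h2 := dBE_sharp_le hyp hφ hc hz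
  rw [norm_mul, norm_mul] at h1
  have h3 : ‖dBE φ φq c z * conj (dBE φ φq c w) - conj (dBE φ φq c (conj z)) * dBE φ φq c (conj w)‖ ≤
      ‖dBE φ φq c z‖ * ‖dBE φ φq c w‖ + ‖dBE φ φq c z‖ * ‖dBE φ φq c (conj w)‖ := by
    refine (norm_sub_le _ _).trans ?_
    rw [norm_mul, norm_mul, RCLike.norm_conj (dBE φ φq c w)]
    gcongr
  have h4 : ‖z‖ / 2 ≤ ‖z - conj w‖ := by
    have := norm_sub_norm_le z (conj w)
    rw [RCLike.norm_conj] at this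
    linarith
  have h5 : ‖I / 2‖ = 1 / 2 := by simp
  rw [h5] at h1
  rw [norm_div, div_le_div_iff₀ hE hz0]
  have h6 : ‖z‖ / 2 * ‖dBK a c r φ w z‖ ≤ ‖z - conj w‖ * ‖dBK a c r φ w z‖ := by gcongr
  nlinarith

theorem conjKE (hyp : SLHyp a b p q r s) (hφ : RealEntireSolFam a b p q r s φ φq)
    (hc : c ∈ Ioo a b) {η : ℂ} (hη : 0 < η.im) (t : ℝ) :
    conj (dBK a c r φ η t / dBE φ φq c t) = -I / 2 * (dBE φ φq c η / (t - η) -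
      conj (dBE φ φq c (conj η)) * (dBE φ φq c t / conj (dBE φ φq c t) / (t - η))) := by
  have h := congrArg conj (dBK_eq hyp hφ hc η t)
  have h1 : (t : ℂ) - η ≠ 0 := real_sub_ne hη.ne' t
  have h2 : conj (dBE φ φq c t) ≠ 0 := by simpa using E_real_ne hyp hφ hc t
  simp only [map_mul, map_sub, map_div₀, conj_conj, conj_ofReal, conj_I, map_ofNat] at h ⊢
  field_simp
  field_simp at h
  linear_combination h

theorem memLp_unimod {N : ℝ → ℂ} {u : ℝ → ℂ} (hN : MemLp N 2) (hu : Continuous u) (h1 : ∀ t, ‖u t‖ = 1) :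
    MemLp (fun t => u t * N t) 2 := by
  refine hN.of_le (hu.aestronglyMeasurable.mul hN.1) (Eventually.of_forall fun t => ?_)
  rw [norm_mul, h1, one_mul]

theorem Eu_cont (hyp : SLHyp a b p q r s) (hφ : RealEntireSolFam a b p q r s φ φq)
    (hc : c ∈ Ioo a b) : Continuous fun t : ℝ => dBE φ φq c t / conj (dBE φ φq c t) :=
  (E_real_cont hφ hc).div (Complex.continuous_conj.comp (E_real_cont hφ hc)) fun t => by
    simpa using E_real_ne hyp hφ hc t

theorem Eu_norm (hyp : SLHyp a b p q r s) (hφ : RealEntireSolFam a b p q r s φ φq)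
    (hc : c ∈ Ioo a b) (t : ℝ) : ‖dBE φ φq c t / conj (dBE φ φq c t)‖ = 1 := by
  rw [norm_div, RCLike.norm_conj, div_self]
  exact norm_ne_zero_iff.2 (E_real_ne hyp hφ hc t)

theorem repro_formula (hyp : SLHyp a b p q r s) (hφ : RealEntireSolFam a b p q r s φ φq)
    (hc : c ∈ Ioo a b) {η : ℂ} (hη : 0 < η.im) {N : ℝ → ℂ} (hN : MemLp N 2) :
    ∫ t : ℝ, N t * conj (dBK a c r φ η t / dBE φ φq c t) = -I / 2 * (dBE φ φq c η *
      (∫ t : ℝ, N t / (t - η)) - conj (dBE φ φq c (conj η)) *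
      ∫ t : ℝ, (dBE φ φq c t / conj (dBE φ φq c t) * N t) / (t - η)) := by
  have hL := memLp_inv_sub hη.ne'
  have i1 : Integrable fun t : ℝ => N t / (t - η) := by
    simpa only [div_eq_mul_inv] using L2_mul_integrable hN hL
  have i2 : Integrable fun t : ℝ => (dBE φ φq c t / conj (dBE φ φq c t) * N t) / (t - η) := by
    simpa only [div_eq_mul_inv] using
      L2_mul_integrable (memLp_unimod hN (Eu_cont hyp hφ hc) (Eu_norm hyp hφ hc)) hL
  rw [← integral_const_mul, ← integral_const_mul, ← integral_sub (i1.const_mul _) (i2.const_mul _),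
    ← integral_const_mul]
  congr 1
  funext t
  rw [conjKE hyp hφ hc hη]
  ring

theorem repro (hyp : SLHyp a b p q r s) (hφ : RealEntireSolFam a b p q r s φ φq)
    (hc : c ∈ Ioo a b) {η : ℂ} (hη : 0 < η.im) {F : ℂ → ℂ}
    (hN : MemLp (fun t : ℝ => F t / dBE φ φq c t) 2)
    (h1 : ∫ t : ℝ, F t / dBE φ φq c t / (t - η) = 2 * Real.pi * I * (F η / dBE φ φq c η))
    (h2 : ∫ t : ℝ, conj (F t) / dBE φ φq c t / (t - conj η) = 0) :
    ∫ t : ℝ, F t / dBE φ φq c t * conj (dBK a c r φ η t / dBE φ φq c t) = Real.pi * F η := by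
  rw [repro_formula hyp hφ hc hη hN, h1]
  have h3 : ∫ t : ℝ, (dBE φ φq c t / conj (dBE φ φq c t) * (F t / dBE φ φq c t)) / (t - η) = 0 := by
    have := congrArg conj h2
    rw [← integral_conj, map_zero] at this
    rw [← this]
    congr 1
    funext t
    have e := E_real_ne hyp hφ hc t
    simp only [map_div₀, map_sub, conj_conj, conj_ofReal]
    congr 1
    field_simp
  rw [h3]
  have e := dBE_ne hyp hφ hc hη.le
  field_simp
  linear_combination (-2 * Real.pi * F η) * I_sq

theorem KE_cont (hyp : SLHyp a b p q r s) (hφ : RealEntireSolFam a b p q r s φ φq)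
    (hc : c ∈ Ioo a b) {F : ℂ → ℂ} (hF : Differentiable ℂ F) :
    DifferentiableOn ℂ (fun z => F z / dBE φ φq c z) {z | 0 < z.im} ∧
    ContinuousOn (fun z => F z / dBE φ φq c z) {z | 0 ≤ z.im} :=
  ⟨hF.differentiableOn.div (dBE_diff hφ hc).differentiableOn fun z hz =>
      dBE_ne hyp hφ hc (le_of_lt hz),
    hF.continuous.continuousOn.div (dBE_diff hφ hc).continuous.continuousOn fun z hz =>
      dBE_ne hyp hφ hc hz⟩

theorem KE_memLp (hyp : SLHyp a b p q r s) (hφ : RealEntireSolFam a b p q r s φ φq)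
    (hc : c ∈ Ioo a b) (w : ℂ) : MemLp (fun t : ℝ => dBK a c r φ w t / dBE φ φq c t) 2 := by
  obtain ⟨C, R₀, h⟩ := KE_decay hyp hφ hc w
  exact memLp_of_decay (KE_cont hyp hφ hc (dBK_diff hyp hφ hc w)).2 h

theorem gram (hyp : SLHyp a b p q r s) (hφ : RealEntireSolFam a b p q r s φ φq)
    (hc : c ∈ Ioo a b) {η : ℂ} (hη : 0 < η.im) (w : ℂ) :
    ∫ t : ℝ, dBK a c r φ w t / dBE φ φq c t * conj (dBK a c r φ η t / dBE φ φq c t) =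
      Real.pi * dBK a c r φ w η := by
  obtain ⟨C, R₀, h⟩ := KE_decay hyp hφ hc w
  obtain ⟨C', R₀', h'⟩ := KE_decay hyp hφ hc (conj w)
  have d := KE_cont hyp hφ hc (dBK_diff hyp hφ hc w)
  have d' := KE_cont hyp hφ hc (dBK_diff hyp hφ hc (conj w))
  refine repro hyp hφ hc hη (KE_memLp hyp hφ hc w) (cauchy_decay d.1 d.2 h hη) ?_
  simp only [dBK_conj hφ hc, conj_ofReal]
  exact cauchy_decay_conj d'.1 d'.2 h' hη

end repro


/-! ### Extension of isometries given by pointwise formulas -/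

theorem inner_toLp {α : Type*} [MeasurableSpace α] {μ : Measure α} {f g : α → ℂ}
    (hf : MemLp f 2 μ) (hg : MemLp g 2 μ) :
    inner ℂ (hf.toLp f) (hg.toLp g) = ∫ x, conj (f x) * g x ∂μ := by
  rw [L2.inner_def]
  refine integral_congr_ae ?_
  filter_upwards [hf.coeFn_toLp, hg.coeFn_toLp] with x h1 h2
  rw [h1, h2, RCLike.inner_apply, mul_comm]

theorem iso_span {H : Type*} [NormedAddCommGroup H] [InnerProductSpace ℂ H]
    (J : H →ₗ[ℂ] (ℝ → ℂ)) {ι : Type*} (k : ι → H) (hL : ∀ i, MemLp (J (k i)) 2)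
    (hG : ∀ i j, ∫ t, J (k i) t * conj (J (k j) t) = inner ℂ (k j) (k i)) {f : H}
    (hf : f ∈ Submodule.span ℂ (range k)) :
    eLpNorm (J f) 2 volume = ‖f‖ₑ := by
  have hM : ∀ f ∈ Submodule.span ℂ (range k), MemLp (J f) 2 := by
    intro f hf
    induction hf using Submodule.span_induction with
    | mem x hx =>
      obtain ⟨i, rfl⟩ := hx
      exact hL i
    | zero => rw [map_zero]; exact MemLp.zero
    | add x y _ _ hx hy => rw [map_add]; exact hx.add hy
    | smul z x _ hx => rw [map_smul]; exact hx.const_smul z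
  have hmi : ∀ {u v : ℝ → ℂ}, MemLp u 2 → MemLp v 2 → Integrable fun t => u t * conj (v t) := by
    intro u v hu hv
    exact L2_mul_integrable hu hv.star
  have h1 : ∀ f ∈ Submodule.span ℂ (range k), ∀ j,
      ∫ t, J f t * conj (J (k j) t) = inner ℂ (k j) f := by
    intro f hf j
    induction hf using Submodule.span_induction with
    | mem x hx =>
      obtain ⟨i, rfl⟩ := hx
      exact hG i j
    | zero => simp
    | add x y hx' hy' hx hy =>
      rw [map_add, inner_add_right, ← hx, ← hy,
        ← integral_add (hmi (hM x hx') (hL j)) (hmi (hM y hy') (hL j))]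
      simp only [Pi.add_apply, add_mul]
    | smul z x _ hx =>
      rw [map_smul, inner_smul_right, ← hx, ← integral_const_mul]
      simp only [Pi.smul_apply, smul_eq_mul, mul_assoc]
  have h2 : ∀ g ∈ Submodule.span ℂ (range k),
      ∫ t, J f t * conj (J g t) = inner ℂ g f := by
    intro g hg
    induction hg using Submodule.span_induction with
    | mem x hx =>
      obtain ⟨i, rfl⟩ := hx
      exact h1 f hf i
    | zero => simp
    | add x y hx' hy' hx hy =>
      rw [map_add, inner_add_left, ← hx, ← hy,
        ← integral_add (hmi (hM f hf) (hM x hx')) (hmi (hM f hf) (hM y hy'))]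
      simp only [Pi.add_apply, map_add, mul_add]
    | smul z x _ hx =>
      rw [map_smul, inner_smul_left, ← hx, ← integral_const_mul]
      simp only [Pi.smul_apply, smul_eq_mul, map_mul]
      congr 1
      funext t
      ring
  have h3 := inner_toLp (hM f hf) (hM f hf)
  simp only [mul_comm (conj _) _] at h3
  rw [h2 f hf, inner_self_eq_norm_sq_to_K, inner_self_eq_norm_sq_to_K] at h3
  have h4 : ‖(hM f hf).toLp (J f)‖ ^ 2 = ‖f‖ ^ 2 := by exact_mod_cast h3
  have h5 := (sq_eq_sq₀ (norm_nonneg _) (norm_nonneg _)).1 h4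
  rw [Lp.norm_toLp] at h5
  rw [← ofReal_norm, ← h5, ENNReal.ofReal_toReal (hM f hf).2.ne]

theorem iso_ext {H : Type*} [NormedAddCommGroup H] [InnerProductSpace ℂ H]
    (J : H →ₗ[ℂ] (ℝ → ℂ)) (hm : ∀ f, AEStronglyMeasurable (J f) volume)
    (hcont : ∀ t, Continuous fun f => J f t) {ι : Type*} (k : ι → H)
    (hd : Dense (Submodule.span ℂ (range k) : Set H)) (hL : ∀ i, MemLp (J (k i)) 2)
    (hG : ∀ i j, ∫ t, J (k i) t * conj (J (k j) t) = inner ℂ (k j) (k i)) (f : H) :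
    eLpNorm (J f) 2 volume = ‖f‖ₑ := by
  have hle : ∀ f, eLpNorm (J f) 2 volume ≤ ‖f‖ₑ := by
    intro f
    obtain ⟨u, hu, hlim⟩ := mem_closure_iff_seq_limit.1 (hd f)
    have h1 := Lp.eLpNorm_lim_le_liminf_eLpNorm (p := 2) (fun n => hm (u n)) (J f)
      (Eventually.of_forall fun t => ((hcont t).tendsto f).comp hlim)
    refine h1.trans (le_of_eq ?_)
    have h2 : Tendsto (fun n => eLpNorm (J (u n)) 2 volume) atTop (𝓝 ‖f‖ₑ) := by
      simp only [fun n => iso_span J k hL hG (hu n)]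
      exact (continuous_enorm.tendsto f).comp hlim
    exact h2.liminf_eq
  refine le_antisymm (hle f) ?_
  obtain ⟨u, hu, hlim⟩ := mem_closure_iff_seq_limit.1 (hd f)
  have h1 : ∀ n, ‖u n‖ₑ ≤ eLpNorm (J f) 2 volume + ‖u n - f‖ₑ := by
    intro n
    rw [← iso_span J k hL hG (hu n)]
    have e : J (u n) = J f + J (u n - f) := by rw [← map_add, add_sub_cancel]
    conv_lhs => rw [e]
    refine (eLpNorm_add_le (hm _) (hm _) (by norm_num)).trans ?_
    gcongr
    exact hle _
  have h2 : Tendsto (fun n => ‖u n‖ₑ) atTop (𝓝 ‖f‖ₑ) := (continuous_enorm.tendsto f).comp hlim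
  have h3 : Tendsto (fun n => eLpNorm (J f) 2 volume + ‖u n - f‖ₑ) atTop
      (𝓝 (eLpNorm (J f) 2 volume + 0)) := by
    refine Tendsto.const_add _ ?_
    have := (continuous_enorm.tendsto (f - f)).comp (hlim.sub_const f)
    simpa [Function.comp_def] using this
  rw [add_zero] at h3
  exact le_of_tendsto_of_tendsto' h2 h3 h1


/-! ### The transform on `L²` -/

section trans

variable {a b : ℝ} {p q r s : ℝ → ℝ} {φ φq : ℂ → ℝ → ℂ} {c : ℝ}

/-- Kernel vectors. -/
def kv (hyp : SLHyp a b p q r s) (hφ : RealEntireSolFam a b p q r s φ φq)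
    (hc : c ∈ Ioo a b) (z : ℂ) : Lp ℂ 2 (volume.restrict (Ioo a c)) :=
  (phi_memLp hyp hφ hc (conj z)).toLp _

theorem inner_kv_toLp (hyp : SLHyp a b p q r s) (hφ : RealEntireSolFam a b p q r s φ φq)
    (hc : c ∈ Ioo a b) (z : ℂ) {f : ℝ → ℂ} (hf : MemLp f 2 (volume.restrict (Ioo a c))) :
    inner ℂ (kv hyp hφ hc z) (hf.toLp f) = ∫ x in Ioo a c, φ z x * (√(r x) : ℂ) * f x := by
  rw [kv, inner_toLp]
  refine setIntegral_congr_fun measurableSet_Ioo fun x hx => ?_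
  simp only [map_mul, conj_ofReal, (hφ.real z x ⟨hx.1, hx.2.trans hc.2⟩).1, conj_conj]

theorem inner_kv (hyp : SLHyp a b p q r s) (hφ : RealEntireSolFam a b p q r s φ φq)
    (hc : c ∈ Ioo a b) (z : ℂ) (F : Lp ℂ 2 (volume.restrict (Ioo a c))) :
    inner ℂ (kv hyp hφ hc z) F = ∫ x in Ioo a c, φ z x * (√(r x) : ℂ) * F x := by
  conv_lhs => rw [← Lp.toLp_coeFn F (Lp.memLp F)]
  exact inner_kv_toLp hyp hφ hc z (Lp.memLp F)

theorem inner_kv_kv (hyp : SLHyp a b p q r s) (hφ : RealEntireSolFam a b p q r s φ φq)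
    (hc : c ∈ Ioo a b) (z w : ℂ) :
    inner ℂ (kv hyp hφ hc z) (kv hyp hφ hc w) = dBK a c r φ w z := by
  rw [dBK_sqrt hyp hφ hc]
  exact inner_kv_toLp hyp hφ hc z _

theorem inner_kv_diff (hyp : SLHyp a b p q r s) (hφ : RealEntireSolFam a b p q r s φ φq)
    (hc : c ∈ Ioo a b) (F : Lp ℂ 2 (volume.restrict (Ioo a c))) :
    Differentiable ℂ fun z => inner ℂ (kv hyp hφ hc z) F := by
  rw [funext fun z => inner_kv hyp hφ hc z F]
  exact tr_diff hyp hφ hc (Lp.memLp F)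

theorem kv_norm_sq (hyp : SLHyp a b p q r s) (hφ : RealEntireSolFam a b p q r s φ φq)
    (hc : c ∈ Ioo a b) (z : ℂ) :
    ‖kv hyp hφ hc z‖ ^ 2 = ∫ t in Ioo a c, ‖φ z t‖ ^ 2 * r t := by
  have h1 := inner_kv_kv hyp hφ hc z z
  rw [inner_self_eq_norm_sq_to_K, dBK] at h1
  have h2 : ∫ x in Ioo a c, φ z x * conj (φ z x) * (r x : ℂ) =
      ((∫ t in Ioo a c, ‖φ z t‖ ^ 2 * r t : ℝ) : ℂ) := by
    rw [← integral_complex_ofReal]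
    congr 1
    funext x
    rw [Complex.mul_conj, Complex.normSq_eq_norm_sq]
    push_cast
    rfl
  rw [h2] at h1
  refine Complex.ofReal_injective ?_
  push_cast
  exact h1

/-- From `L²` to functions. -/
theorem exists_fun (hyp : SLHyp a b p q r s) (hφ : RealEntireSolFam a b p q r s φ φq)
    (hc : c ∈ Ioo a b) (F : Lp ℂ 2 (volume.restrict (Ioo a c))) :
    ∃ f : ℝ → ℂ, AEStronglyMeasurable f volume ∧ (∀ x, x ∉ Ioo a c → f x = 0) ∧
      IntegrableOn (fun x => ‖f x‖ ^ 2 * r x) (Ioo a b) ∧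
      (∀ z, ∫ x in Ioo a c, φ z x * f x * (r x : ℂ) = inner ℂ (kv hyp hφ hc z) F) ∧
      (∀ᵐ x ∂(volume.restrict (Ioo a c)), F x = f x * (√(r x) : ℂ)) := by
  set f : ℝ → ℂ := (Ioo a c).indicator fun x => F x / (√(r x) : ℂ) with hf
  have hz : ∀ x, x ∉ Ioo a c → f x = 0 := fun x hx => indicator_of_notMem hx _
  have hpos := rpos_sub hyp hc.2.le
  have hFf : ∀ᵐ x ∂(volume.restrict (Ioo a c)), F x = f x * (√(r x) : ℂ) := by
    filter_upwards [hpos, ae_restrict_mem measurableSet_Ioo] with x hx hxm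
    have : (√(r x) : ℂ) ≠ 0 := by exact_mod_cast (Real.sqrt_pos.2 hx).ne'
    rw [hf, indicator_of_mem hxm, div_mul_cancel₀ _ this]
  refine ⟨f, ?_, hz, ?_, ?_, hFf⟩
  · rw [hf, aestronglyMeasurable_indicator_iff measurableSet_Ioo]
    exact (Lp.aestronglyMeasurable F).div₀
      (Complex.measurable_ofReal.comp hyp.mr.sqrt).aestronglyMeasurable
  · have h1 : IntegrableOn (fun x => ‖f x‖ ^ 2 * r x) (Ioo a c) := by
      refine ((memLp_two_iff_integrable_sq_norm (Lp.aestronglyMeasurable F)).1 (Lp.memLp F)).congr ?_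
      filter_upwards [hFf, hpos] with x hx hxp
      rw [hx, norm_mul, mul_pow, Complex.norm_real, Real.norm_eq_abs, sq_abs, Real.sq_sqrt hxp.le]
    have h2 := (integrable_indicator_iff measurableSet_Ioo).2 h1
    refine (h2.congr (Eventually.of_forall fun x => ?_)).integrableOn
    by_cases hx : x ∈ Ioo a c
    · simp only [indicator_of_mem hx]
    · simp [indicator_of_notMem hx, hz x hx]
  · intro z
    rw [inner_kv hyp hφ hc]
    refine integral_congr_ae ?_
    filter_upwards [hFf, hpos] with x hx hxp
    have : (r x : ℂ) = (√(r x) : ℂ) * (√(r x) : ℂ) := by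
      exact_mod_cast (Real.mul_self_sqrt hxp.le).symm
    rw [hx, this]
    ring

theorem entire_eq {F G : ℂ → ℂ} (hF : Differentiable ℂ F) (hG : Differentiable ℂ G)
    (h : ∀ z : ℂ, 0 < z.im → F z = G z) : F = G := by
  refine AnalyticOnNhd.eq_of_eventuallyEq (z₀ := I) (fun z _ => hF.analyticAt z)
    (fun z _ => hG.analyticAt z) ?_
  filter_upwards [isOpen_uhp.mem_nhds (show I ∈ {z : ℂ | 0 < z.im} by simp)] with z hz
  exact h z hz

theorem kv_dense (hyp : SLHyp a b p q r s) (hφ : RealEntireSolFam a b p q r s φ φq)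
    (hc : c ∈ Ioo a b) : Dense (Submodule.span ℂ
      (range fun w : UHP => kv hyp hφ hc w) : Set (Lp ℂ 2 (volume.restrict (Ioo a c)))) := by
  rw [Submodule.dense_iff_topologicalClosure_eq_top, Submodule.topologicalClosure_eq_top_iff,
    Submodule.eq_bot_iff]
  intro F hF
  have h1 : ∀ z : ℂ, 0 < z.im → inner ℂ (kv hyp hφ hc z) F = 0 := fun z hz =>
    (Submodule.mem_orthogonal _ _).1 hF _ (Submodule.subset_span ⟨⟨z, hz⟩, rfl⟩)
  have h2 := entire_eq (inner_kv_diff hyp hφ hc F) (differentiable_const (0 : ℂ)) h1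
  obtain ⟨f, hfm, -, hf2, hfz, hFf⟩ := exists_fun hyp hφ hc F
  have h3 := complete_ae hyp hφ hc hfm hf2 fun z _ => (hfz z).trans (congrFun h2 z)
  rw [← ae_restrict_iff' measurableSet_Ioo] at h3
  rw [Lp.eq_zero_iff_ae_eq_zero]
  filter_upwards [h3, hFf] with x hx hx'
  rw [hx', hx, zero_mul, Pi.zero_apply]

/-- The transform, normalized. -/
def Jmap (hyp : SLHyp a b p q r s) (hφ : RealEntireSolFam a b p q r s φ φq)
    (hc : c ∈ Ioo a b) : Lp ℂ 2 (volume.restrict (Ioo a c)) →ₗ[ℂ] (ℝ → ℂ) where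
  toFun F t := inner ℂ (kv hyp hφ hc t) F / ((√Real.pi : ℂ) * dBE φ φq c t)
  map_add' F G := by
    funext t
    simp only [Pi.add_apply, inner_add_right, add_div]
  map_smul' k F := by
    funext t
    simp only [Pi.smul_apply, inner_smul_right, smul_eq_mul, RingHom.id_apply, mul_div_assoc]

theorem Jmap_apply (hyp : SLHyp a b p q r s) (hφ : RealEntireSolFam a b p q r s φ φq)
    (hc : c ∈ Ioo a b) (F : Lp ℂ 2 (volume.restrict (Ioo a c))) (t : ℝ) :
    Jmap hyp hφ hc F t = inner ℂ (kv hyp hφ hc t) F / ((√Real.pi : ℂ) * dBE φ φq c t) := rfl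

theorem sqrtpi_ne : (√Real.pi : ℂ) ≠ 0 := by
  exact_mod_cast (Real.sqrt_pos.2 Real.pi_pos).ne'

theorem sqrtpi_sq : (√Real.pi : ℂ) * (√Real.pi : ℂ) = Real.pi := by
  exact_mod_cast Real.mul_self_sqrt Real.pi_pos.le

theorem Jmap_cont (hyp : SLHyp a b p q r s) (hφ : RealEntireSolFam a b p q r s φ φq)
    (hc : c ∈ Ioo a b) (F : Lp ℂ 2 (volume.restrict (Ioo a c))) :
    Continuous (Jmap hyp hφ hc F) := by
  have h1 : Continuous fun t : ℝ => inner ℂ (kv hyp hφ hc t) F :=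
    (inner_kv_diff hyp hφ hc F).continuous.comp Complex.continuous_ofReal
  exact h1.div (continuous_const.mul (E_real_cont hφ hc)) fun t =>
    mul_ne_zero sqrtpi_ne (E_real_ne hyp hφ hc t)

theorem Jmap_kv (hyp : SLHyp a b p q r s) (hφ : RealEntireSolFam a b p q r s φ φq)
    (hc : c ∈ Ioo a b) (w : ℂ) (t : ℝ) : Jmap hyp hφ hc (kv hyp hφ hc w) t =
      (√Real.pi : ℂ)⁻¹ * (dBK a c r φ w t / dBE φ φq c t) := by
  rw [Jmap_apply, inner_kv_kv]
  have := E_real_ne hyp hφ hc t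
  have := sqrtpi_ne
  field_simp

theorem Jmap_kv_memLp (hyp : SLHyp a b p q r s) (hφ : RealEntireSolFam a b p q r s φ φq)
    (hc : c ∈ Ioo a b) (w : ℂ) : MemLp (Jmap hyp hφ hc (kv hyp hφ hc w)) 2 := by
  rw [funext (Jmap_kv hyp hφ hc w)]
  exact (KE_memLp hyp hφ hc w).const_mul _

theorem Jmap_iso (hyp : SLHyp a b p q r s) (hφ : RealEntireSolFam a b p q r s φ φq)
    (hc : c ∈ Ioo a b) (F : Lp ℂ 2 (volume.restrict (Ioo a c))) :
    eLpNorm (Jmap hyp hφ hc F) 2 volume = ‖F‖ₑ := by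
  refine iso_ext (Jmap hyp hφ hc) (fun F => (Jmap_cont hyp hφ hc F).aestronglyMeasurable) ?_
    (fun w : UHP => kv hyp hφ hc w) (kv_dense hyp hφ hc) (fun w => Jmap_kv_memLp hyp hφ hc w) ?_ F
  · intro t
    simp only [Jmap_apply]
    exact (continuous_const.inner continuous_id).div_const _
  · intro w η
    have h1 := gram hyp hφ hc (η := η) η.2 w
    rw [inner_kv_kv]
    have e : ∀ t : ℝ, Jmap hyp hφ hc (kv hyp hφ hc w) t * conj (Jmap hyp hφ hc (kv hyp hφ hc η) t) =
        (Real.pi : ℂ)⁻¹ * (dBK a c r φ w t / dBE φ φq c t *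
          conj (dBK a c r φ η t / dBE φ φq c t)) := by
      intro t
      rw [Jmap_kv, Jmap_kv, map_mul, map_inv₀, conj_ofReal, ← sqrtpi_sq, mul_inv]
      ring
    simp only [e]
    rw [integral_const_mul, h1, ← mul_assoc, inv_mul_cancel₀, one_mul]
    exact_mod_cast Real.pi_ne_zero

theorem Jmap_memLp (hyp : SLHyp a b p q r s) (hφ : RealEntireSolFam a b p q r s φ φq)
    (hc : c ∈ Ioo a b) (F : Lp ℂ 2 (volume.restrict (Ioo a c))) :
    MemLp (Jmap hyp hφ hc F) 2 :=
  ⟨(Jmap_cont hyp hφ hc F).aestronglyMeasurable, by rw [Jmap_iso]; exact enorm_lt_top⟩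

/-- The transform as a linear isometry into `L²(ℝ)`. -/
def Tmap (hyp : SLHyp a b p q r s) (hφ : RealEntireSolFam a b p q r s φ φq)
    (hc : c ∈ Ioo a b) : Lp ℂ 2 (volume.restrict (Ioo a c)) →ₗᵢ[ℂ] Lp ℂ 2 (volume : Measure ℝ) where
  toFun F := (Jmap_memLp hyp hφ hc F).toLp _
  map_add' F G := by
    rw [← MemLp.toLp_add]
    exact MemLp.toLp_congr _ _ (by rw [map_add])
  map_smul' k F := by
    rw [RingHom.id_apply, ← MemLp.toLp_const_smul]
    exact MemLp.toLp_congr _ _ (by rw [map_smul])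
  norm_map' F := by
    show ‖(Jmap_memLp hyp hφ hc F).toLp _‖ = ‖F‖
    rw [Lp.norm_toLp, Jmap_iso, toReal_enorm]

theorem Tmap_apply (hyp : SLHyp a b p q r s) (hφ : RealEntireSolFam a b p q r s φ φq)
    (hc : c ∈ Ioo a b) (F : Lp ℂ 2 (volume.restrict (Ioo a c))) :
    Tmap hyp hφ hc F = (Jmap_memLp hyp hφ hc F).toLp _ := rfl

end trans


section final

variable {a b c : ℝ} {p q r s : ℝ → ℝ} {φ φq : ℂ → ℝ → ℂ}

theorem fin_repro (hyp : SLHyp a b p q r s) (hφ : RealEntireSolFam a b p q r s φ φq)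
    (hc : c ∈ Ioo a b) {h : ℝ → ℂ} (hh : MemLp h 2) (w : ℂ) :
    inner ℂ (Tmap hyp hφ hc (kv hyp hφ hc w)) (hh.toLp h) =
      (√Real.pi : ℂ)⁻¹ * ∫ t : ℝ, h t * conj (dBK a c r φ w t / dBE φ φq c t) := by
  rw [Tmap_apply, inner_toLp, ← integral_const_mul]
  congr 1
  funext t
  rw [Jmap_kv, map_mul, map_inv₀, conj_ofReal]
  ring

theorem fin_main (hyp : SLHyp a b p q r s) (hφ : RealEntireSolFam a b p q r s φ φq)
    (hc : c ∈ Ioo a b) (G : Lp ℂ 2 (volume.restrict (Ioo a c))) :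
    OfBoundedType (fun z => inner ℂ (kv hyp hφ hc z) G / dBE φ φq c z) ∧
    NonposMeanType (fun z => inner ℂ (kv hyp hφ hc z) G / dBE φ φq c z) := by
  constructor
  · have hJ := Jmap_memLp hyp hφ hc G
    have hJc := Jmap_cont hyp hφ hc G
    have hJ2 := memLp_unimod hJ (Eu_cont hyp hφ hc) (Eu_norm hyp hφ hc)
    have b1 := cauchyInt_bt hJc.measurable hJ
    have b2 := cauchyInt_bt ((Eu_cont hyp hφ hc).mul hJc).measurable hJ2
    have b3 : OfBoundedType (fun z => conj (dBE φ φq c (conj z)) / dBE φ φq c z) := by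
      refine OfBoundedType.of_bounded (C := 1) ?_ ?_
      · exact (dBE_sharp_diff hφ hc).differentiableOn.div (dBE_diff hφ hc).differentiableOn
          fun z hz => dBE_ne hyp hφ hc (le_of_lt hz)
      · intro z hz
        rw [norm_div]
        exact div_le_one_of_le₀ (dBE_sharp_le hyp hφ hc (le_of_lt hz)) (norm_nonneg _)
    have b4 := (b1.add ((b3.mul b2).const_mul (-1))).const_mul ((√Real.pi : ℂ)⁻¹ * (-I / 2))
    refine b4.congr fun z hz => ?_
    have hE := dBE_ne hyp hφ hc (le_of_lt hz)
    have e := fin_repro hyp hφ hc hJ z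
    rw [← Tmap_apply hyp hφ hc G, LinearIsometry.inner_map_map,
      repro_formula hyp hφ hc hz hJ] at e
    rw [e]
    simp only [Pi.mul_apply]
    generalize (∫ t : ℝ, Jmap hyp hφ hc G t / (t - z)) = A
    generalize (∫ t : ℝ, dBE φ φq c t / conj (dBE φ φq c t) * Jmap hyp hφ hc G t / (t - z)) = B
    field_simp
    ring
  · refine nonposMeanType_of_bounded (C := ‖G‖) fun y hy => ?_
    have him : ((y : ℂ) * I).im = y := by simp
    have hE := dBE_ne hyp hφ hc (z := (y : ℂ) * I) (by rw [him]; linarith)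
    have h1 := dBE_normSq hyp hφ hc ((y : ℂ) * I)
    rw [← kv_norm_sq hyp hφ hc, him] at h1
    have h2 : ‖kv hyp hφ hc (y * I)‖ ≤ ‖dBE φ φq c (y * I)‖ := by
      refine (sq_le_sq₀ (norm_nonneg _) (norm_nonneg _)).1 ?_
      nlinarith [sq_nonneg ‖kv hyp hφ hc (y * I)‖,
        sq_nonneg ‖conj (dBE φ φq c (conj ((y : ℂ) * I)))‖]
    rw [norm_div, div_le_iff₀ (norm_pos_iff.2 hE)]
    calc _ ≤ ‖kv hyp hφ hc (y * I)‖ * ‖G‖ := norm_inner_le_norm _ _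
      _ ≤ ‖dBE φ φq c (y * I)‖ * ‖G‖ := by gcongr
      _ = _ := mul_comm _ _

theorem fin_norm (hyp : SLHyp a b p q r s) (hφ : RealEntireSolFam a b p q r s φ φq)
    (hc : c ∈ Ioo a b) (G : Lp ℂ 2 (volume.restrict (Ioo a c))) :
    Integrable (fun t : ℝ => ‖inner ℂ (kv hyp hφ hc t) G‖ ^ 2 / ‖dBE φ φq c t‖ ^ 2) ∧
    (1 / Real.pi) * ∫ t : ℝ, ‖inner ℂ (kv hyp hφ hc t) G‖ ^ 2 / ‖dBE φ φq c t‖ ^ 2 = ‖G‖ ^ 2 := by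
  have e : ∀ t : ℝ, ‖inner ℂ (kv hyp hφ hc t) G‖ ^ 2 / ‖dBE φ φq c t‖ ^ 2 =
      Real.pi * ‖Jmap hyp hφ hc G t‖ ^ 2 := by
    intro t
    have hE := norm_ne_zero_iff.2 (E_real_ne hyp hφ hc t)
    have hp : ‖(√Real.pi : ℂ)‖ ^ 2 = Real.pi := by
      rw [Complex.norm_real, Real.norm_eq_abs, sq_abs, Real.sq_sqrt Real.pi_pos.le]
    rw [Jmap_apply, norm_div, norm_mul, div_pow, mul_pow, hp]
    have := Real.pi_ne_zero
    field_simp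
  simp only [e]
  have hJ := Jmap_memLp hyp hφ hc G
  refine ⟨((memLp_two_iff_integrable_sq_norm hJ.1).1 hJ).const_mul _, ?_⟩
  rw [integral_const_mul, ← mul_assoc, one_div, inv_mul_cancel₀ Real.pi_ne_zero, one_mul]
  have h1 := inner_toLp hJ hJ
  rw [← Tmap_apply, LinearIsometry.inner_map_map, inner_self_eq_norm_sq_to_K] at h1
  refine Complex.ofReal_injective ?_
  rw [← integral_complex_ofReal]
  push_cast
  refine Eq.trans ?_ h1.symm
  congr 1
  funext t
  rw [mul_comm, Complex.mul_conj, Complex.normSq_eq_norm_sq]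
  push_cast
  rfl

theorem hat_sub (hc : c ∈ Ioo a b) {f : ℝ → ℂ}
    (h0 : ∀ x, x ∉ Ioo a c → f x = 0) (z : ℂ) :
    hatT a b r φ f z = ∫ x in Ioo a c, φ z x * f x * (r x : ℂ) := by
  rw [hatT]
  exact (setIntegral_eq_of_subset_of_forall_sdiff_eq_zero measurableSet_Ioo
    (Ioo_subset_Ioo_right hc.2.le) fun x hx => by simp [h0 x hx.2])

theorem exists_Lp (hyp : SLHyp a b p q r s) (hφ : RealEntireSolFam a b p q r s φ φq)
    (hc : c ∈ Ioo a b) {f : ℝ → ℂ} (hfm : AEStronglyMeasurable f volume)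
    (h0 : ∀ x, x ∉ Ioo a c → f x = 0)
    (hf2 : IntegrableOn (fun x => ‖f x‖ ^ 2 * r x) (Ioo a b)) :
    ∃ G : Lp ℂ 2 (volume.restrict (Ioo a c)),
      (∀ z, hatT a b r φ f z = inner ℂ (kv hyp hφ hc z) G) ∧
      ‖G‖ ^ 2 = ∫ x in Ioo a b, ‖f x‖ ^ 2 * r x := by
  have hpos := rpos_sub hyp hc.2.le
  have hsub : Ioo a c ⊆ Ioo a b := Ioo_subset_Ioo_right hc.2.le
  have hgm : AEStronglyMeasurable (fun x => f x * (√(r x) : ℂ)) (volume.restrict (Ioo a c)) :=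
    hfm.restrict.mul (Complex.measurable_ofReal.comp hyp.mr.sqrt).aestronglyMeasurable
  have e : ∀ᵐ x ∂(volume.restrict (Ioo a c)), ‖f x * (√(r x) : ℂ)‖ ^ 2 = ‖f x‖ ^ 2 * r x := by
    filter_upwards [hpos] with x hx
    rw [norm_mul, mul_pow, Complex.norm_real, Real.norm_eq_abs, sq_abs, Real.sq_sqrt hx.le]
  have hg : MemLp (fun x => f x * (√(r x) : ℂ)) 2 (volume.restrict (Ioo a c)) := by
    rw [memLp_two_iff_integrable_sq_norm hgm]
    exact (hf2.mono_set hsub).congr (by filter_upwards [e] with x hx using hx.symm)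
  refine ⟨hg.toLp _, fun z => ?_, ?_⟩
  · rw [hat_sub hc h0, inner_kv_toLp]
    refine integral_congr_ae ?_
    filter_upwards [hpos] with x hx
    have : (r x : ℂ) = (√(r x) : ℂ) * (√(r x) : ℂ) := by
      exact_mod_cast (Real.mul_self_sqrt hx.le).symm
    rw [this]
    ring
  · have h1 := inner_toLp hg hg
    rw [inner_self_eq_norm_sq_to_K] at h1
    have h2 : ∫ x in Ioo a b, ‖f x‖ ^ 2 * r x = ∫ x in Ioo a c, ‖f x‖ ^ 2 * r x :=
      (setIntegral_eq_of_subset_of_forall_sdiff_eq_zero measurableSet_Ioo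
        hsub fun x hx => by simp [h0 x hx.2])
    rw [h2]
    refine Complex.ofReal_injective ?_
    rw [← integral_complex_ofReal]
    refine Eq.trans (by push_cast; rfl) (h1.trans ?_)
    refine integral_congr_ae ?_
    filter_upwards [e] with x hx
    rw [← hx, mul_comm, Complex.mul_conj, Complex.normSq_eq_norm_sq]

theorem hat_conj (hφ : RealEntireSolFam a b p q r s φ φq) (f : ℝ → ℂ) (z : ℂ) :
    conj (hatT a b r φ f (conj z)) = hatT a b r φ (fun x => conj (f x)) z := by
  rw [hatT, hatT, ← integral_conj]
  refine setIntegral_congr_fun measurableSet_Ioo fun x hx => ?_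
  simp only [(hφ.real z x hx).1, map_mul, conj_conj, conj_ofReal]

theorem fin_direct (hyp : SLHyp a b p q r s) (hφ : RealEntireSolFam a b p q r s φ φq)
    (hc : c ∈ Ioo a b) {f : ℝ → ℂ} (hfm : AEStronglyMeasurable f volume)
    (h0 : ∀ x, x ∉ Ioo a c → f x = 0)
    (hf2 : IntegrableOn (fun x => ‖f x‖ ^ 2 * r x) (Ioo a b)) :
    MemDB (dBE φ φq c) (hatT a b r φ f) ∧
      DBnormSq (dBE φ φq c) (hatT a b r φ f) = ∫ x in Ioo a b, ‖f x‖ ^ 2 * r x := by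
  obtain ⟨G, hG, hGn⟩ := exists_Lp hyp hφ hc hfm h0 hf2
  obtain ⟨G', hG', -⟩ := exists_Lp hyp hφ hc (f := fun x => conj (f x))
    (Complex.continuous_conj.comp_aestronglyMeasurable hfm) (fun x hx => by simp [h0 x hx])
    (by simpa only [RCLike.norm_conj] using hf2)
  have e := funext hG
  have h1 := fin_main hyp hφ hc G
  have h2 := fin_main hyp hφ hc G'
  have h3 := fin_norm hyp hφ hc G
  refine ⟨⟨?_, ?_, ?_, ?_, ?_, ?_⟩, ?_⟩
  · rw [e]; exact inner_kv_diff hyp hφ hc G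
  · simpa only [hG] using h3.1
  · simpa only [hG] using h1.1
  · simpa only [hG] using h1.2
  · simpa only [hat_conj hφ, hG'] using h2.1
  · simpa only [hat_conj hφ, hG'] using h2.2
  · rw [DBnormSq, ← hGn, ← h3.2]
    simp only [hG]

theorem fin_surj (hyp : SLHyp a b p q r s) (hφ : RealEntireSolFam a b p q r s φ φq)
    (hc : c ∈ Ioo a b) {F : ℂ → ℂ} (hF : MemDB (dBE φ φq c) F) :
    ∃ f : ℝ → ℂ,
      AEStronglyMeasurable f volume ∧ (∀ x, x ∉ Ioo a c → f x = 0) ∧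
      IntegrableOn (fun x => ‖f x‖ ^ 2 * r x) (Ioo a b) ∧ hatT a b r φ f = F := by
  obtain ⟨hd, hi, b1, m1, b2, m2⟩ := hF
  have hFc : Continuous fun t : ℝ => F t := hd.continuous.comp Complex.continuous_ofReal
  have hcont : Continuous fun t : ℝ => F t / dBE φ φq c t :=
    hFc.div (E_real_cont hφ hc) (E_real_ne hyp hφ hc)
  have hN : MemLp (fun t : ℝ => F t / dBE φ φq c t) 2 := by
    rw [memLp_two_iff_integrable_sq_norm hcont.aestronglyMeasurable]
    simpa only [norm_div, div_pow] using hi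
  have hd' : Differentiable ℂ fun z => conj (F (conj z)) := by
    intro z
    have := (hd (conj z)).conj_conj
    simpa [Function.comp_def] using this
  have hN' : MemLp (fun t : ℝ => conj (F (conj (t : ℂ))) / dBE φ φq c t) 2 := by
    have hc' : Continuous fun t : ℝ => conj (F (conj (t : ℂ))) / dBE φ φq c t :=
      (hd'.continuous.comp Complex.continuous_ofReal).div (E_real_cont hφ hc)
        (E_real_ne hyp hφ hc)
    refine hN.of_le hc'.aestronglyMeasurable (Eventually.of_forall fun t => ?_)
    simp only [conj_ofReal, norm_div, RCLike.norm_conj, le_refl]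
  have key : ∀ η : ℂ, 0 < η.im →
      ∫ t : ℝ, F t / dBE φ φq c t * conj (dBK a c r φ η t / dBE φ φq c t) = Real.pi * F η := by
    intro η hη
    have k1 := KE_cont hyp hφ hc hd
    have k2 := KE_cont hyp hφ hc hd'
    have c1 := (cauchy_of_boundedType k1.1 k1.2 hN b1 m1 hη).1
    have c2 := (cauchy_of_boundedType k2.1 k2.2 hN' b2 m2 hη).2
    simp only [conj_ofReal] at c2
    exact repro hyp hφ hc hη hN c1 c2
  have hh : MemLp (fun t : ℝ => (√Real.pi : ℂ)⁻¹ * (F t / dBE φ φq c t)) 2 := hN.const_mul _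
  set G := ContinuousLinearMap.adjoint (Tmap hyp hφ hc).toContinuousLinearMap (hh.toLp _) with hG
  obtain ⟨f, hfm, h0, hf2, hfz, -⟩ := exists_fun hyp hφ hc G
  refine ⟨f, hfm, h0, hf2, ?_⟩
  have e : hatT a b r φ f = fun z => inner ℂ (kv hyp hφ hc z) G :=
    funext fun z => (hat_sub hc h0 z).trans (hfz z)
  rw [e]
  refine entire_eq (inner_kv_diff hyp hφ hc G) hd fun z hz => ?_
  rw [hG, ContinuousLinearMap.adjoint_inner_right]
  refine (fin_repro hyp hφ hc hh z).trans ?_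
  simp only [mul_assoc]
  rw [integral_const_mul, key z hz, ← sqrtpi_sq]
  have := sqrtpi_ne
  field_simp

end final


/-- The transform `f ↦ f̂` restricted to `L²₀((a,c); r dx)` is a unitary map
onto the de Branges space `𝔅(c)`: it is isometric and surjective. -/
theorem transform_unitary_onto_deBranges {a b : ℝ} {p q r s : ℝ → ℝ}
    (hyp : SLHyp a b p q r s) {φ φq : ℂ → ℝ → ℂ}
    (hφ : RealEntireSolFam a b p q r s φ φq) {c : ℝ} (hc : c ∈ Set.Ioo a b) :
    (∀ f : ℝ → ℂ, AEStronglyMeasurable f volume → (∀ x, x ∉ Set.Ioo a c → f x = 0) →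
      IntegrableOn (fun x => ‖f x‖ ^ 2 * r x) (Set.Ioo a b) →
      MemDB (dBE φ φq c) (hatT a b r φ f) ∧
        DBnormSq (dBE φ φq c) (hatT a b r φ f) = ∫ x in Set.Ioo a b, ‖f x‖ ^ 2 * r x) ∧
    ∀ F : ℂ → ℂ, MemDB (dBE φ φq c) F → ∃ f : ℝ → ℂ,
      AEStronglyMeasurable f volume ∧ (∀ x, x ∉ Set.Ioo a c → f x = 0) ∧
      IntegrableOn (fun x => ‖f x‖ ^ 2 * r x) (Set.Ioo a b) ∧ hatT a b r φ f = F := by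
  exact ⟨fun f hfm h0 hf2 => fin_direct hyp hφ hc hfm h0 hf2, fun F hF => fin_surj hyp hφ hc hF⟩
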